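/- Let Ω ⊂ (0,1) be a lacunary sequence converging to 0, let (X,𝒜,μ) be a probability space, let S,T : X → X be commuting, invertible, measure-preserving, ergodic transformations, and let {R_n}_{n∈ℕ} be a process such that for every n ∈ ℕ the slope of R_n belongs to Ω. Then the maximal operator M* f = sup_{n∈ℕ} M_n |f| is of weak-type (p,p) for every 1 < p < ∞. -/

import Mathlib

open MeasureTheory Filter Topology Set
open scoped ENNReal Pointwise BigOperators

noncomputable section

/-- A (possibly tilted) closed rectangle in the plane, described by a corner,
an angle, and two positive side lengths. -/
structure Rect where
  corner : ℝ × ℝ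
  angle : ℝ
  len1 : ℝ
  len2 : ℝ
  len1_pos : 0 < len1
  len2_pos : 0 < len2

namespace Rect

/-- The set of points of a rectangle. -/
def carrier (R : Rect) : Set (ℝ × ℝ) :=
  {p | ∃ s t : ℝ, s ∈ Icc (0 : ℝ) R.len1 ∧ t ∈ Icc (0 : ℝ) R.len2 ∧
    p = R.corner + s • (Real.cos R.angle, Real.sin R.angle) +
      t • (-Real.sin R.angle, Real.cos R.angle)}

/-- `l(R)`: the length of the shortest side. -/
def shortSide (R : Rect) : ℝ := min R.len1 R.len2

/-- `L(R)`: the length of the longest side. -/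
def longSide (R : Rect) : ℝ := max R.len1 R.len2

/-- The slope of a rectangle: the tangent of the angle formed between its longest
side and the horizontal axis (canonical choice for squares). -/
def slope (R : Rect) : ℝ :=
  if R.len2 ≤ R.len1 then Real.tan R.angle else Real.tan (R.angle + Real.pi / 2)

end Rect

/-- The integer lattice points lying in a planar set. -/
def latticePts (F : Set (ℝ × ℝ)) : Set (ℤ × ℤ) := {p | ((p.1 : ℝ), (p.2 : ℝ)) ∈ F}

/-- `#(F ∩ ℤ²)`: the number of integer lattice points in `F`. -/
def latticeCount (F : Set (ℝ × ℝ)) : ℕ := (latticePts F).ncard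

/-- A process: a sequence of rectangles containing `(0,0)` whose shortest sides
tend to infinity. -/
def IsProcess (R : ℕ → Rect) : Prop :=
  (∀ n, ((0 : ℝ), (0 : ℝ)) ∈ (R n).carrier) ∧
    Tendsto (fun n => (R n).shortSide) atTop atTop

variable {X : Type*} [MeasurableSpace X]

/-- The ergodic average `M_R f(x) = (1/#(R ∩ ℤ²)) ∑_{(i,j) ∈ R ∩ ℤ²} f(S^i T^j x)`. -/
def ergAvg (S T : X ≃ᵐ X) (R : Rect) (f : X → ℝ) (x : X) : ℝ :=
  (latticeCount R.carrier : ℝ)⁻¹ *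
    ∑ᶠ p ∈ latticePts R.carrier, f ((S.toEquiv ^ p.1) ((T.toEquiv ^ p.2) x))

/-- The maximal operator `M* f = sup_n M_n |f|`. -/
def maxOp (S T : X ≃ᵐ X) (R : ℕ → Rect) (f : X → ℝ) (x : X) : ℝ≥0∞ :=
  ⨆ n, ENNReal.ofReal (ergAvg S T (R n) (fun y => |f y|) x)

/-- The maximal operator `M'* f = sup_n |M_n f|`. -/
def maxOpAbs (S T : X ≃ᵐ X) (R : ℕ → Rect) (f : X → ℝ) (x : X) : ℝ≥0∞ :=
  ⨆ n, ENNReal.ofReal |ergAvg S T (R n) f x|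

/-- `S, T` form a pair of commuting, invertible, measure-preserving, ergodic
transformations of the probability space `(X, μ)`. -/
structure ErgodicSetup (μ : Measure X) (S T : X ≃ᵐ X) : Prop where
  prob : IsProbabilityMeasure μ
  measPres_S : MeasurePreserving (⇑S) μ μ
  measPres_T : MeasurePreserving (⇑T) μ μ
  comm : ∀ x, S (T x) = T (S x)
  erg_S : Ergodic (⇑S) μ
  erg_T : Ergodic (⇑T) μ

/-- An operator `M` is of weak-type `(p,p)`. -/
def IsWeakType (μ : Measure X) (M : (X → ℝ) → X → ℝ≥0∞) (p : ℝ) : Prop :=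
  ∃ C : ℝ, 0 < C ∧ ∀ f : X → ℝ, MemLp f (ENNReal.ofReal p) μ → ∀ lam : ℝ, 0 < lam →
    μ {x | ENNReal.ofReal lam < M f x} ≤
      ENNReal.ofReal (C * ((eLpNorm f (ENNReal.ofReal p) μ).toReal / lam) ^ p)

/-- The averages `M_n f` converge almost everywhere. -/
def AEConverges (μ : Measure X) (S T : X ≃ᵐ X) (R : ℕ → Rect) (f : X → ℝ) : Prop :=
  ∀ᵐ x ∂μ, ∃ L : ℝ, Tendsto (fun n => ergAvg S T (R n) f x) atTop (𝓝 L)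

/-- The maximal operator `M*` satisfies a Tauberian condition. -/
def ErgTauberian (μ : Measure X) (S T : X ≃ᵐ X) (R : ℕ → Rect) : Prop :=
  ∀ lam : ℝ, 0 < lam → lam < 1 → ∃ C : ℝ, 0 < C ∧ ∀ A : Set X, MeasurableSet A →
    0 < μ A → μ A < ⊤ →
    μ {x | ENNReal.ofReal lam < maxOp S T R (A.indicator fun _ => (1 : ℝ)) x} ≤
      ENNReal.ofReal C * μ A

/-- A `p`-good process: on every probability space with a commuting, invertible,
measure-preserving, ergodic pair, the averages converge a.e. for every `f ∈ L^p`. -/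
def IsGoodProcess (R : ℕ → Rect) (p : ℝ≥0∞) : Prop :=
  ∀ (Y : Type) [MeasurableSpace Y], ∀ (μ : Measure Y) (S T : Y ≃ᵐ Y),
    ErgodicSetup μ S T → ∀ f : Y → ℝ, MemLp f p μ → AEConverges μ S T R f

/-- The discrete average `A_R φ(k,l)`. -/
def discAvg (R : Rect) (φ : ℤ × ℤ → ℝ) (kl : ℤ × ℤ) : ℝ :=
  (latticeCount R.carrier : ℝ)⁻¹ *
    ∑ᶠ p ∈ latticePts R.carrier, φ (kl.1 + p.1, kl.2 + p.2)

/-- The discrete maximal operator `A* φ = sup_n A_n |φ|`. -/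
def discMaxOp (R : ℕ → Rect) (φ : ℤ × ℤ → ℝ) (kl : ℤ × ℤ) : ℝ≥0∞ :=
  ⨆ n, ENNReal.ofReal (discAvg (R n) (fun q => |φ q|) kl)

/-- The `N`-truncated discrete maximal operator `A*_N φ = sup_{n ≥ N} A_n |φ|`. -/
def discMaxOpFrom (R : ℕ → Rect) (N : ℕ) (φ : ℤ × ℤ → ℝ) (kl : ℤ × ℤ) : ℝ≥0∞ :=
  ⨆ n, ⨆ (_ : N ≤ n), ENNReal.ofReal (discAvg (R n) (fun q => |φ q|) kl)

def lpSum (φ : ℤ × ℤ → ℝ) (p : ℝ) : ℝ≥0∞ := ∑' q : ℤ × ℤ, ENNReal.ofReal (|φ q| ^ p)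

/-- `φ ∈ ℓ^p(ℤ²)`. -/
def Memlp (φ : ℤ × ℤ → ℝ) (p : ℝ) : Prop := lpSum φ p < ⊤

/-- The `ℓ^p(ℤ²)` norm. -/
def lpNorm (φ : ℤ × ℤ → ℝ) (p : ℝ) : ℝ≥0∞ := lpSum φ p ^ (1 / p)

/-- The `ℓ^p(ℤ²)` norm of an `ℝ≥0∞`-valued function. -/
def lpNormE (F : ℤ × ℤ → ℝ≥0∞) (p : ℝ) : ℝ≥0∞ := (∑' q : ℤ × ℤ, F q ^ p) ^ (1 / p)

/-- A discrete operator `B` is of weak-type `(p,p)` on `ℓ^p(ℤ²)`. -/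
def IsDiscWeakType (B : (ℤ × ℤ → ℝ) → ℤ × ℤ → ℝ≥0∞) (p : ℝ) : Prop :=
  ∃ C : ℝ, 0 < C ∧ ∀ φ : ℤ × ℤ → ℝ, Memlp φ p → ∀ lam : ℝ, 0 < lam →
    Measure.count {kl : ℤ × ℤ | ENNReal.ofReal lam ≤ B φ kl} ≤
      ENNReal.ofReal (C * ((lpNorm φ p).toReal / lam) ^ p)

/-- The discrete maximal operator associated with `R` satisfies a Tauberian condition. -/
def DiscTauberian (R : ℕ → Rect) : Prop :=
  ∀ lam : ℝ, 0 < lam → ∃ C : ℝ, 0 < C ∧ ∀ E : Finset (ℤ × ℤ), E.Nonempty →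
    Measure.count {kl : ℤ × ℤ |
        ENNReal.ofReal lam ≤ discMaxOp R (fun q => if q ∈ E then (1 : ℝ) else 0) kl} ≤
      ENNReal.ofReal C * (E.card : ℝ≥0∞)

/-- Vertices and sets of the geometric construction 1 (with `A = (1,0)`,
`B = (0,b)`, `C = (0,c)`). -/
def ptA : ℝ × ℝ := (1, 0)
def ptB (b : ℝ) : ℝ × ℝ := (0, b)
def ptC (c : ℝ) : ℝ × ℝ := (0, c)
def ptB' (b : ℝ) : ℝ × ℝ := ptA + (3 / 2 : ℝ) • (ptB b - ptA)
def ptC' (c : ℝ) : ℝ × ℝ := ptA + (3 / 2 : ℝ) • (ptC c - ptA)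

/-- The full triangle `ABC`. -/
def triABC (b c : ℝ) : Set (ℝ × ℝ) := convexHull ℝ {ptA, ptB b, ptC c}

/-- The full trapezium `BCC'B'`. -/
def trapV (b c : ℝ) : Set (ℝ × ℝ) := convexHull ℝ {ptB b, ptC c, ptC' c, ptB' b}

/-- The rectangle `P`: the smallest rectangle having `AC'` as one of its sides and
containing the triangle `AB'C'`, translated so that its center is the origin.
Its sides have directions `(-1,c)/√(1+c²)` and `(c,1)/√(1+c²)`, with half-lengths
`(3/4)√(1+c²)` and `(3/4)(b-c)/√(1+c²)`. -/
def rectP (b c : ℝ) : Set (ℝ × ℝ) :=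
  {p : ℝ × ℝ |
    |(-p.1 + c * p.2)| / Real.sqrt (1 + c ^ 2) ≤ (3 / 4) * Real.sqrt (1 + c ^ 2) ∧
    |(c * p.1 + p.2)| / Real.sqrt (1 + c ^ 2) ≤ (3 / 4) * (b - c) / Real.sqrt (1 + c ^ 2)}

/-- Horizontal translation of a planar set by `t`. -/
def hTranslate (t : ℝ) (F : Set (ℝ × ℝ)) : Set (ℝ × ℝ) :=
  (fun p : ℝ × ℝ => (p.1 + t, p.2)) '' F

/-- The triangle `Δ_k` with vertices `A = (0,1)`, `B_{k-1} = (u_{k-1}, 0)`,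
`B_k = (u_k, 0)`. -/
def triPerron (u : ℕ → ℝ) (k : ℕ) : Set (ℝ × ℝ) :=
  convexHull ℝ {((0 : ℝ), (1 : ℝ)), ((u (k - 1) : ℝ), (0 : ℝ)), ((u k : ℝ), (0 : ℝ))}

/-- The symmetric difference `Δ_n := R_n △ (R_n + (0,1))`. -/
def symmDiffTranslate (R : Rect) : Set (ℝ × ℝ) :=
  symmDiff R.carrier ((fun q : ℝ × ℝ => q + ((0 : ℝ), (1 : ℝ))) '' R.carrier)


set_option linter.unusedSectionVars false
set_option linter.unusedVariables false

/-! ## Exponential measure -/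

def EE : Measure ℝ := (volume.restrict (Ioi (0:ℝ))).withDensity (fun t => ENNReal.ofReal (Real.exp (-t)))

lemma EE_integral {E : Type*} [NormedAddCommGroup E] [NormedSpace ℝ E] (g : ℝ → E) :
    ∫ t, g t ∂EE = ∫ t in Ioi (0:ℝ), Real.exp (-t) • g t := by
  unfold EE
  rw [integral_withDensity_eq_integral_toReal_smul (by fun_prop) (by simp)]
  congr 1; ext t
  rw [ENNReal.toReal_ofReal (Real.exp_pos _).le]

instance EE_prob : IsProbabilityMeasure EE := by
  constructor
  unfold EE
  rw [withDensity_apply _ MeasurableSet.univ, Measure.restrict_univ,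
    ← ofReal_integral_eq_lintegral_ofReal]
  · rw [integral_exp_neg_Ioi_zero]; simp
  · exact (integrableOn_exp_neg_Ioi 0)
  · exact Eventually.of_forall (fun t => (Real.exp_pos _).le)

lemma EE_ae_pos : ∀ᵐ t ∂EE, 0 < t := by
  unfold EE
  have h : ∀ᵐ t ∂(volume.restrict (Ioi (0:ℝ))), 0 < t := ae_restrict_mem measurableSet_Ioi
  exact (withDensity_absolutelyContinuous _ _).ae_le h

/-- law of `t • w` -/
def mu (w : ℝ × ℝ) : Measure (ℝ × ℝ) := EE.map (fun t => t • w)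

instance mu_prob (w : ℝ × ℝ) : IsProbabilityMeasure (mu w) :=
  Measure.isProbabilityMeasure_map (by fun_prop)

lemma charFunDual_mu (w : ℝ × ℝ) (L : StrongDual ℝ (ℝ × ℝ)) :
    charFunDual (mu w) L = 1 / (1 - L w * Complex.I) := by
  rw [charFunDual_apply, mu, integral_map (by fun_prop)
    (Continuous.aestronglyMeasurable (by fun_prop)), EE_integral]
  have h := integral_exp_mul_complex_Ioi (a := -1 + L w * Complex.I) (by simp) 0
  calc _ = ∫ x : ℝ in Ioi 0, Complex.exp ((-1 + L w * Complex.I) * x) := by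
        congr 1; ext t
        rw [Complex.real_smul, Complex.ofReal_exp, ← Complex.exp_add]
        congr 1; simp; ring
    _ = _ := by
        rw [h]
        have h1 : (-1 + L w * Complex.I) = -(1 - L w * Complex.I : ℂ) := by ring
        rw [h1, neg_div_neg_eq]; simp

lemma one_sub_ne (L : StrongDual ℝ (ℝ × ℝ)) (w : ℝ × ℝ) : (1 - L w * Complex.I : ℂ) ≠ 0 := by
  intro h
  have := congrArg Complex.re h
  simp at this

/-- main measure identity -/
lemma mu_identity (c : NNReal) (v w : ℝ × ℝ) :
    c • (mu ((c:ℝ) • (v + w)) ∗ mu v + mu ((c:ℝ) • (v + w)) ∗ mu w)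
      + mu ((c:ℝ) • (v + w)) ∗ (mu v ∗ mu w) =
    mu v ∗ mu w + (2 * c) • (mu ((c:ℝ) • (v + w)) ∗ (mu v ∗ mu w)) := by
  apply Measure.ext_of_charFunDual
  ext L
  have hadd : ∀ (μ ν : Measure (ℝ × ℝ)) [IsFiniteMeasure μ] [IsFiniteMeasure ν],
      charFunDual (μ + ν) L = charFunDual μ L + charFunDual ν L := by
    intro μ ν _ _
    simp only [charFunDual_apply]
    refine integral_add_measure ?_ ?_
    all_goals
      refine Integrable.of_bound (C := 1) (Continuous.aestronglyMeasurable (by fun_prop)) ?_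
      exact Eventually.of_forall fun x => by rw [Complex.norm_exp_ofReal_mul_I]
  have hsm : ∀ (d : NNReal) (μ : Measure (ℝ × ℝ)),
      charFunDual (d • μ) L = d * charFunDual μ L := by
    intro d μ
    simp only [charFunDual_apply]
    rw [integral_smul_nnreal_measure]
    simp [NNReal.smul_def]
  rw [hadd, hsm, hadd, hadd, hsm]
  simp only [charFunDual_conv, charFunDual_mu]
  have h1 := one_sub_ne L v
  have h2 := one_sub_ne L w
  have h3 := one_sub_ne L ((c:ℝ) • (v+w))
  have e : (L ((c:ℝ) • (v+w)) : ℂ) = c * (L v + L w) := by simp [mul_add]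
  rw [e] at h3 ⊢
  field_simp
  push_cast
  ring

section flow

variable {G : Type*} [AddCommGroup G] [TopologicalSpace G] [IsTopologicalAddGroup G]
  [CompactSpace G]

/-- translation -/
def tr (φ : ℝ × ℝ →ₜ+ G) (x : ℝ × ℝ) : C(G, ℝ) →L[ℝ] C(G, ℝ) :=
  LinearMap.mkContinuous
    { toFun := fun f => f.comp ⟨fun g => g + φ x, by fun_prop⟩
      map_add' := fun _ _ => rfl
      map_smul' := fun _ _ => rfl } 1 (fun f => by
        rw [one_mul, ContinuousMap.norm_le _ (norm_nonneg _)]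
        intro g
        exact f.norm_coe_le_norm _)

@[simp] lemma tr_apply (φ : ℝ × ℝ →ₜ+ G) (x : ℝ × ℝ) (f : C(G, ℝ)) (g : G) :
    tr φ x f g = f (g + φ x) := rfl

lemma norm_tr (φ : ℝ × ℝ →ₜ+ G) (x : ℝ × ℝ) (f : C(G, ℝ)) : ‖tr φ x f‖ ≤ ‖f‖ := by
  rw [ContinuousMap.norm_le _ (norm_nonneg _)]
  intro g
  exact f.norm_coe_le_norm _

lemma tr_add (φ : ℝ × ℝ →ₜ+ G) (x y : ℝ × ℝ) (f : C(G, ℝ)) :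
    tr φ (x + y) f = tr φ x (tr φ y f) := by
  ext g; simp [add_assoc]

lemma tr_cont (φ : ℝ × ℝ →ₜ+ G) (f : C(G, ℝ)) : Continuous (fun x => tr φ x f) := by
  have : (fun x => tr φ x f) =
      (ContinuousMap.curry ⟨fun p : (ℝ × ℝ) × G => f (p.2 + φ p.1), by fun_prop⟩) := by
    ext x g; rfl
  rw [this]; exact ContinuousMap.continuous _

lemma tr_int (φ : ℝ × ℝ →ₜ+ G) (f : C(G, ℝ)) (m : Measure (ℝ × ℝ)) [IsFiniteMeasure m] :
    Integrable (fun x => tr φ x f) m :=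
  Integrable.of_bound (C := ‖f‖) (tr_cont φ f).aestronglyMeasurable
    (Eventually.of_forall fun x => norm_tr φ x f)

/-- averaging against a finite measure -/
def mop (φ : ℝ × ℝ →ₜ+ G) (m : Measure (ℝ × ℝ)) [IsFiniteMeasure m] :
    C(G, ℝ) →ₗ[ℝ] C(G, ℝ) where
  toFun f := ∫ x, tr φ x f ∂m
  map_add' f h := by
    simp only [map_add]
    exact integral_add (tr_int φ f m) (tr_int φ h m)
  map_smul' c f := by
    simp only [map_smul]
    exact integral_smul c _

lemma mop_def (φ : ℝ × ℝ →ₜ+ G) (m : Measure (ℝ × ℝ)) [IsFiniteMeasure m] (f : C(G, ℝ)) :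
    mop φ m f = ∫ x, tr φ x f ∂m := rfl

lemma mop_conv (φ : ℝ × ℝ →ₜ+ G) (m n : Measure (ℝ × ℝ)) [IsFiniteMeasure m]
    [IsFiniteMeasure n] : mop φ (m ∗ n) = mop φ m * mop φ n := by
  ext1 f
  rw [Module.End.mul_apply, mop_def, mop_def, mop_def]
  rw [integral_conv (tr_int φ f _)]
  congr 1; ext1 x
  rw [← ContinuousLinearMap.integral_comp_comm _ (tr_int φ f n)]
  simp only [tr_add]

lemma mop_add (φ : ℝ × ℝ →ₜ+ G) (m n : Measure (ℝ × ℝ)) [IsFiniteMeasure m]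
    [IsFiniteMeasure n] : mop φ (m + n) = mop φ m + mop φ n := by
  ext1 f
  rw [LinearMap.add_apply, mop_def, mop_def, mop_def]
  exact integral_add_measure (tr_int φ f _) (tr_int φ f _)

lemma mop_smul (φ : ℝ × ℝ →ₜ+ G) (c : NNReal) (m : Measure (ℝ × ℝ)) [IsFiniteMeasure m] :
    mop φ (c • m) = (c : ℝ) • mop φ m := by
  ext1 f
  rw [LinearMap.smul_apply, mop_def, mop_def]
  exact integral_smul_nnreal_measure _ _

/-- exponential average along `w` -/
def AA (φ : ℝ × ℝ →ₜ+ G) (w : ℝ × ℝ) : Module.End ℝ C(G, ℝ) := mop φ (mu w)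

lemma AA_apply (φ : ℝ × ℝ →ₜ+ G) (w : ℝ × ℝ) (f : C(G, ℝ)) (g : G) :
    AA φ w f g = ∫ t, f (g + φ (t • w)) ∂EE := by
  unfold AA
  rw [mop_def, ContinuousMap.integral_apply (tr_int φ f _), mu,
    integral_map (by fun_prop) (Continuous.aestronglyMeasurable (by simp only [tr_apply]; fun_prop))]
  rfl

lemma AA_int (φ : ℝ × ℝ →ₜ+ G) (w : ℝ × ℝ) (f : C(G, ℝ)) (g : G) :
    Integrable (fun t : ℝ => f (g + φ (t • w))) EE :=
  Integrable.of_bound (C := ‖f‖) (Continuous.aestronglyMeasurable (by fun_prop))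
    (Eventually.of_forall fun x => f.norm_coe_le_norm _)

lemma AA_comm (φ : ℝ × ℝ →ₜ+ G) (v w : ℝ × ℝ) : AA φ v * AA φ w = AA φ w * AA φ v := by
  unfold AA
  rw [← mop_conv, ← mop_conv]
  simp only [Measure.conv_comm (mu v) (mu w)]

lemma AA_zero (φ : ℝ × ℝ →ₜ+ G) : AA φ 0 = 1 := by
  ext f g
  rw [AA_apply]; simp

/-- (★) -/
lemma AA_star (φ : ℝ × ℝ →ₜ+ G) (c : ℝ) (hc : 0 ≤ c) (v w : ℝ × ℝ) :
    c • (AA φ (c • (v + w)) * AA φ v + AA φ (c • (v + w)) * AA φ w)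
      + AA φ (c • (v + w)) * (AA φ v * AA φ w) =
    AA φ v * AA φ w + (2 * c) • (AA φ (c • (v + w)) * (AA φ v * AA φ w)) := by
  lift c to NNReal using hc
  have h := mu_identity c v w
  have h2 : mop φ (c • (mu ((c:ℝ) • (v + w)) ∗ mu v + mu ((c:ℝ) • (v + w)) ∗ mu w)
      + mu ((c:ℝ) • (v + w)) ∗ (mu v ∗ mu w)) =
      mop φ (mu v ∗ mu w + (2 * c) • (mu ((c:ℝ) • (v + w)) ∗ (mu v ∗ mu w))) := by
    simp only [h]
  simp only [mop_add, mop_smul, mop_conv, NNReal.coe_mul, NNReal.coe_ofNat] at h2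
  exact h2

lemma AA_mono (φ : ℝ × ℝ →ₜ+ G) (w : ℝ × ℝ) {f h : C(G, ℝ)} (hfh : ∀ g, f g ≤ h g) (g : G) :
    AA φ w f g ≤ AA φ w h g := by
  rw [AA_apply, AA_apply]
  exact integral_mono (AA_int φ w f g) (AA_int φ w h g) (fun t => hfh _)

lemma AA_const (φ : ℝ × ℝ →ₜ+ G) (w : ℝ × ℝ) (c : ℝ) (g : G) :
    AA φ w (ContinuousMap.const G c) g = c := by
  rw [AA_apply]; simp

lemma AA_vec (φ : ℝ × ℝ →ₜ+ G) (w : ℝ × ℝ) (f : C(G, ℝ)) :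
    AA φ w f = ∫ t, tr φ (t • w) f ∂EE := by
  rw [AA, mop_def, mu, integral_map (by fun_prop) (tr_cont φ f).aestronglyMeasurable]

lemma AA_cont (φ : ℝ × ℝ →ₜ+ G) (f : C(G, ℝ)) : Continuous (fun w => AA φ w f) := by
  simp only [AA_vec]
  refine continuous_of_dominated (bound := fun _ => ‖f‖) ?_ ?_ (integrable_const _) ?_
  · intro w
    exact Continuous.aestronglyMeasurable ((tr_cont φ f).comp (by fun_prop : Continuous fun t : ℝ => t • w))
  · intro w
    exact Eventually.of_forall fun t => norm_tr φ _ f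
  · exact Eventually.of_forall fun t => (tr_cont φ f).comp (by fun_prop : Continuous fun w : ℝ × ℝ => t • w)

lemma AA_approx (φ : ℝ × ℝ →ₜ+ G) (f : C(G, ℝ)) (w : ℝ × ℝ) {ε : ℝ} (hε : 0 < ε) :
    ∃ τ0 : ℝ, 0 < τ0 ∧ ∀ τ : ℝ, 0 < τ → τ ≤ τ0 → ‖AA φ (τ • w) f - f‖ < ε := by
  have hc : Continuous (fun τ : ℝ => AA φ (τ • w) f) := (AA_cont φ f).comp (by fun_prop)
  have h0 := (Metric.continuous_iff.1 hc) 0 ε hε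
  obtain ⟨δ, hδ, h⟩ := h0
  refine ⟨δ / 2, by positivity, fun τ h1 h2 => ?_⟩
  have := h τ (by rw [Real.dist_eq, sub_zero, abs_of_pos h1]; linarith)
  rw [dist_eq_norm] at this
  simpa [AA_zero] using this

lemma AA_shift (φ : ℝ × ℝ →ₜ+ G) (w : ℝ × ℝ) (v : C(G, ℝ)) (hv : ∀ g, 0 ≤ v g) (g : G) (t : ℝ)
    (ht : 0 ≤ t) : Real.exp (-t) * AA φ (-w) v g ≤ AA φ (-w) v (g + φ (t • w)) := by
  rw [AA_apply, AA_apply, EE_integral, EE_integral, ← integral_const_mul]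
  have hint : IntegrableOn (fun s : ℝ => Real.exp (-s) • v (g + φ (t • w) + φ (s • -w))) (Ioi 0) := by
    have h1 : IntegrableOn (fun s : ℝ => Real.exp (-s) * ‖v‖) (Ioi 0) :=
      (integrableOn_exp_neg_Ioi 0).mul_const _
    refine Integrable.mono' h1 (Continuous.aestronglyMeasurable (by fun_prop)) ?_
    refine Eventually.of_forall fun s => ?_
    rw [norm_smul, Real.norm_of_nonneg (Real.exp_pos _).le]
    exact mul_le_mul_of_nonneg_left (v.norm_coe_le_norm _) (Real.exp_pos _).le
  calc _ = ∫ s in Ioi (0:ℝ), (fun s => Real.exp (-s) • v (g + φ (t • w) + φ (s • -w))) (s + t) := by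
        congr 1; ext s
        have e : g + φ (t • w) + φ ((s + t) • -w) = g + φ (s • -w) := by
          rw [add_assoc, ← map_add]; congr 2; module
        simp only [e, smul_eq_mul]
        rw [neg_add, Real.exp_add]; ring
    _ = ∫ s in Ioi (0 + t : ℝ), Real.exp (-s) • v (g + φ (t • w) + φ (s • -w)) := by
        rw [← integral_indicator measurableSet_Ioi, ← integral_indicator measurableSet_Ioi,
          ← integral_add_right_eq_self ((Ioi (0 + t)).indicator _) t]
        congr 1; ext s
        by_cases h : 0 < s
        · rw [indicator_of_mem (by simpa using h), indicator_of_mem (by simpa using h)]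
        · rw [indicator_of_notMem (by simpa using h), indicator_of_notMem (by simpa using h)]
    _ ≤ _ := by
        refine setIntegral_mono_set hint (Eventually.of_forall fun s => ?_)
          (Eventually.of_forall fun s hs => ?_)
        · exact smul_nonneg (Real.exp_pos _).le (hv _)
        · have : (0:ℝ) + t < s := hs
          show 0 < s
          linarith

lemma AA_dual (φ : ℝ × ℝ →ₜ+ G) (w : ℝ × ℝ) (v vi : C(G, ℝ)) (hv : ∀ g, 0 < v g)
    (hvi : ∀ g, vi g = (v g)⁻¹) (C : ℝ) (hC : ∀ g, AA φ (-((2:ℝ) • w)) v g ≤ C * v g) (g : G) :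
    AA φ w vi g * AA φ (-((2:ℝ) • w)) v g ≤ 2 * C := by
  set B := AA φ (-((2:ℝ) • w)) v g with hB
  rw [AA_apply, ← integral_mul_const, EE_integral]
  have key : ∀ t : ℝ, 0 < t → vi (g + φ (t • w)) * B ≤ C * Real.exp (t / 2) := by
    intro t ht
    have h1 := AA_shift φ ((2:ℝ) • w) v (fun g => (hv g).le) g (t / 2) (by linarith)
    have e : (t / 2) • (2:ℝ) • w = t • w := by rw [smul_smul]; congr 1; ring
    rw [e] at h1
    have h2 := h1.trans (hC _)
    rw [hvi, inv_mul_le_iff₀ (hv _)]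
    rw [← hB, Real.exp_neg, inv_mul_le_iff₀ (Real.exp_pos _)] at h2
    linarith
  have hint2 : IntegrableOn (fun t : ℝ => C * Real.exp (-(1/2) * t)) (Ioi 0) :=
    ((exp_neg_integrableOn_Ioi 0 (by norm_num)).const_mul _)
  have h4 : ∫ t : ℝ in Ioi 0, C * Real.exp (-(1/2) * t) = 2 * C := by
    rw [integral_const_mul]
    have := integral_exp_mul_Ioi (a := -(1/2)) (by norm_num) 0
    rw [this]; simp; ring
  rw [← h4]
  refine setIntegral_mono_on ?_ hint2 measurableSet_Ioi fun t ht => ?_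
  · have h1 : IntegrableOn (fun s : ℝ => Real.exp (-s) * (‖vi‖ * |B|)) (Ioi 0) :=
      (integrableOn_exp_neg_Ioi 0).mul_const _
    refine Integrable.mono' h1 (Continuous.aestronglyMeasurable (by fun_prop)) ?_
    refine Eventually.of_forall fun s => ?_
    rw [norm_smul, Real.norm_of_nonneg (Real.exp_pos _).le, norm_mul, Real.norm_eq_abs B]
    gcongr
    exact (vi.norm_coe_le_norm _)
  · have := key t ht
    calc Real.exp (-t) • (vi (g + φ (t • w)) * B) ≤ Real.exp (-t) * (C * Real.exp (t/2)) :=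
          mul_le_mul_of_nonneg_left this (Real.exp_pos _).le
      _ = _ := by
          rw [mul_left_comm, ← Real.exp_add]; congr 2; ring

variable [MeasurableSpace G] [BorelSpace G] (ν : Measure G) [IsProbabilityMeasure ν]

lemma C_int (f : C(G, ℝ)) : Integrable f ν :=
  Integrable.of_bound (C := ‖f‖) f.continuous.measurable.aestronglyMeasurable
    (Eventually.of_forall fun x => f.norm_coe_le_norm _)

/-- integral functional -/
def Iν : C(G, ℝ) →L[ℝ] ℝ :=
  LinearMap.mkContinuous
    { toFun := fun f => ∫ g, f g ∂ν
      map_add' := fun f h => integral_add (C_int ν f) (C_int ν h)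
      map_smul' := fun c f => integral_const_mul c _ } 1 (fun f => by
        rw [one_mul]
        refine (norm_integral_le_of_norm_le_const (C := ‖f‖)
          (Eventually.of_forall fun x => f.norm_coe_le_norm _)).trans ?_
        simp)

lemma Iν_apply (f : C(G, ℝ)) : Iν ν f = ∫ g, f g ∂ν := rfl

variable [ν.IsAddLeftInvariant]

lemma AA_adj (φ : ℝ × ℝ →ₜ+ G) (w : ℝ × ℝ) (f h : C(G, ℝ)) :
    ∫ g, (AA φ w f) g * h g ∂ν = ∫ g, f g * (AA φ (-w) h) g ∂ν := by
  have hmul : ∀ (a : C(G,ℝ)), ∃ L : C(G,ℝ) →L[ℝ] ℝ, ∀ b, L b = ∫ g, b g * a g ∂ν := fun a =>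
    ⟨(Iν ν).comp ((ContinuousLinearMap.mul ℝ C(G,ℝ)).flip a), fun b => rfl⟩
  obtain ⟨L1, hL1⟩ := hmul h
  obtain ⟨L2, hL2⟩ := hmul f
  have e1 : ∫ g, (AA φ w f) g * h g ∂ν = ∫ x, L1 (tr φ x f) ∂(mu w) := by
    rw [← hL1, AA, mop_def, L1.integral_comp_comm (tr_int φ f _)]
  have e2 : ∫ g, f g * (AA φ (-w) h) g ∂ν = ∫ x, L2 (tr φ x h) ∂(mu (-w)) := by
    have : ∫ g, f g * (AA φ (-w) h) g ∂ν = L2 (AA φ (-w) h) := by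
      rw [hL2]; congr 1; ext g; ring
    rw [this, AA, mop_def, L2.integral_comp_comm (tr_int φ h _)]
  have c1 : Continuous (fun x => L1 (tr φ x f)) := L1.continuous.comp (tr_cont φ f)
  have c2 : Continuous (fun x => L2 (tr φ x h)) := L2.continuous.comp (tr_cont φ h)
  rw [e1, e2, mu, mu, integral_map (by fun_prop)
      c1.aestronglyMeasurable,
      integral_map (by fun_prop) c2.aestronglyMeasurable]
  congr 1; ext t
  rw [hL1, hL2]
  simp only [tr_apply]
  rw [← integral_add_left_eq_self (fun g => h (g + φ (t • -w)) * f g) (φ (t • w))]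
  congr 1; ext g
  have : φ (t • w) + g + φ (t • -w) = g := by
    rw [add_comm (φ (t • w)) g, add_assoc, ← map_add]; simp
  rw [this, add_comm (φ (t • w)) g, mul_comm]

lemma AA_integral (φ : ℝ × ℝ →ₜ+ G) (w : ℝ × ℝ) (f : C(G, ℝ)) :
    ∫ g, (AA φ w f) g ∂ν = ∫ g, f g ∂ν := by
  have h := AA_adj ν φ w f (ContinuousMap.const G 1)
  simp only [AA_const] at h
  simpa using h

end flow

section flow2

variable {G : Type*} [AddCommGroup G] [TopologicalSpace G] [IsTopologicalAddGroup G]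
  [CompactSpace G]

open Classical in
/-- pointwise real power, as a continuous function -/
def cpow (f : C(G, ℝ)) (s : ℝ) : C(G, ℝ) :=
  if h : Continuous (fun g => f g ^ s) then ⟨_, h⟩ else 0

lemma cpow_pos (f : C(G, ℝ)) (hf : ∀ g, 0 < f g) (s : ℝ) (g : G) : cpow f s g = f g ^ s := by
  have h : Continuous (fun g => f g ^ s) :=
    f.continuous.rpow_const (fun g => Or.inl (hf g).ne')
  simp [cpow, h]

lemma cpow_nn (f : C(G, ℝ)) (s : ℝ) (hs : 0 ≤ s) (g : G) : cpow f s g = f g ^ s := by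
  have h : Continuous (fun g => f g ^ s) :=
    f.continuous.rpow_const (fun g => Or.inr hs)
  simp [cpow, h]

lemma AA_nonneg (φ : ℝ × ℝ →ₜ+ G) (w : ℝ × ℝ) {f : C(G, ℝ)} (hf : ∀ g, 0 ≤ f g) (g : G) :
    0 ≤ AA φ w f g := by
  have := AA_mono φ w (f := 0) (h := f) hf g
  simpa using this

lemma AA_pos (φ : ℝ × ℝ →ₜ+ G) (w : ℝ × ℝ) {f : C(G, ℝ)} (hf : ∀ g, 0 < f g) (g : G) :
    0 < AA φ w f g := by
  have : Nonempty G := ⟨g⟩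
  obtain ⟨x, hx⟩ := isCompact_univ.exists_isMinOn univ_nonempty f.continuous.continuousOn
  have h1 : ∀ y, f x ≤ f y := fun y => hx.2 (mem_univ y)
  have := AA_mono φ w (f := ContinuousMap.const G (f x)) (h := f) h1 g
  rw [AA_const] at this
  exact (hf x).trans_le this

lemma AA_abs (φ : ℝ × ℝ →ₜ+ G) (w : ℝ × ℝ) (f : C(G, ℝ)) (g : G) :
    |AA φ w f g| ≤ AA φ w |f| g := by
  rw [abs_le]
  constructor
  · have := AA_mono φ w (f := -|f|) (h := f) (fun g => by simpa using neg_abs_le (f g)) g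
    simpa using this
  · exact AA_mono φ w (fun g => by simpa using le_abs_self (f g)) g

lemma AA_holder (φ : ℝ × ℝ →ₜ+ G) (w : ℝ × ℝ) {f h k : C(G, ℝ)} {θ : ℝ} (h0 : 0 ≤ θ) (h1 : θ ≤ 1)
    (hf : ∀ g, 0 ≤ f g) (hh : ∀ g, 0 ≤ h g) (hk : ∀ g, k g ≤ f g ^ θ * h g ^ (1 - θ)) (g : G) :
    AA φ w k g ≤ AA φ w f g ^ θ * AA φ w h g ^ (1 - θ) := by
  have key : ∀ ε : ℝ, 0 < ε → AA φ w k g ≤ (AA φ w f g + ε) ^ θ * (AA φ w h g + ε) ^ (1 - θ) := by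
    intro ε hε
    set a := AA φ w f g + ε with ha
    set b := AA φ w h g + ε with hb
    have ha0 : 0 < a := by have := AA_nonneg φ w hf g; linarith
    have hb0 : 0 < b := by have := AA_nonneg φ w hh g; linarith
    have hm : 0 < a ^ θ * b ^ (1 - θ) := by positivity
    have h3 : ∀ x, k x ≤ ((a ^ θ * b ^ (1 - θ)) • ((θ / a) • (f + ContinuousMap.const G ε)
        + ((1 - θ) / b) • (h + ContinuousMap.const G ε))) x := by
      intro x
      have h4 := Real.geom_mean_le_arith_mean2_weighted h0 (sub_nonneg.2 h1)
        (p₁ := (f x + ε) / a) (p₂ := (h x + ε) / b)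
        (div_nonneg (by linarith [hf x]) ha0.le) (div_nonneg (by linarith [hh x]) hb0.le) (by ring)
      rw [Real.div_rpow (by linarith [hf x]) ha0.le, Real.div_rpow (by linarith [hh x]) hb0.le,
        div_mul_div_comm, div_le_iff₀ hm] at h4
      have h5 : f x ^ θ * h x ^ (1 - θ) ≤ (f x + ε) ^ θ * (h x + ε) ^ (1 - θ) := by
        have := hf x
        have := hh x
        have : 0 ≤ 1 - θ := sub_nonneg.2 h1
        gcongr <;> linarith
      refine (hk x).trans (h5.trans (h4.trans (le_of_eq ?_)))
      simp
      ring
    have h6 := AA_mono φ w h3 g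
    refine h6.trans (le_of_eq ?_)
    simp only [map_smul, map_add, ContinuousMap.smul_apply, ContinuousMap.add_apply, AA_const, smul_eq_mul]
    rw [← ha, ← hb]
    field_simp
    ring
  have hc : Continuous (fun ε : ℝ => (AA φ w f g + ε) ^ θ * (AA φ w h g + ε) ^ (1 - θ)) :=
    ((continuous_const.add continuous_id).rpow_const (fun _ => Or.inr h0)).mul
      ((continuous_const.add continuous_id).rpow_const (fun _ => Or.inr (sub_nonneg.2 h1)))
  have ht : Tendsto (fun ε : ℝ => (AA φ w f g + ε) ^ θ * (AA φ w h g + ε) ^ (1 - θ)) (𝓝[>] 0)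
      (𝓝 (AA φ w f g ^ θ * AA φ w h g ^ (1 - θ))) := by
    have := (hc.tendsto 0).mono_left (nhdsWithin_le_nhds (s := Ioi 0))
    simpa using this
  refine ge_of_tendsto ht ?_
  filter_upwards [self_mem_nhdsWithin] with ε hε using key ε hε

/-- Jensen, concave form -/
lemma AA_jensen (φ : ℝ × ℝ →ₜ+ G) (w : ℝ × ℝ) {f k : C(G, ℝ)} {θ : ℝ} (h0 : 0 ≤ θ) (h1 : θ ≤ 1)
    (hf : ∀ g, 0 ≤ f g) (hk : ∀ g, k g ≤ f g ^ θ) (g : G) :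
    AA φ w k g ≤ AA φ w f g ^ θ := by
  have := AA_holder φ w (h := ContinuousMap.const G 1) h0 h1 hf (by simp) (k := k)
    (by simpa using hk) g
  rwa [AA_const, Real.one_rpow, mul_one] at this

/-- Jensen, convex form -/
lemma AA_jensen' (φ : ℝ × ℝ →ₜ+ G) (w : ℝ × ℝ) {f : C(G, ℝ)} {s : ℝ} (hs : 1 ≤ s)
    (hf : ∀ g, 0 ≤ f g) (g : G) :
    AA φ w f g ^ s ≤ AA φ w (cpow f s) g := by
  have hs0 : 0 < s := by linarith
  have hp : ∀ g, 0 ≤ cpow f s g := fun g => by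
    rw [cpow_nn _ _ hs0.le]; exact Real.rpow_nonneg (hf g) _
  have := AA_jensen φ w (f := cpow f s) (k := f) (θ := s⁻¹) (by positivity)
    (inv_le_one_of_one_le₀ hs) hp (fun g => by
      rw [cpow_nn _ _ hs0.le, Real.rpow_rpow_inv (hf g) hs0.ne']) g
  calc _ ≤ ((AA φ w (cpow f s) g) ^ s⁻¹) ^ s :=
        Real.rpow_le_rpow (AA_nonneg φ w hf g) this hs0.le
    _ = _ := Real.rpow_inv_rpow (AA_nonneg φ w hp g) hs0.ne'

/-- Hilbert identity -/
lemma AA_hilbert (φ : ℝ × ℝ →ₜ+ G) (c : ℝ) (hc : 0 ≤ c) (v : ℝ × ℝ) :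
    c • AA φ (c • v) = AA φ v + (c - 1) • (AA φ (c • v) * AA φ v) := by
  have h := AA_star φ c hc v 0
  simp only [add_zero, AA_zero, mul_one] at h
  have h2 : c • AA φ (c • v) = (c • (AA φ (c • v) * AA φ v + AA φ (c • v)) + AA φ (c • v) * AA φ v)
    - (c + 1) • (AA φ (c • v) * AA φ v) := by module
  rw [h2, h]; module

lemma AA_le_mul (φ : ℝ × ℝ →ₜ+ G) (c : ℝ) (hc : 1 ≤ c) (v : ℝ × ℝ) {f : C(G, ℝ)}
    (hf : ∀ g, 0 ≤ f g) (g : G) : AA φ v f g ≤ c * AA φ (c • v) f g := by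
  have h := AA_hilbert φ c (by linarith) v
  have h2 := congrArg (fun B : Module.End ℝ C(G, ℝ) => B f g) h
  simp only [LinearMap.smul_apply, LinearMap.add_apply, ContinuousMap.smul_apply, smul_eq_mul,
    ContinuousMap.add_apply, Module.End.mul_apply] at h2
  rw [h2]
  have := AA_nonneg φ (c • v) (AA_nonneg φ v hf) g
  nlinarith

/-- maximal function over a finite set of vectors (together with `0`) -/
def mx (φ : ℝ × ℝ →ₜ+ G) (W : Finset (ℝ × ℝ)) (f : C(G, ℝ)) : C(G, ℝ) :=
  (insert 0 W).sup' (Finset.insert_nonempty _ _) (fun w => AA φ w f)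

lemma mx_le_iff (φ : ℝ × ℝ →ₜ+ G) (W : Finset (ℝ × ℝ)) (f : C(G, ℝ)) (g : G) (c : ℝ) :
    mx φ W f g ≤ c ↔ f g ≤ c ∧ ∀ w ∈ W, AA φ w f g ≤ c := by
  rw [mx, ContinuousMap.sup'_apply, Finset.sup'_le_iff]
  simp [AA_zero]

lemma mx_ge (φ : ℝ × ℝ →ₜ+ G) (W : Finset (ℝ × ℝ)) (f : C(G, ℝ)) (g : G) : f g ≤ mx φ W f g :=
  ((mx_le_iff φ W f g _).1 le_rfl).1

lemma mx_ge' (φ : ℝ × ℝ →ₜ+ G) (W : Finset (ℝ × ℝ)) (f : C(G, ℝ)) (g : G) (w : ℝ × ℝ) (hw : w ∈ W) :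
    AA φ w f g ≤ mx φ W f g :=
  ((mx_le_iff φ W f g _).1 le_rfl).2 w hw

lemma mx_pos (φ : ℝ × ℝ →ₜ+ G) (W : Finset (ℝ × ℝ)) {f : C(G, ℝ)} (hf : ∀ g, 0 < f g) (g : G) :
    0 < mx φ W f g := (hf g).trans_le (mx_ge φ W f g)

lemma mx_mem (φ : ℝ × ℝ →ₜ+ G) (W : Finset (ℝ × ℝ)) (f : C(G, ℝ)) (g : G) :
    mx φ W f g = f g ∨ ∃ w ∈ W, mx φ W f g = AA φ w f g := by
  by_contra hcon
  push Not at hcon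
  obtain ⟨h1, h2⟩ := hcon
  rw [mx, ContinuousMap.sup'_apply] at *
  obtain ⟨w, hw, h⟩ := Finset.exists_mem_eq_sup' (Finset.insert_nonempty (0 : ℝ × ℝ) W)
    (fun w => AA φ w f g)
  rw [h] at h1 h2
  rcases Finset.mem_insert.1 hw with rfl | hw
  · simp [AA_zero] at h1
  · exact h2 w hw rfl

variable [MeasurableSpace G] [BorelSpace G] (ν : Measure G) [IsProbabilityMeasure ν]

/-- boundedness of the maximal function on L^s -/
def MB (φ : ℝ × ℝ →ₜ+ G) (W : Finset (ℝ × ℝ)) (s D : ℝ) : Prop :=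
  ∀ f : C(G, ℝ), (∀ g, 0 < f g) → ∫ g, (mx φ W f g) ^ s ∂ν ≤ D * ∫ g, f g ^ s ∂ν

lemma pow_int {f : C(G, ℝ)} (hf : ∀ g, 0 < f g) (s : ℝ) : Integrable (fun g => f g ^ s) ν := by
  have := C_int ν (cpow f s)
  refine this.congr (Eventually.of_forall fun g => cpow_pos f hf s g)

lemma pow_int' (f : C(G, ℝ)) (s : ℝ) (hs : 0 ≤ s) : Integrable (fun g => f g ^ s) ν := by
  have := C_int ν (cpow f s)
  refine this.congr (Eventually.of_forall fun g => cpow_nn f s hs g)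

lemma MB_union (φ : ℝ × ℝ →ₜ+ G) {W₁ W₂ : Finset (ℝ × ℝ)} {s D₁ D₂ : ℝ}
    (h1 : MB ν φ W₁ s D₁) (h2 : MB ν φ W₂ s D₂) : MB ν φ (W₁ ∪ W₂) s (D₁ + D₂) := by
  intro f hf
  rw [add_mul]
  refine le_trans ?_ (add_le_add (h1 f hf) (h2 f hf))
  rw [← integral_add (pow_int ν (mx_pos φ _ hf) s) (pow_int ν (mx_pos φ _ hf) s)]
  refine integral_mono (pow_int ν (mx_pos φ _ hf) s)
    ((pow_int ν (mx_pos φ _ hf) s).add (pow_int ν (mx_pos φ _ hf) s)) (fun g => ?_)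
  have p1 := Real.rpow_nonneg (mx_pos φ W₁ hf g).le s
  have p2 := Real.rpow_nonneg (mx_pos φ W₂ hf g).le s
  have e : mx φ (W₁ ∪ W₂) f g = mx φ W₁ f g ∨ mx φ (W₁ ∪ W₂) f g = mx φ W₂ f g := by
    have l1 : mx φ W₁ f g ≤ mx φ (W₁ ∪ W₂) f g := (mx_le_iff _ _ _ _ _).2
      ⟨mx_ge _ _ _ _, fun w hw => mx_ge' _ _ _ _ _ (Finset.mem_union_left _ hw)⟩
    have l2 : mx φ W₂ f g ≤ mx φ (W₁ ∪ W₂) f g := (mx_le_iff _ _ _ _ _).2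
      ⟨mx_ge _ _ _ _, fun w hw => mx_ge' _ _ _ _ _ (Finset.mem_union_right _ hw)⟩
    rcases mx_mem φ (W₁ ∪ W₂) f g with h | ⟨w, hw, h⟩
    · left; exact le_antisymm (h ▸ mx_ge _ _ _ _) l1
    · rcases Finset.mem_union.1 hw with hw | hw
      · left; exact le_antisymm (h ▸ mx_ge' _ _ _ _ _ hw) l1
      · right; exact le_antisymm (h ▸ mx_ge' _ _ _ _ _ hw) l2
  rcases e with e | e <;> simp only [e] <;> linarith

variable [ν.IsAddLeftInvariant]

lemma AA_Ls (φ : ℝ × ℝ →ₜ+ G) (w : ℝ × ℝ) {f : C(G, ℝ)} {s : ℝ} (hs : 1 ≤ s)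
    (hf : ∀ g, 0 ≤ f g) : ∫ g, AA φ w f g ^ s ∂ν ≤ ∫ g, f g ^ s ∂ν := by
  have h0 : 0 ≤ s := by linarith
  calc _ ≤ ∫ g, AA φ w (cpow f s) g ∂ν :=
        integral_mono (pow_int' ν _ s h0) (C_int ν _) (fun g => AA_jensen' φ w hs hf g)
    _ = ∫ g, cpow f s g ∂ν := AA_integral ν φ w _
    _ = _ := by simp only [cpow_nn f s h0]

/-- Hopf type inequality for the finest-scale maximal function. -/
lemma hopf (φ : ℝ × ℝ →ₜ+ G) (w : ℝ × ℝ) (N : ℕ) (f M : C(G, ℝ)) (lam : ℝ)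
    (hM : ∀ g, ∃ i ∈ Finset.range N, M g = AA φ ((2:ℝ) ^ i • w) f g)
    (hM' : ∀ g, ∀ i ∈ Finset.range N, AA φ ((2:ℝ) ^ i • w) f g ≤ M g) :
    lam * ν.real {g | lam < M g} ≤ ∫ g in {g | lam < M g}, AA φ w f g ∂ν := by
  classical
  set k : C(G, ℝ) := f - ContinuousMap.const G lam with hk
  set H : ℕ → C(G, ℝ) := fun i => (2:ℝ) ^ i • AA φ ((2:ℝ) ^ i • w) k with hH
  set U : C(G, ℝ) := 0 ⊔ ((Finset.range (N + 1)).sup' (by simp) (fun i => if i < N then H i else 0))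
    with hU
  have hHv : ∀ i g, H i g = (2:ℝ) ^ i * (AA φ ((2:ℝ) ^ i • w) f g - lam) := by
    intro i g
    simp [hH, hk, AA_const]
  have hU0 : ∀ g, 0 ≤ U g := fun g => by simp [hU]
  have hUH : ∀ i < N, ∀ g, H i g ≤ U g := by
    intro i hi g
    rw [hU, ContinuousMap.sup_apply, ContinuousMap.sup'_apply]
    refine le_sup_of_le_right ?_
    refine le_trans ?_ (Finset.le_sup' (fun i => (if i < N then H i else 0 : C(G,ℝ)) g)
      (Finset.mem_range.2 (by omega : i < N + 1)))
    simp [hi]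
  have hUex : ∀ g, U g = 0 ∨ ∃ i < N, U g = H i g := by
    intro g
    obtain ⟨i, hi, h⟩ := Finset.exists_mem_eq_sup' (s := Finset.range (N + 1)) (by simp)
      (fun i => (if i < N then H i else 0 : C(G,ℝ)) g)
    rw [hU, ContinuousMap.sup_apply, ContinuousMap.sup'_apply, h]
    by_cases hi : i < N
    · simp only [hi, if_true]
      rcases le_total ((0:C(G,ℝ)) g) (H i g) with h | h
      · right; exact ⟨i, hi, by rw [sup_eq_right.2 h]⟩
      · left; rw [sup_eq_left.2 h]; rfl
    · simp [hi]
  have hset : ∀ g, lam < M g ↔ 0 < U g := by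
    intro g
    constructor
    · intro h
      obtain ⟨i, hi, e⟩ := hM g
      refine lt_of_lt_of_le ?_ (hUH i (Finset.mem_range.1 hi) g)
      rw [hHv, ← e]
      have : 0 < M g - lam := by linarith
      positivity
    · intro h
      rcases hUex g with e | ⟨i, hi, e⟩
      · linarith
      · rw [e, hHv] at h
        have h2 := pos_of_mul_pos_right h (by positivity : (0:ℝ) ≤ 2 ^ i)
        have := hM' g i (Finset.mem_range.2 hi)
        linarith
  have hms : MeasurableSet {g | lam < M g} := measurableSet_lt measurable_const M.continuous.measurable
  have hpt : ∀ g, U g - AA φ w U g ≤ ({g | lam < M g}.indicator (fun g => AA φ w f g - lam)) g := by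
    intro g
    by_cases hg : lam < M g
    · rw [indicator_of_mem (by exact hg)]
      have hpos := (hset g).1 hg
      rcases hUex g with e | ⟨i, hi, e⟩
      · linarith
      · have hb := AA_hilbert φ ((2:ℝ)^i) (by positivity) w
        have h2 := congrArg (fun B : Module.End ℝ C(G, ℝ) => B k g) hb
        rw [AA_comm] at h2
        simp only [LinearMap.smul_apply, LinearMap.add_apply, ContinuousMap.smul_apply, smul_eq_mul,
          ContinuousMap.add_apply, Module.End.mul_apply] at h2
        have h3 : H i g = AA φ w k g + ((2:ℝ) ^ i - 1) * AA φ w (AA φ ((2:ℝ)^i • w) k) g := by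
          rw [← h2]; rfl
        have h4 : AA φ w (H i) g = (2:ℝ)^i * AA φ w (AA φ ((2:ℝ)^i • w) k) g := by
          simp [hH]
        have h5 := AA_mono φ w (hUH i hi) g
        have h6 : 0 ≤ AA φ w U g := AA_nonneg φ w hU0 g
        have h7 : AA φ w k g = AA φ w f g - lam := by simp [hk, AA_const]
        have h8 : (1:ℝ) ≤ 2 ^ i := one_le_pow₀ (by norm_num)
        rw [e, h3, h7]
        have h9 : ((2:ℝ) ^ i - 1) * AA φ w (AA φ ((2:ℝ)^i • w) k) g ≤ AA φ w U g := by
          have : AA φ w (AA φ ((2:ℝ)^i • w) k) g = AA φ w (H i) g / 2 ^ i := by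
            rw [h4]; field_simp
          rw [this]
          rw [mul_div_assoc', div_le_iff₀ (by positivity)]
          calc ((2:ℝ)^i - 1) * AA φ w (H i) g ≤ ((2:ℝ)^i - 1) * AA φ w U g :=
                mul_le_mul_of_nonneg_left h5 (by linarith)
            _ ≤ _ := by nlinarith
        linarith
    · rw [indicator_of_notMem (by exact hg)]
      have h0 : U g = 0 := le_antisymm (not_lt.1 (fun h => hg ((hset g).2 h))) (hU0 g)
      have := AA_nonneg φ w hU0 g
      linarith
  have hi : Integrable (fun g => AA φ w f g - lam) ν := (C_int ν _).sub (integrable_const _)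
  have hint := integral_mono ((C_int ν U).sub (C_int ν (AA φ w U))) (hi.indicator hms) hpt
  have e0 : ∫ g, (⇑U - ⇑(AA φ w U)) g ∂ν = 0 := by
    simp only [Pi.sub_apply]
    rw [integral_sub (C_int ν U) (C_int ν (AA φ w U)), AA_integral, sub_self]
  rw [e0, integral_indicator hms, integral_sub (C_int ν _).integrableOn (integrable_const _),
    setIntegral_const, smul_eq_mul] at hint
  linarith

end flow2

section flow3

variable {G : Type*} [AddCommGroup G] [TopologicalSpace G] [IsTopologicalAddGroup G]
  [CompactSpace G]
variable [MeasurableSpace G] [BorelSpace G] (ν : Measure G) [IsProbabilityMeasure ν]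

lemma doob_Ls (M F : C(G, ℝ)) (hM : ∀ g, 0 ≤ M g) (hF : ∀ g, 0 ≤ F g) (s : ℝ) (hs : 1 < s)
    (h : ∀ lam : ℝ, 0 < lam → lam * ν.real {g | lam < M g} ≤ ∫ g in {g | lam < M g}, F g ∂ν) :
    ∫ g, M g ^ s ∂ν ≤ (s / (s - 1)) * ∫ g, F g * M g ^ (s - 1) ∂ν := by
  have hs1 : 0 < s - 1 := by linarith
  have hs0 : 0 < s := by linarith
  set ν' := ν.withDensity (fun g => ENNReal.ofReal (F g)) with hν'
  have hFm : Measurable (fun g => ENNReal.ofReal (F g)) :=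
    ENNReal.measurable_ofReal.comp F.continuous.measurable
  have hweak : ∀ t : ℝ, 0 < t → ENNReal.ofReal t * ν {g | t < M g} ≤ ν' {g | t < M g} := by
    intro t ht
    have hms : MeasurableSet {g | t < M g} := measurableSet_lt measurable_const M.continuous.measurable
    rw [hν', withDensity_apply _ hms, ← ofReal_integral_eq_lintegral_ofReal
      (C_int ν F).integrableOn (Eventually.of_forall hF)]
    have : ν {g | t < M g} = ENNReal.ofReal (ν.real {g | t < M g}) := by
      rw [ofReal_measureReal]
    rw [this, ← ENNReal.ofReal_mul ht.le]
    exact ENNReal.ofReal_le_ofReal (h t ht)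
  have l1 := lintegral_rpow_eq_lintegral_meas_lt_mul ν (f := M) (Eventually.of_forall hM)
    M.continuous.measurable.aemeasurable hs0
  have l2 := lintegral_rpow_eq_lintegral_meas_lt_mul ν' (f := M) (Eventually.of_forall hM)
    M.continuous.measurable.aemeasurable hs1
  have l3 : ∫⁻ t in Ioi 0, ν {a | t < M a} * ENNReal.ofReal (t ^ (s - 1)) ≤
      ∫⁻ t in Ioi 0, ν' {a | t < M a} * ENNReal.ofReal (t ^ (s - 1 - 1)) := by
    refine setLIntegral_mono' measurableSet_Ioi fun t ht => ?_
    have ht : (0:ℝ) < t := ht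
    have : t ^ (s - 1) = t * t ^ (s - 1 - 1) := by
      conv_rhs => rw [← Real.rpow_one_add' ht.le (by linarith)]
      congr 1; ring
    rw [this, ENNReal.ofReal_mul ht.le, ← mul_assoc, mul_comm (ν _)]
    exact mul_le_mul_left (hweak t ht) _
  have l4 : ENNReal.ofReal (s - 1) * ∫⁻ g, ENNReal.ofReal (M g ^ s) ∂ν ≤
      ENNReal.ofReal s * ∫⁻ g, ENNReal.ofReal (F g * M g ^ (s - 1)) ∂ν := by
    have e : ∫⁻ g, ENNReal.ofReal (F g * M g ^ (s - 1)) ∂ν =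
        ∫⁻ g, ENNReal.ofReal (M g ^ (s - 1)) ∂ν' := by
      rw [hν', lintegral_withDensity_eq_lintegral_mul _ hFm]
      · congr 1; ext g; rw [ENNReal.ofReal_mul (hF g)]; rfl
      · exact ENNReal.measurable_ofReal.comp (M.continuous.measurable.pow_const _)
    rw [e, l1, l2, ← mul_assoc, ← mul_assoc, mul_comm (ENNReal.ofReal s)]
    exact mul_le_mul_right l3 _
  have i1 := pow_int' ν M s hs0.le
  have i2 : Integrable (fun g => F g * M g ^ (s - 1)) ν :=
    (C_int ν (F * cpow M (s - 1))).congr (Eventually.of_forall fun g => by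
      simp [cpow_nn M (s-1) hs1.le])
  rw [← ofReal_integral_eq_lintegral_ofReal i1 (Eventually.of_forall fun g => Real.rpow_nonneg (hM g) _),
    ← ofReal_integral_eq_lintegral_ofReal i2 (Eventually.of_forall fun g => mul_nonneg (hF g) (Real.rpow_nonneg (hM g) _)),
    ← ENNReal.ofReal_mul hs1.le, ← ENNReal.ofReal_mul hs0.le, ENNReal.ofReal_le_ofReal_iff
      (mul_nonneg hs0.le (integral_nonneg fun g => mul_nonneg (hF g) (Real.rpow_nonneg (hM g) _)))] at l4
  rw [div_mul_eq_mul_div, le_div_iff₀ hs1]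
  linarith

/-- constant of the one-dimensional maximal theorem -/
def D1 (s : ℝ) : ℝ := 2 * (2 * (s / (s - 1))) ^ s + 1

lemma D1_pos {s : ℝ} (hs : 1 < s) : 0 < D1 s := by
  have : 0 < s - 1 := by linarith
  have : 0 < s := by linarith
  unfold D1; positivity

lemma young_aux {a b D s : ℝ} (ha : 0 ≤ a) (hb : 0 ≤ b) (hD : 0 < D) (hs : 1 < s) :
    D * (a * b ^ (s - 1)) ≤ 1 / 2 * b ^ s + (2 * D) ^ s * a ^ s := by
  have hs1 : 0 < s - 1 := by linarith
  have e : ∀ x : ℝ, 0 ≤ x → x ^ s = x * x ^ (s - 1) := by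
    intro x hx
    rw [← Real.rpow_one_add' hx (by linarith)]; congr 1; ring
  rw [← Real.mul_rpow (by positivity) ha]
  have p1 : 0 ≤ (2 * D * a) ^ s := Real.rpow_nonneg (by positivity) _
  have p2 : 0 ≤ b ^ s := Real.rpow_nonneg hb _
  rcases le_total (2 * D * a) b with h | h
  · have : D * (a * b ^ (s - 1)) ≤ 1 / 2 * b ^ s := by
      rw [e b hb]
      have := Real.rpow_nonneg hb (s - 1)
      nlinarith
    linarith
  · have : D * (a * b ^ (s - 1)) ≤ 1 / 2 * (2 * D * a) ^ s := by
      rw [e (2 * D * a) (by positivity)]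
      have h2 : b ^ (s - 1) ≤ (2 * D * a) ^ (s - 1) := Real.rpow_le_rpow hb h hs1.le
      have : D * (a * b ^ (s - 1)) ≤ D * (a * (2 * D * a) ^ (s - 1)) := by gcongr
      linarith
    linarith

variable [ν.IsAddLeftInvariant]

/-- dyadic multiples of a vector -/
def dy (w : ℝ × ℝ) (N : ℕ) : Finset (ℝ × ℝ) := (Finset.range N).image (fun i => (2:ℝ) ^ i • w)

lemma max1D (φ : ℝ × ℝ →ₜ+ G) (w : ℝ × ℝ) (N : ℕ) {s : ℝ} (hs : 1 < s) :
    MB ν φ (dy w N) s (D1 s) := by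
  intro f hf
  have hs1 : 0 < s - 1 := by linarith
  have hs0 : 0 < s := by linarith
  have hfn : 0 ≤ ∫ g, f g ^ s ∂ν := integral_nonneg fun g => Real.rpow_nonneg (hf g).le _
  rcases Nat.eq_zero_or_pos N with rfl | hN
  · have : ∀ g, mx φ (dy w 0) f g = f g := fun g =>
      le_antisymm ((mx_le_iff _ _ _ _ _).2 ⟨le_rfl, by simp [dy]⟩) (mx_ge _ _ _ _)
    simp only [this]
    have : 0 ≤ 2 * (2 * (s / (s - 1))) ^ s := by positivity
    unfold D1; nlinarith
  have hne : (Finset.range N).Nonempty := ⟨0, Finset.mem_range.2 hN⟩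
  set M : C(G, ℝ) := (Finset.range N).sup' hne (fun i => AA φ ((2:ℝ) ^ i • w) f) with hMdef
  have hM : ∀ g, ∃ i ∈ Finset.range N, M g = AA φ ((2:ℝ) ^ i • w) f g := by
    intro g
    rw [hMdef, ContinuousMap.sup'_apply]
    exact Finset.exists_mem_eq_sup' hne _
  have hM' : ∀ g, ∀ i ∈ Finset.range N, AA φ ((2:ℝ) ^ i • w) f g ≤ M g := by
    intro g i hi
    rw [hMdef, ContinuousMap.sup'_apply]
    exact Finset.le_sup' (fun i => AA φ ((2:ℝ) ^ i • w) f g) hi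
  have hMp : ∀ g, 0 ≤ M g := fun g => by
    obtain ⟨i, _, e⟩ := hM g
    rw [e]; exact AA_nonneg φ _ (fun g => (hf g).le) g
  have hFp : ∀ g, 0 ≤ AA φ w f g := AA_nonneg φ _ (fun g => (hf g).le)
  have key := doob_Ls ν M (AA φ w f) hMp hFp s hs (fun lam _ => hopf ν φ w N f M lam hM hM')
  have i1 := pow_int' ν M s hs0.le
  have i2 := pow_int' ν (AA φ w f) s hs0.le
  have i3 : Integrable (fun g => AA φ w f g * M g ^ (s - 1)) ν :=
    (C_int ν (AA φ w f * cpow M (s - 1))).congr (Eventually.of_forall fun g => by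
      simp [cpow_nn M (s-1) hs1.le])
  have hD : 0 < s / (s - 1) := by positivity
  have y : (s / (s - 1)) * ∫ g, AA φ w f g * M g ^ (s - 1) ∂ν ≤
      1 / 2 * ∫ g, M g ^ s ∂ν + (2 * (s / (s - 1))) ^ s * ∫ g, AA φ w f g ^ s ∂ν := by
    rw [← integral_const_mul, ← integral_const_mul, ← integral_const_mul,
      ← integral_add (i1.const_mul _) (i2.const_mul _)]
    exact integral_mono (i3.const_mul _) ((i1.const_mul _).add (i2.const_mul _))
      (fun g => young_aux (hFp g) (hMp g) hD hs)
  have z := AA_Ls ν φ w hs.le (fun g => (hf g).le)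
  have hMs : ∫ g, M g ^ s ∂ν ≤ 2 * (2 * (s / (s - 1))) ^ s * ∫ g, f g ^ s ∂ν := by
    have : (2 * (s / (s - 1))) ^ s * ∫ g, AA φ w f g ^ s ∂ν ≤ (2 * (s / (s - 1))) ^ s * ∫ g, f g ^ s ∂ν :=
      mul_le_mul_of_nonneg_left z (by positivity)
    linarith
  have fin : ∫ g, mx φ (dy w N) f g ^ s ∂ν ≤ ∫ g, (M g ^ s + f g ^ s) ∂ν := by
    refine integral_mono (pow_int ν (mx_pos φ _ hf) s) (i1.add (pow_int ν hf s)) fun g => ?_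
    have a1 := Real.rpow_nonneg (hMp g) s
    have a2 := Real.rpow_nonneg (hf g).le s
    rcases mx_mem φ (dy w N) f g with h | ⟨v, hv, h⟩
    · simp only [h]; linarith
    · obtain ⟨i, hi, rfl⟩ := Finset.mem_image.1 hv
      have : mx φ (dy w N) f g ^ s ≤ M g ^ s :=
        Real.rpow_le_rpow (mx_pos φ _ hf g).le (h ▸ hM' g i hi) hs0.le
      linarith
  rw [integral_add i1 (pow_int ν hf s)] at fin
  unfold D1
  linarith

end flow3

/-! ## Scalar tangent inequality -/

lemma tangent_aux {β q r : ℝ} (hβ : 1/2 ≤ β) (hβ1 : β < 1) (hq : 0 < q) (hr : r = q ^ (2 * β)) :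
    (1 - β) * (q - 1) ^ 2 ≤ 1 + β * (q ^ 2 - 1) - r ∧ (r - 1) ^ 2 ≤ 4 * (q - 1) ^ 2 * max 1 r := by
  have hr0 : 0 < r := hr ▸ Real.rpow_pos_of_pos hq _
  constructor
  · have h := Real.geom_mean_le_arith_mean2_weighted (w₁ := 2 * β - 1) (w₂ := 2 * (1 - β))
      (by linarith) (by linarith) (p₁ := q ^ 2) (p₂ := q) (by positivity) hq.le (by ring)
    have e : (q ^ 2) ^ (2 * β - 1) * q ^ (2 * (1 - β)) = r := by
      rw [hr, ← Real.rpow_natCast, ← Real.rpow_mul hq.le, ← Real.rpow_add hq]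
      congr 1; push_cast; ring
    rw [e] at h
    nlinarith
  · set p := q ^ β with hp
    have hp0 : 0 < p := Real.rpow_pos_of_pos hq _
    have e : r = p ^ 2 := by
      rw [hr, hp, ← Real.rpow_natCast, ← Real.rpow_mul hq.le]; congr 1; push_cast; ring
    rcases le_total 1 q with h1 | h1
    · have a1 : 1 ≤ p := Real.one_le_rpow h1 (by linarith)
      have a2 : p ≤ q := by
        calc p ≤ q ^ (1:ℝ) := Real.rpow_le_rpow_of_exponent_le h1 hβ1.le
          _ = q := Real.rpow_one q
      have : r ≤ max 1 r := le_max_right _ _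
      have h2 : (r - 1) ^ 2 ≤ 4 * (q - 1) ^ 2 * r := by
        rw [e]
        have : p ^ 2 - 1 ≤ (q - 1) * (2 * p) := by nlinarith
        have h0 : 0 ≤ p ^ 2 - 1 := by nlinarith
        calc (p ^ 2 - 1) ^ 2 ≤ ((q - 1) * (2 * p)) ^ 2 := by gcongr
          _ = _ := by ring
      have h3 : 4 * (q - 1) ^ 2 * r ≤ 4 * (q - 1) ^ 2 * max 1 r := by gcongr
      linarith
    · have a2 : q ≤ p := by
        calc q = q ^ (1:ℝ) := (Real.rpow_one q).symm
          _ ≤ p := Real.rpow_le_rpow_of_exponent_ge hq h1 hβ1.le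
      have a1 : p ≤ 1 := Real.rpow_le_one hq.le h1 (by linarith)
      have h2 : (r - 1) ^ 2 ≤ 4 * (q - 1) ^ 2 := by
        rw [e]
        have : 1 - p ^ 2 ≤ (1 - q) * 2 := by nlinarith
        have h0 : 0 ≤ 1 - p ^ 2 := by nlinarith
        calc (p ^ 2 - 1) ^ 2 = (1 - p ^ 2) ^ 2 := by ring
          _ ≤ ((1 - q) * 2) ^ 2 := by gcongr
          _ = _ := by ring
      have h3 : 4 * (q - 1) ^ 2 * 1 ≤ 4 * (q - 1) ^ 2 * max 1 r := by
        gcongr; exact le_max_left _ _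
      linarith

lemma tangent {β : ℝ} (hβ : 1/2 ≤ β) (hβ1 : β < 1) (f f' z z' : ℝ) (hz : 0 < z) (hz' : 0 < z') :
    f ^ 2 * z ^ (-β) + 2 * f * z ^ (-β) * (f' - f) - β * f ^ 2 * z ^ (-β) * z⁻¹ * (z' - z)
      + (1 - β) / 8 * ((f' - f) ^ 2 * (max z z') ^ (-β)) ≤ f' ^ 2 * z' ^ (-β) := by
  set q := Real.sqrt (z' / z) with hq
  have hq0 : 0 < q := Real.sqrt_pos.2 (by positivity)
  have hq2 : q ^ 2 = z' / z := Real.sq_sqrt (by positivity)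
  obtain ⟨h1, h2⟩ := tangent_aux hβ hβ1 hq0 rfl
  set r := q ^ (2 * β) with hr
  have hr0 : 0 < r := Real.rpow_pos_of_pos hq0 _
  have hrr : r = (z' / z) ^ β := by
    rw [hr, ← hq2, ← Real.rpow_natCast, ← Real.rpow_mul hq0.le]; norm_num
  set s := z ^ (-β) with hs
  have hs0 : 0 < s := Real.rpow_pos_of_pos hz _
  have hs' : z' ^ (-β) = s / r := by
    rw [hrr, hs, Real.div_rpow hz'.le hz.le, Real.rpow_neg hz.le, Real.rpow_neg hz'.le]
    have := Real.rpow_pos_of_pos hz β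
    have := Real.rpow_pos_of_pos hz' β
    field_simp
  have hmax : (max z z') ^ (-β) = s / max 1 r := by
    rcases le_total z z' with h | h
    · have : 1 ≤ r := by
        rw [hrr]; exact Real.one_le_rpow ((one_le_div hz).2 h) (by linarith)
      rw [max_eq_right h, hs', max_eq_right this]
    · have : r ≤ 1 := by
        rw [hrr]; exact Real.rpow_le_one (by positivity) ((div_le_one hz).2 h) (by linarith)
      rw [max_eq_left h, max_eq_left this, div_one]
  have hzz : z⁻¹ * (z' - z) = q ^ 2 - 1 := by rw [hq2]; field_simp
  rw [hs', hmax, mul_assoc (β * f ^ 2 * s), hzz]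
  set m := max 1 r with hm
  have hm0 : 0 < m := by positivity
  have hmr : r ≤ m := le_max_right _ _
  have hm1 : 1 ≤ m := le_max_left _ _
  have key : f' ^ 2 * (s / r) = f ^ 2 * s + 2 * f * s * (f' - f) - β * f ^ 2 * s * (q ^ 2 - 1)
      + (s / r * (f' - f * r) ^ 2 + f ^ 2 * s * (1 + β * (q ^ 2 - 1) - r)) := by
    field_simp; ring
  rw [key]
  have g1 : (f' - f) ^ 2 ≤ 2 * (f' - f * r) ^ 2 + 2 * f ^ 2 * (r - 1) ^ 2 := by
    nlinarith [sq_nonneg ((f' - f * r) - f * (r - 1))]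
  have g2 : (f' - f) ^ 2 * (s / m) ≤ 2 * (s / r * (f' - f * r) ^ 2) + 8 * (f ^ 2 * s * (q - 1) ^ 2) := by
    calc (f' - f) ^ 2 * (s / m) ≤ (2 * (f' - f * r) ^ 2 + 2 * f ^ 2 * (r - 1) ^ 2) * (s / m) := by
          gcongr
      _ ≤ 2 * (f' - f * r) ^ 2 * (s / r) + 2 * f ^ 2 * (4 * (q - 1) ^ 2 * m) * (s / m) := by
          rw [add_mul]; gcongr
      _ = _ := by field_simp; ring
  have g3 : f ^ 2 * s * ((1 - β) * (q - 1) ^ 2) ≤ f ^ 2 * s * (1 + β * (q ^ 2 - 1) - r) := by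
    gcongr
  have g4 : 0 ≤ s / r * (f' - f * r) ^ 2 := by positivity
  have g5 : (1 - β) / 8 * ((f' - f) ^ 2 * (s / m)) ≤
      (1 - β) / 8 * (2 * (s / r * (f' - f * r) ^ 2) + 8 * (f ^ 2 * s * (q - 1) ^ 2)) :=
    mul_le_mul_of_nonneg_left g2 (by linarith)
  nlinarith

section flow4

variable {G : Type*} [AddCommGroup G] [TopologicalSpace G] [IsTopologicalAddGroup G]
  [CompactSpace G]
variable [MeasurableSpace G] [BorelSpace G] (ν : Measure G) [IsProbabilityMeasure ν]

/-- weighted L² seminorm -/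
def NW (ρ : C(G, ℝ)) : Seminorm ℝ C(G, ℝ) :=
  (normSeminorm ℝ (Lp ℝ 2 ν)).comp
    ((ContinuousMap.toLp 2 ν ℝ : C(G, ℝ) →L[ℝ] Lp ℝ 2 ν).toLinearMap.comp
      (LinearMap.mulLeft ℝ (cpow ρ (1/2))))

lemma NW_def (ρ f : C(G, ℝ)) : NW ν ρ f = ‖(ContinuousMap.toLp 2 ν ℝ (cpow ρ (1/2) * f) : Lp ℝ 2 ν)‖ := rfl

lemma NW_sq (ρ f : C(G, ℝ)) (hρ : ∀ g, 0 ≤ ρ g) : NW ν ρ f ^ 2 = ∫ g, f g ^ 2 * ρ g ∂ν := by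
  rw [NW_def, ← real_inner_self_eq_norm_sq, ContinuousMap.inner_toLp]
  congr 1; ext g
  simp only [ContinuousMap.mul_apply, cpow_nn ρ (1/2) (by norm_num), RCLike.conj_to_real]
  have : ρ g ^ (1/2:ℝ) * ρ g ^ (1/2:ℝ) = ρ g := by
    rw [← Real.sqrt_eq_rpow]; exact Real.mul_self_sqrt (hρ g)
  calc _ = f g ^ 2 * (ρ g ^ (1/2:ℝ) * ρ g ^ (1/2:ℝ)) := by ring
    _ = _ := by rw [this]

lemma NW_cs (ρ ρ' f h : C(G, ℝ)) (hρ : ∀ g, 0 < ρ g) (hρ' : ∀ g, ρ g * ρ' g = 1) :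
    ∫ g, f g * h g ∂ν ≤ NW ν ρ f * NW ν ρ' h := by
  rw [NW_def, NW_def]
  refine le_trans (le_of_eq ?_) (real_inner_le_norm _ _)
  rw [ContinuousMap.inner_toLp]
  congr 1; ext g
  simp only [ContinuousMap.mul_apply, cpow_nn _ (1/2) (by norm_num), RCLike.conj_to_real]
  have hp' : 0 ≤ ρ' g := by
    have := hρ' g
    by_contra hneg; push Not at hneg
    nlinarith [hρ g]
  have : ρ g ^ (1/2:ℝ) * ρ' g ^ (1/2:ℝ) = 1 := by
    rw [← Real.mul_rpow (hρ g).le hp', hρ']; simp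
  calc f g * h g = f g * h g * (ρ g ^ (1/2:ℝ) * ρ' g ^ (1/2:ℝ)) := by rw [this, mul_one]
    _ = _ := by ring

variable [ν.IsAddLeftInvariant]

lemma K_lemma {β : ℝ} (hβ : 1/2 ≤ β) (hβ1 : β < 1) (φ : ℝ × ℝ →ₜ+ G) (w : ℝ × ℝ) (θ : ℝ) (h0 : 0 ≤ θ)
    (h1 : θ ≤ 1) (p z p' z' : C(G, ℝ)) (hz : ∀ g, 0 < z g)
    (hp' : p' = θ • p + (1 - θ) • AA φ w p) (hz' : z' = θ • z + (1 - θ) • AA φ w z) :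
    ∫ g, p' g ^ 2 * z' g ^ (-β) ∂ν + θ * ((1 - β) / 8) * ∫ g, (p g - p' g) ^ 2 * (max (z g) (z' g)) ^ (-β) ∂ν
      ≤ ∫ g, p g ^ 2 * z g ^ (-β) ∂ν := by
  have hz'0 : ∀ g, 0 < z' g := by
    intro g
    rw [hz']
    have a := AA_pos φ w hz g
    have b := hz g
    simp only [ContinuousMap.add_apply, ContinuousMap.smul_apply, smul_eq_mul]
    rcases eq_or_lt_of_le h0 with rfl | h0
    · simpa using a
    · have : 0 ≤ (1 - θ) * AA φ w z g := mul_nonneg (by linarith) a.le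
      have := mul_pos h0 b
      linarith
  set F : C(G, ℝ) := p ^ 2 * cpow z (-β) with hF
  have hFv : ∀ g, F g = p g ^ 2 * z g ^ (-β) := fun g => by simp [hF, cpow_pos z hz]
  set R : C(G, ℝ) := (p - p') ^ 2 * cpow (z ⊔ z') (-β) with hR
  have hRv : ∀ g, R g = (p g - p' g) ^ 2 * (max (z g) (z' g)) ^ (-β) := fun g => by
    have : ∀ g, 0 < (z ⊔ z') g := fun g => by
      rw [ContinuousMap.sup_apply]; exact lt_sup_of_lt_left (hz g)
    simp [hR, cpow_pos _ this]
  set F' : C(G, ℝ) := p' ^ 2 * cpow z' (-β) with hF'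
  have hFv' : ∀ g, F' g = p' g ^ 2 * z' g ^ (-β) := fun g => by simp [hF', cpow_pos z' hz'0]
  have hpt : ∀ g, F' g + θ * ((1 - β) / 8) * R g ≤ θ * F g + (1 - θ) * AA φ w F g := by
    intro g
    set c1 : ℝ := 2 * p' g * z' g ^ (-β) with hc1
    set c2 : ℝ := β * p' g ^ 2 * z' g ^ (-β) * (z' g)⁻¹ with hc2
    set lin : C(G, ℝ) := ContinuousMap.const G (F' g) + c1 • (p - ContinuousMap.const G (p' g))
      - c2 • (z - ContinuousMap.const G (z' g)) with hlin
    have hlv : ∀ x, lin x = F' g + c1 * (p x - p' g) - c2 * (z x - z' g) := fun x => by simp [hlin]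
    have t1 : ∀ x, lin x + (1 - β) / 8 * ((p x - p' g) ^ 2 * (max (z' g) (z x)) ^ (-β)) ≤ F x := by
      intro x
      rw [hlv, hFv, hFv']
      exact tangent hβ hβ1 (p' g) (p x) (z' g) (z x) (hz'0 g) (hz x)
    have t2 : ∀ x, lin x ≤ F x := by
      intro x
      refine le_trans ?_ (t1 x)
      have : 0 ≤ (max (z' g) (z x)) ^ (-β) := Real.rpow_nonneg (le_max_of_le_left (hz'0 g).le) _
      have : 0 ≤ (1 - β) / 8 := by linarith
      have : 0 ≤ (1 - β) / 8 * ((p x - p' g) ^ 2 * (max (z' g) (z x)) ^ (-β)) := by positivity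
      linarith
    have t3 := AA_mono φ w t2 g
    have t4 : AA φ w lin g = F' g + c1 * (AA φ w p g - p' g) - c2 * (AA φ w z g - z' g) := by
      simp [hlin, AA_const]
    have e1 : p' g = θ * p g + (1 - θ) * AA φ w p g := by
      conv_lhs => rw [hp']
      simp
    have e2 : z' g = θ * z g + (1 - θ) * AA φ w z g := by
      conv_lhs => rw [hz']
      simp
    have t5 := t1 g
    rw [max_comm, ← hRv, hlv] at t5
    rw [t4] at t3
    have s1 := mul_le_mul_of_nonneg_left t5 h0
    have s2 := mul_le_mul_of_nonneg_left t3 (sub_nonneg.2 h1)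
    have e3 : θ * (F' g + c1 * (p g - p' g) - c2 * (z g - z' g)) +
      (1 - θ) * (F' g + c1 * (AA φ w p g - p' g) - c2 * (AA φ w z g - z' g)) = F' g := by
      linear_combination (-c1) * e1 + c2 * e2
    nlinarith
  have hI := integral_mono ((C_int ν F').add ((C_int ν R).const_mul (θ * ((1 - β) / 8))))
    (((C_int ν F).const_mul θ).add ((C_int ν (AA φ w F)).const_mul (1 - θ))) hpt
  simp only [Pi.add_apply] at hI
  rw [integral_add (C_int ν F') ((C_int ν R).const_mul _), integral_add ((C_int ν F).const_mul _)
    ((C_int ν (AA φ w F)).const_mul _), integral_const_mul, integral_const_mul, integral_const_mul,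
    AA_integral] at hI
  simp only [hFv, hFv', hRv] at hI
  linarith

end flow4

section flow5

variable {G : Type*} [AddCommGroup G] [TopologicalSpace G] [IsTopologicalAddGroup G]
  [CompactSpace G]
variable [MeasurableSpace G] [BorelSpace G] (ν : Measure G) [IsProbabilityMeasure ν]

lemma AA_scale (φ : ℝ × ℝ →ₜ+ G) (c : ℝ) (hc : 0 < c) (v : ℝ × ℝ) (f : C(G, ℝ)) :
    AA φ (c • v) f = (1 / c) • AA φ v f + (1 - 1 / c) • AA φ (c • v) (AA φ v f) := by
  have h := congrArg (fun B : Module.End ℝ C(G, ℝ) => (1 / c) • B f) (AA_hilbert φ c hc.le v)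
  simp only [LinearMap.smul_apply, LinearMap.add_apply, Module.End.mul_apply, smul_add, smul_smul] at h
  rw [one_div_mul_cancel hc.ne', one_smul] at h
  rw [h]; congr 2; field_simp

lemma wint (f : C(G, ℝ)) {z : C(G, ℝ)} (hz : ∀ g, 0 < z g) (γ : ℝ) :
    Integrable (fun g => f g ^ 2 * z g ^ γ) ν :=
  (C_int ν (f ^ 2 * cpow z γ)).congr (Eventually.of_forall fun g => by simp [cpow_pos z hz])

variable [ν.IsAddLeftInvariant]

/-- square function estimate -/
lemma sqf {β : ℝ} (hβ : 1/2 ≤ β) (hβ1 : β < 1) (φ : ℝ × ℝ →ₜ+ G) (w : ℝ × ℝ) (s : ℕ → ℝ)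
    (hs : ∀ k, 0 < s k) (hs2 : ∀ k, 2 * s (k + 1) ≤ s k) (K : ℕ) (f z : C(G, ℝ)) (hz : ∀ g, 0 < z g) :
    ∑ k ∈ Finset.range K, ∫ g, (AA φ (s k • w) f g - AA φ ((2:ℝ) • s k • w) f g) ^ 2 *
      (max (AA φ (s k • w) z g) (AA φ ((2:ℝ) • s k • w) z g)) ^ (-β) ∂ν ≤
      (16 / (1 - β)) * ∫ g, f g ^ 2 * z g ^ (-β) ∂ν := by
  set Φ : ℝ → ℝ := fun a => ∫ g, AA φ (a • w) f g ^ 2 * AA φ (a • w) z g ^ (-β) ∂ν with hΦ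
  set T : ℕ → ℝ := fun k => ∫ g, (AA φ (s k • w) f g - AA φ ((2:ℝ) • s k • w) f g) ^ 2 *
      (max (AA φ (s k • w) z g) (AA φ ((2:ℝ) • s k • w) z g)) ^ (-β) ∂ν with hT
  have hTn : ∀ k, 0 ≤ T k := fun k => integral_nonneg fun g =>
    mul_nonneg (sq_nonneg _) (Real.rpow_nonneg (le_max_of_le_left (AA_pos φ _ hz g).le) _)
  have hΦn : ∀ a, 0 ≤ Φ a := fun a => integral_nonneg fun g =>
    mul_nonneg (sq_nonneg _) (Real.rpow_nonneg (AA_pos φ _ hz g).le _)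
  have hΦ0 : ∀ a, Φ a ≤ ∫ g, f g ^ 2 * z g ^ (-β) ∂ν := by
    intro a
    have := K_lemma ν hβ hβ1 φ (a • w) 0 le_rfl zero_le_one f z (AA φ (a • w) f) (AA φ (a • w) z) hz
      (by simp) (by simp)
    simpa using this
  have hΦm : ∀ a c, 1 ≤ c → Φ (c * a) ≤ Φ a := by
    intro a c hc
    have hc0 : 0 < c := by linarith
    have := K_lemma ν hβ hβ1 φ (c • a • w) (1 / c) (by positivity) ((div_le_one hc0).2 hc)
      (AA φ (a • w) f) (AA φ (a • w) z) (AA φ (c • a • w) f) (AA φ (c • a • w) z) (AA_pos φ _ hz)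
      (AA_scale φ c hc0 _ _) (AA_scale φ c hc0 _ _)
    simp only [smul_smul] at this
    refine le_trans ?_ this
    refine le_add_of_nonneg_right (mul_nonneg (mul_nonneg (by positivity) (by linarith)) ?_)
    exact integral_nonneg fun g =>
      mul_nonneg (sq_nonneg _) (Real.rpow_nonneg (le_max_of_le_left (AA_pos φ _ hz g).le) _)
  have hstep : ∀ k, (1 - β) / 16 * T k ≤ Φ (s k) - Φ (2 * s k) := by
    intro k
    have := K_lemma ν hβ hβ1 φ ((2:ℝ) • s k • w) (1 / 2) (by positivity) (by norm_num)
      (AA φ (s k • w) f) (AA φ (s k • w) z) (AA φ ((2:ℝ) • s k • w) f) (AA φ ((2:ℝ) • s k • w) z)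
      (AA_pos φ _ hz) (AA_scale φ 2 (by norm_num) _ _) (AA_scale φ 2 (by norm_num) _ _)
    have e : Φ (2 * s k) = ∫ g, AA φ ((2:ℝ) • s k • w) f g ^ 2 * AA φ ((2:ℝ) • s k • w) z g ^ (-β) ∂ν := by
      simp only [hΦ, smul_smul]
    rw [e]
    simp only [hΦ, hT]
    linarith
  have hsum : ∀ K, (1 - β) / 16 * ∑ k ∈ Finset.range (K + 1), T k ≤ Φ (s K) := by
    intro K
    induction K with
    | zero =>
      rw [zero_add, Finset.sum_range_one]
      have := hstep 0
      have := hΦn (2 * s 0)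
      linarith
    | succ K ih =>
      rw [Finset.sum_range_succ, mul_add]
      have h1 := hstep (K + 1)
      have h2 : Φ (s K) ≤ Φ (2 * s (K + 1)) := by
        have hp := hs (K + 1)
        have := hΦm (2 * s (K + 1)) (s K / (2 * s (K + 1)))
          ((one_le_div (by positivity)).2 (hs2 K))
        rwa [div_mul_cancel₀ _ (by positivity)] at this
      linarith
  have hfin : (1 - β) / 16 * ∑ k ∈ Finset.range K, T k ≤ ∫ g, f g ^ 2 * z g ^ (-β) ∂ν := by
    cases K with
    | zero =>
      simp
      exact integral_nonneg fun g => mul_nonneg (sq_nonneg _) (Real.rpow_nonneg (hz g).le _)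
    | succ K => exact (hsum K).trans (hΦ0 _)
  have hb : 0 < 1 - β := by linarith
  rw [div_mul_eq_mul_div, le_div_iff₀ hb]
  linarith

/-- sum version: weighted square function -/
lemma sqfN {β C : ℝ} (hβ : 1/2 ≤ β) (hβ1 : β < 1) (hC : 1 ≤ C) (φ : ℝ × ℝ →ₜ+ G) (w : ℝ × ℝ) (s : ℕ → ℝ)
    (hs : ∀ k, 0 < s k) (hs2 : ∀ k, 2 * s (k + 1) ≤ s k) (K : ℕ) (f v : C(G, ℝ)) (hv : ∀ g, 0 < v g)
    (hA : ∀ k < K, ∀ g, AA φ (s k • w) v g ≤ C * v g)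
    (hA' : ∀ k < K, ∀ g, AA φ ((2:ℝ) • s k • w) v g ≤ C * v g) :
    ∑ k ∈ Finset.range K, NW ν (cpow v (-β)) (AA φ (s k • w) f - AA φ ((2:ℝ) • s k • w) f) ^ 2 ≤
      (16 * C / (1 - β)) * NW ν (cpow v (-β)) f ^ 2 := by
  have hcp : ∀ g, 0 ≤ cpow v (-β) g := fun g => by
    rw [cpow_pos v hv]; exact Real.rpow_nonneg (hv g).le _
  have h := sqf ν hβ hβ1 φ w s hs hs2 K f v hv
  simp only [NW_sq ν _ _ hcp, cpow_pos v hv]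
  have hC0 : 0 < C := by linarith
  calc _ ≤ ∑ k ∈ Finset.range K, C * ∫ g, (AA φ (s k • w) f g - AA φ ((2:ℝ) • s k • w) f g) ^ 2 *
      (max (AA φ (s k • w) v g) (AA φ ((2:ℝ) • s k • w) v g)) ^ (-β) ∂ν := by
        refine Finset.sum_le_sum fun k hk => ?_
        rw [← integral_const_mul]
        have hmp : ∀ g, 0 < (AA φ (s k • w) v ⊔ AA φ ((2:ℝ) • s k • w) v) g := fun g => by
          rw [ContinuousMap.sup_apply]; exact lt_sup_of_lt_left (AA_pos φ _ hv g)
        refine integral_mono (wint ν _ hv _) ((wint ν (AA φ (s k • w) f - AA φ ((2:ℝ) • s k • w) f)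
          hmp (-β)).const_mul C) fun g => ?_
        have hk := Finset.mem_range.1 hk
        have m1 : max (AA φ (s k • w) v g) (AA φ ((2:ℝ) • s k • w) v g) ≤ C * v g :=
          max_le (hA k hk g) (hA' k hk g)
        have m0 := hmp g
        rw [ContinuousMap.sup_apply] at m0
        have m2 : (C * v g) ^ (-β) ≤ (max (AA φ (s k • w) v g) (AA φ ((2:ℝ) • s k • w) v g)) ^ (-β) :=
          Real.rpow_le_rpow_of_nonpos m0 m1 (by linarith)
        rw [Real.mul_rpow hC0.le (hv g).le] at m2
        have m3 : C ^ (-(1:ℝ)) ≤ C ^ (-β) := Real.rpow_le_rpow_of_exponent_le hC (by linarith)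
        rw [Real.rpow_neg_one] at m3
        have m4 : v g ^ (-β) ≤ C * (max (AA φ (s k • w) v g) (AA φ ((2:ℝ) • s k • w) v g)) ^ (-β) := by
          have a := Real.rpow_pos_of_pos (hv g) (-β)
          have : C * (C⁻¹ * v g ^ (-β)) ≤ C * (C ^ (-β) * v g ^ (-β)) := by gcongr
          rw [mul_inv_cancel_left₀ hC0.ne'] at this
          exact this.trans (mul_le_mul_of_nonneg_left m2 hC0.le)
        have := mul_le_mul_of_nonneg_left m4 (sq_nonneg (AA φ (s k • w) f g - AA φ ((2:ℝ) • s k • w) f g))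
        simp only [ContinuousMap.sub_apply, ContinuousMap.sup_apply]
        calc _ ≤ _ := this
          _ = _ := by ring
    _ ≤ _ := by
        rw [← Finset.mul_sum]
        refine (mul_le_mul_of_nonneg_left h hC0.le).trans (le_of_eq ?_)
        ring

/-- boundedness of averages in the weighted space -/
lemma bddN {β C : ℝ} (hβ : 1/2 ≤ β) (hβ1 : β < 1) (hC : 1 ≤ C) (φ : ℝ × ℝ →ₜ+ G) (w : ℝ × ℝ)
    (f v : C(G, ℝ)) (hv : ∀ g, 0 < v g) (hA : ∀ g, AA φ w v g ≤ C * v g) :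
    NW ν (cpow v (-β)) (AA φ w f) ≤ C * NW ν (cpow v (-β)) f := by
  have hcp : ∀ g, 0 ≤ cpow v (-β) g := fun g => by
    rw [cpow_pos v hv]; exact Real.rpow_nonneg (hv g).le _
  have hC0 : 0 < C := by linarith
  have h := K_lemma ν hβ hβ1 φ w 0 le_rfl zero_le_one f v (AA φ w f) (AA φ w v) hv (by simp) (by simp)
  simp only [zero_mul, add_zero] at h
  have h2 : NW ν (cpow v (-β)) (AA φ w f) ^ 2 ≤ C * NW ν (cpow v (-β)) f ^ 2 := by
    simp only [NW_sq ν _ _ hcp, cpow_pos v hv]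
    refine le_trans ?_ (mul_le_mul_of_nonneg_left h hC0.le)
    rw [← integral_const_mul]
    refine integral_mono (wint ν _ hv _) ((wint ν _ (AA_pos φ w hv) _).const_mul _) fun g => ?_
    have m2 : (C * v g) ^ (-β) ≤ (AA φ w v g) ^ (-β) :=
      Real.rpow_le_rpow_of_nonpos (AA_pos φ w hv g) (hA g) (by linarith)
    rw [Real.mul_rpow hC0.le (hv g).le] at m2
    have m3 : C ^ (-(1:ℝ)) ≤ C ^ (-β) := Real.rpow_le_rpow_of_exponent_le hC (by linarith)
    rw [Real.rpow_neg_one] at m3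
    have m4 : v g ^ (-β) ≤ C * (AA φ w v g) ^ (-β) := by
      have a := Real.rpow_pos_of_pos (hv g) (-β)
      have : C * (C⁻¹ * v g ^ (-β)) ≤ C * (C ^ (-β) * v g ^ (-β)) := by gcongr
      rw [mul_inv_cancel_left₀ hC0.ne'] at this
      exact this.trans (mul_le_mul_of_nonneg_left m2 hC0.le)
    have := mul_le_mul_of_nonneg_left m4 (sq_nonneg (AA φ w f g))
    calc _ ≤ _ := this
      _ = _ := by ring
  refine le_of_sq_le_sq ?_ (mul_nonneg hC0.le (apply_nonneg _ _)) |>.trans le_rfl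
  rw [mul_pow]
  refine h2.trans ?_
  have := sq_nonneg (NW ν (cpow v (-β)) f)
  nlinarith

/-- dual square function -/
lemma dsqf {β C : ℝ} (hβ : 1/2 ≤ β) (hβ1 : β < 1) (hC : 1 ≤ C) (φ : ℝ × ℝ →ₜ+ G) (w : ℝ × ℝ)
    (M : ℕ) (h v : C(G, ℝ)) (hv : ∀ g, 0 < v g)
    (hA : ∀ a < M + 2, ∀ g, AA φ ((2:ℝ) ^ a • w) v g ≤ C * v g) :
    ∑ a ∈ Finset.range M, NW ν (cpow v β) (AA φ (-((2:ℝ) ^ (a + 2) • w))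
      (AA φ (-((2:ℝ) ^ a • w)) h - AA φ (-((2:ℝ) ^ (a + 1) • w)) h)) ^ 2 ≤
      (64 * C / (1 - β)) * NW ν (cpow v β) h ^ 2 := by
  have hC0 : 0 < C := by linarith
  have hβ0 : 0 < β := by linarith
  have hcp : ∀ g, 0 ≤ cpow v β g := fun g => by
    rw [cpow_pos v hv]; exact Real.rpow_nonneg (hv g).le _
  set z := cpow v (-1) with hz
  have hzv : ∀ g, z g = (v g)⁻¹ := fun g => by rw [hz, cpow_pos v hv, Real.rpow_neg_one]
  have hz0 : ∀ g, 0 < z g := fun g => by rw [hzv]; exact inv_pos.2 (hv g)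
  -- reversed dyadic scales
  have hM := sqf ν hβ hβ1 φ (-w) (fun k => (2:ℝ) ^ (M - 1 : ℤ) * (2:ℝ) ^ (-(k:ℤ)))
    (fun k => by positivity) (fun k => le_of_eq (by
      push_cast; rw [neg_add, zpow_add₀ (by norm_num)]; ring)) M h z hz0
  rw [← Finset.sum_range_reflect] at hM
  have hzz : ∫ g, h g ^ 2 * z g ^ (-β) ∂ν = NW ν (cpow v β) h ^ 2 := by
    rw [NW_sq ν _ _ hcp]
    congr 1; ext g
    rw [hzv, cpow_pos v hv, Real.inv_rpow (hv g).le, ← Real.rpow_neg (hv g).le, neg_neg]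
  rw [hzz] at hM
  have hstep : ∀ a ∈ Finset.range M, NW ν (cpow v β) (AA φ (-((2:ℝ) ^ (a + 2) • w))
      (AA φ (-((2:ℝ) ^ a • w)) h - AA φ (-((2:ℝ) ^ (a + 1) • w)) h)) ^ 2 ≤ (4 * C) *
      ∫ g, (AA φ (((2:ℝ) ^ (M - 1 : ℤ) * (2:ℝ) ^ (-((M - 1 - a : ℕ):ℤ))) • (-w)) h g -
        AA φ ((2:ℝ) • ((2:ℝ) ^ (M - 1 : ℤ) * (2:ℝ) ^ (-((M - 1 - a : ℕ):ℤ))) • (-w)) h g) ^ 2 *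
      (max (AA φ (((2:ℝ) ^ (M - 1 : ℤ) * (2:ℝ) ^ (-((M - 1 - a : ℕ):ℤ))) • (-w)) z g)
        (AA φ ((2:ℝ) • ((2:ℝ) ^ (M - 1 : ℤ) * (2:ℝ) ^ (-((M - 1 - a : ℕ):ℤ))) • (-w)) z g)) ^ (-β) ∂ν := by
    intro a ha
    have ha := Finset.mem_range.1 ha
    have e1 : ((2:ℝ) ^ (M - 1 : ℤ) * (2:ℝ) ^ (-((M - 1 - a : ℕ):ℤ))) = (2:ℝ) ^ a := by
      rw [← zpow_add₀ (by norm_num), ← zpow_natCast]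
      congr 1; omega
    have e2 : (2:ℝ) • (2:ℝ) ^ a • (-w) = -((2:ℝ) ^ (a + 1) • w) := by
      rw [smul_smul, smul_neg, pow_succ, mul_comm]
    rw [e1, e2, smul_neg]
    set d : C(G, ℝ) := AA φ (-((2:ℝ) ^ a • w)) h - AA φ (-((2:ℝ) ^ (a + 1) • w)) h with hd
    set L := (2:ℝ) ^ (a + 2) • w with hL
    set za := AA φ (-((2:ℝ) ^ a • w)) z with hza
    set zb := AA φ (-((2:ℝ) ^ (a + 1) • w)) z with hzb
    have hmp : ∀ g, 0 < (za ⊔ zb) g := fun g => by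
      rw [ContinuousMap.sup_apply]; exact lt_sup_of_lt_left (AA_pos φ _ hz0 g)
    -- pointwise bound
    have pb : ∀ g, AA φ L (cpow v β) g ≤ (4 * C) * (max (za g) (zb g)) ^ (-β) := by
      intro g
      have j1 : AA φ L (cpow v β) g ≤ AA φ L v g ^ β :=
        AA_jensen φ L hβ0.le hβ1.le (fun g => (hv g).le) (fun g => le_of_eq (cpow_pos v hv β g)) g
      have e3 : -((2:ℝ) • -((2:ℝ) ^ (a + 1) • w)) = L := by
        rw [smul_neg, neg_neg, smul_smul, hL]; congr 1; ring
      have dual := AA_dual φ (-((2:ℝ) ^ (a + 1) • w)) v z hv hzv C (by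
        rw [e3]; exact hA (a + 2) (by omega)) g
      rw [e3] at dual
      have zab : za g ≤ 2 * zb g := by
        have := AA_le_mul φ 2 (by norm_num) (-((2:ℝ) ^ a • w)) (f := z) (fun g => (hz0 g).le) g
        have e4 : (2:ℝ) • -((2:ℝ) ^ a • w) = -((2:ℝ) ^ (a + 1) • w) := by
          rw [smul_neg, smul_smul]; congr 2; ring
        rwa [e4] at this
      have hzb0 : 0 < zb g := AA_pos φ _ hz0 g
      have hm : max (za g) (zb g) ≤ 2 * zb g := max_le zab (by linarith)
      have hAL : 0 < AA φ L v g := AA_pos φ _ hv g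
      have hm2 : max (za g) (zb g) * AA φ L v g ≤ 4 * C := by
        have := mul_le_mul_of_nonneg_right hm hAL.le
        linarith
      have hm0 : 0 < max (za g) (zb g) := lt_max_of_lt_right hzb0
      have h5 : (AA φ L v g) ^ β ≤ (4 * C / max (za g) (zb g)) ^ β :=
        Real.rpow_le_rpow hAL.le ((le_div_iff₀ hm0).2 (by linarith)) hβ0.le
      rw [Real.div_rpow (by positivity) hm0.le, div_eq_mul_inv, ← Real.rpow_neg hm0.le] at h5
      refine j1.trans (h5.trans (mul_le_mul_of_nonneg_right ?_ (Real.rpow_nonneg hm0.le _)))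
      calc (4 * C) ^ β ≤ (4 * C) ^ (1:ℝ) := Real.rpow_le_rpow_of_exponent_le (by linarith) hβ1.le
        _ = _ := Real.rpow_one _
    have q1 : ∀ g, (AA φ (-L) d g) ^ 2 ≤ AA φ (-L) (d ^ 2) g := by
      intro g
      have h1 := AA_jensen' φ (-L) (f := |d|) (s := 2) (by norm_num) (fun g => by simp) g
      have h2 : cpow |d| 2 = d ^ 2 := by
        ext x
        rw [cpow_nn _ _ (by norm_num)]
        simp
      rw [h2] at h1
      refine le_trans ?_ h1
      rw [Real.rpow_two]
      exact sq_le_sq' (by have := neg_le_of_abs_le (AA_abs φ (-L) d g); linarith)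
        ((le_abs_self _).trans (AA_abs φ (-L) d g))
    rw [NW_sq ν _ _ hcp]
    calc ∫ g, (AA φ (-L) d g) ^ 2 * cpow v β g ∂ν ≤ ∫ g, AA φ (-L) (d ^ 2) g * cpow v β g ∂ν := by
          refine integral_mono (C_int ν ((AA φ (-L) d) ^ 2 * cpow v β))
            (C_int ν (AA φ (-L) (d ^ 2) * cpow v β)) fun g => ?_
          exact mul_le_mul_of_nonneg_right (q1 g) (hcp g)
      _ = ∫ g, (d ^ 2) g * AA φ L (cpow v β) g ∂ν := by
          rw [AA_adj ν φ (-L), neg_neg]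
      _ ≤ ∫ g, (4 * C) * (d g ^ 2 * (za ⊔ zb) g ^ (-β)) ∂ν := by
          refine integral_mono (C_int ν (d ^ 2 * AA φ L (cpow v β)))
            ((wint ν d hmp (-β)).const_mul _) fun g => ?_
          have := mul_le_mul_of_nonneg_left (pb g) (sq_nonneg (d g))
          simp only [ContinuousMap.pow_apply, ContinuousMap.sup_apply]
          calc _ ≤ _ := this
            _ = _ := by ring
      _ = _ := by
          rw [integral_const_mul]; rfl
  calc _ ≤ _ := Finset.sum_le_sum hstep
    _ ≤ _ := by
      rw [← Finset.mul_sum]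
      refine (mul_le_mul_of_nonneg_left hM (by positivity)).trans (le_of_eq ?_)
      ring

end flow5

/-! ## Duality and weighted maximal inequality -/

section flow6
variable {G : Type*} [AddCommGroup G] [TopologicalSpace G] [IsTopologicalAddGroup G]
  [CompactSpace G]
variable [MeasurableSpace G] [BorelSpace G] (ν : Measure G) [IsProbabilityMeasure ν]
variable [ν.IsAddLeftInvariant]

lemma AA_commf (φ : ℝ × ℝ →ₜ+ G) (v w : ℝ × ℝ) (f : C(G, ℝ)) :
    AA φ v (AA φ w f) = AA φ w (AA φ v f) :=
  congrArg (fun L : Module.End ℝ C(G, ℝ) => L f) (AA_comm φ v w)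

lemma B_adj (φ : ℝ × ℝ →ₜ+ G) (u v w : ℝ × ℝ) (f h : C(G, ℝ)) :
    ∫ g, (AA φ u (AA φ v f - AA φ w f)) g * h g ∂ν =
      ∫ g, f g * (AA φ (-u) (AA φ (-v) h - AA φ (-w) h)) g ∂ν := by
  rw [AA_adj]
  have e1 : ∀ g, (AA φ v f - AA φ w f) g * (AA φ (-u) h) g =
      (AA φ v f) g * (AA φ (-u) h) g - (AA φ w f) g * (AA φ (-u) h) g := by
    intro g; simp [sub_mul]
  have e2 : ∀ g, f g * (AA φ (-u) (AA φ (-v) h - AA φ (-w) h)) g =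
      f g * (AA φ (-v) (AA φ (-u) h)) g - f g * (AA φ (-w) (AA φ (-u) h)) g := by
    intro g
    rw [map_sub, AA_commf φ (-u) (-v), AA_commf φ (-u) (-w)]
    simp [mul_sub]
  simp_rw [e1, e2]
  have i : ∀ a b : C(G, ℝ), Integrable (fun g => a g * b g) ν := fun a b => C_int ν (a * b)
  rw [integral_sub (i _ _) (i _ _), integral_sub (i _ _) (i _ _), AA_adj, AA_adj]

lemma cs_abs {x P S T D : ℝ} (hx : 0 ≤ x) (h2 : x ≤ P) (h5 : P ^ 2 ≤ S * T) (h4 : T ≤ D * x)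
    (h0 : 0 ≤ S) (hD : 0 ≤ D) : x ≤ D * S := by
  have h6 : x ^ 2 ≤ S * (D * x) :=
    calc x ^ 2 ≤ P ^ 2 := pow_le_pow_left₀ hx h2 2
      _ ≤ S * T := h5
      _ ≤ _ := mul_le_mul_of_nonneg_left h4 h0
  rcases hx.eq_or_lt with e | e
  · rw [← e]; positivity
  · have : x * x ≤ (D * S) * x := by nlinarith
    exact le_of_mul_le_mul_right this e

lemma dualN {β C : ℝ} (hβ : 1/2 ≤ β) (hβ1 : β < 1) (hC : 1 ≤ C) (φ : ℝ × ℝ →ₜ+ G) (w : ℝ × ℝ)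
    (M : ℕ) (v : C(G, ℝ)) (hv : ∀ g, 0 < v g)
    (hA : ∀ a < M + 2, ∀ g, AA φ ((2:ℝ) ^ a • w) v g ≤ C * v g) (F : ℕ → C(G, ℝ)) :
    NW ν (cpow v (-β)) (∑ a ∈ Finset.range M, AA φ ((2:ℝ) ^ (a + 2) • w)
      (AA φ ((2:ℝ) ^ a • w) (F a) - AA φ ((2:ℝ) ^ (a + 1) • w) (F a))) ^ 2 ≤
      (64 * C / (1 - β)) * ∑ a ∈ Finset.range M, NW ν (cpow v (-β)) (F a) ^ 2 := by
  set Φ := ∑ a ∈ Finset.range M, AA φ ((2:ℝ) ^ (a + 2) • w)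
      (AA φ ((2:ℝ) ^ a • w) (F a) - AA φ ((2:ℝ) ^ (a + 1) • w) (F a)) with hΦ
  set N := NW ν (cpow v (-β)) with hN
  set D := 64 * C / (1 - β) with hD
  have hD0 : 0 ≤ D := div_nonneg (by linarith) (by linarith)
  set h := Φ * cpow v (-β) with hh
  have hp : ∀ g, 0 < cpow v (-β) g := fun g => by
    rw [cpow_pos v hv]; exact Real.rpow_pos_of_pos (hv g) _
  have hp' : ∀ g, 0 < cpow v β g := fun g => by
    rw [cpow_pos v hv]; exact Real.rpow_pos_of_pos (hv g) _
  have hpp : ∀ g, cpow v (-β) g * cpow v β g = 1 := fun g => by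
    rw [cpow_pos v hv, cpow_pos v hv, ← Real.rpow_add (hv g)]; simp
  set B : ℕ → C(G, ℝ) := fun a => AA φ (-((2:ℝ) ^ (a + 2) • w))
      (AA φ (-((2:ℝ) ^ a • w)) h - AA φ (-((2:ℝ) ^ (a + 1) • w)) h) with hB
  have h1 : N Φ ^ 2 = ∑ a ∈ Finset.range M, ∫ g, F a g * B a g ∂ν := by
    rw [hN, NW_sq ν _ _ (fun g => (hp g).le)]
    have : ∀ g, Φ g ^ 2 * cpow v (-β) g = ∑ a ∈ Finset.range M, (AA φ ((2:ℝ) ^ (a + 2) • w)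
      (AA φ ((2:ℝ) ^ a • w) (F a) - AA φ ((2:ℝ) ^ (a + 1) • w) (F a))) g * h g := by
      intro g
      rw [← Finset.sum_mul, hh]
      have : Φ g = ∑ a ∈ Finset.range M, (AA φ ((2:ℝ) ^ (a + 2) • w)
        (AA φ ((2:ℝ) ^ a • w) (F a) - AA φ ((2:ℝ) ^ (a + 1) • w) (F a))) g := by
        rw [hΦ, ContinuousMap.sum_apply]
      rw [← this]; simp; ring
    simp_rw [this]
    rw [integral_finsetSum]
    · exact Finset.sum_congr rfl fun a _ => B_adj ν φ _ _ _ _ _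
    · intro a _; exact C_int ν (_ * h)
  have h2 : N Φ ^ 2 ≤ ∑ a ∈ Finset.range M, N (F a) * NW ν (cpow v β) (B a) := by
    rw [h1]; exact Finset.sum_le_sum fun a _ => NW_cs ν _ _ _ _ hp hpp
  have h3 : NW ν (cpow v β) h ^ 2 = N Φ ^ 2 := by
    rw [hN, NW_sq ν _ _ (fun g => (hp g).le), NW_sq ν _ _ (fun g => (hp' g).le)]
    refine integral_congr_ae (.of_forall fun g => ?_)
    have := hpp g
    simp only [hh, ContinuousMap.mul_apply]
    linear_combination (Φ g ^ 2 * cpow v (-β) g) * this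
  have h4 := dsqf ν hβ hβ1 hC φ w M h v hv hA
  rw [h3] at h4
  have h5 : (∑ a ∈ Finset.range M, N (F a) * NW ν (cpow v β) (B a)) ^ 2 ≤
      (∑ a ∈ Finset.range M, N (F a) ^ 2) * ∑ a ∈ Finset.range M, NW ν (cpow v β) (B a) ^ 2 :=
    Finset.sum_mul_sq_le_sq_mul_sq _ _ _
  have h0 : 0 ≤ ∑ a ∈ Finset.range M, N (F a) ^ 2 := Finset.sum_nonneg fun _ _ => sq_nonneg _
  exact cs_abs (sq_nonneg _) h2 h5 h4 h0 hD0

lemma wmax_pos {β C D : ℝ} (hβ : 1/2 ≤ β) (hβ1 : β < 1) (hC : 1 ≤ C) (φ : ℝ × ℝ →ₜ+ G)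
    (W : Finset (ℝ × ℝ)) (hMB : MB ν φ W (2 - β) D) (v : C(G, ℝ)) (hv : ∀ g, 0 < v g)
    (hA : ∀ w ∈ W, ∀ g, AA φ w v g ≤ C * v g) (F : C(G, ℝ)) (hF : ∀ g, 0 < F g) :
    NW ν (cpow v (-β)) (mx φ W F) ^ 2 ≤ C * D * NW ν (cpow v (-β)) F ^ 2 := by
  have hp : ∀ g, 0 < cpow v (-β) g := fun g => by
    rw [cpow_pos v hv]; exact Real.rpow_pos_of_pos (hv g) _
  have hb : 0 < 2 - β := by linarith
  rw [NW_sq ν _ _ (fun g => (hp g).le), NW_sq ν _ _ (fun g => (hp g).le)]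
  set h := cpow F (2 / (2 - β)) * cpow v (-β / (2 - β)) with hh
  have hhe : ∀ g, h g = F g ^ (2 / (2 - β)) * v g ^ (-β / (2 - β)) := fun g => by
    simp only [hh, ContinuousMap.mul_apply, cpow_pos v hv, cpow_pos F hF]
  have hh0 : ∀ g, 0 < h g := fun g => by
    rw [hhe]; exact mul_pos (Real.rpow_pos_of_pos (hF g) _) (Real.rpow_pos_of_pos (hv g) _)
  have hhp : ∀ g, h g ^ (2 - β) = F g ^ 2 * v g ^ (-β) := fun g => by
    rw [hhe, Real.mul_rpow (Real.rpow_pos_of_pos (hF g) _).le (Real.rpow_pos_of_pos (hv g) _).le,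
      ← Real.rpow_mul (hF g).le, ← Real.rpow_mul (hv g).le, div_mul_cancel₀ _ hb.ne',
      div_mul_cancel₀ _ hb.ne', Real.rpow_two]
  have hFe : ∀ g, F g = h g ^ ((2 - β) / 2) * v g ^ (1 - (2 - β) / 2) := fun g => by
    have : h g ^ ((2 - β) / 2) = F g * v g ^ (-β / 2) := by
      rw [hhe, Real.mul_rpow (Real.rpow_pos_of_pos (hF g) _).le (Real.rpow_pos_of_pos (hv g) _).le,
        ← Real.rpow_mul (hF g).le, ← Real.rpow_mul (hv g).le]
      rw [show 2 / (2 - β) * ((2 - β) / 2) = 1 by field_simp,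
        show -β / (2 - β) * ((2 - β) / 2) = -β / 2 by field_simp, Real.rpow_one]
    rw [this, mul_assoc, ← Real.rpow_add (hv g)]
    ring_nf; simp
  have key : ∀ g, mx φ W F g ≤ mx φ W h g ^ ((2 - β) / 2) * (C * v g) ^ (1 - (2 - β) / 2) := by
    intro g
    have hm := mx_pos φ W hh0 g
    have hCv : 0 < C * v g := mul_pos (by linarith) (hv g)
    rw [mx_le_iff]
    constructor
    · rw [hFe g]
      gcongr
      · exact Real.rpow_nonneg (hv g).le _
      · exact (hh0 g).le
      · exact mx_ge φ W h g
      · exact (hv g).le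
      · linarith
      · nlinarith [hv g]
    · intro w hw
      refine (AA_holder φ w (θ := (2 - β) / 2) (by linarith) (by linarith) (fun g => (hh0 g).le)
        (fun g => (hv g).le) (fun g => (hFe g).le) g).trans ?_
      gcongr
      · exact Real.rpow_nonneg (AA_nonneg φ w (fun g => (hv g).le) g) _
      · exact AA_nonneg φ w (fun g => (hh0 g).le) g
      · exact mx_ge' φ W h g w hw
      · exact AA_nonneg φ w (fun g => (hv g).le) g
      · linarith
      · exact hA w hw g
  have key2 : ∀ g, mx φ W F g ^ 2 * cpow v (-β) g ≤ C * mx φ W h g ^ (2 - β) := by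
    intro g
    have hm := mx_pos φ W hh0 g
    have hCv : 0 < C * v g := mul_pos (by linarith) (hv g)
    have hvp := Real.rpow_pos_of_pos (hv g) β
    calc mx φ W F g ^ 2 * cpow v (-β) g
        ≤ (mx φ W h g ^ ((2 - β) / 2) * (C * v g) ^ (1 - (2 - β) / 2)) ^ 2 * cpow v (-β) g := by
          gcongr
          · exact (hp g).le
          · exact (mx_pos φ W hF g).le
          · exact key g
      _ = mx φ W h g ^ (2 - β) * (C ^ β * (v g ^ β * v g ^ (-β))) := by
          rw [mul_pow, ← Real.rpow_natCast, ← Real.rpow_mul hm.le, ← Real.rpow_natCast _ 2,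
            ← Real.rpow_mul hCv.le, cpow_pos v hv]
          rw [show (2 - β) / 2 * ((2:ℕ):ℝ) = 2 - β by push_cast; ring,
            show (1 - (2 - β) / 2) * ((2:ℕ):ℝ) = β by push_cast; ring,
            Real.mul_rpow (by linarith) (hv g).le]
          ring
      _ = C ^ β * mx φ W h g ^ (2 - β) := by
          rw [← Real.rpow_add (hv g)]; simp; ring
      _ ≤ C * mx φ W h g ^ (2 - β) := by
          have : C ^ β ≤ C := by
            calc C ^ β ≤ C ^ (1:ℝ) := Real.rpow_le_rpow_of_exponent_le hC hβ1.le
              _ = C := Real.rpow_one C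
          have := Real.rpow_nonneg hm.le (2 - β)
          gcongr
  calc ∫ g, mx φ W F g ^ 2 * cpow v (-β) g ∂ν ≤ ∫ g, C * mx φ W h g ^ (2 - β) ∂ν := by
        refine integral_mono (C_int ν (mx φ W F ^ 2 * cpow v (-β))) ?_ key2
        exact (pow_int ν (mx_pos φ W hh0) _).const_mul _
    _ = C * ∫ g, mx φ W h g ^ (2 - β) ∂ν := integral_const_mul _ _
    _ ≤ C * (D * ∫ g, h g ^ (2 - β) ∂ν) := mul_le_mul_of_nonneg_left (hMB h hh0) (by linarith)
    _ = _ := by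
        simp_rw [hhp, cpow_pos v hv]; ring

/-- pointwise domination gives norm domination -/
lemma NW_mono (ρ F H : C(G, ℝ)) (hρ : ∀ g, 0 ≤ ρ g) (h : ∀ g, |F g| ≤ |H g|) :
    NW ν ρ F ≤ NW ν ρ H := by
  refine le_of_sq_le_sq ?_ (apply_nonneg _ _)
  rw [NW_sq ν _ _ hρ, NW_sq ν _ _ hρ]
  refine integral_mono (C_int ν (F ^ 2 * ρ)) (C_int ν (H ^ 2 * ρ)) fun g => ?_
  exact mul_le_mul_of_nonneg_right (sq_le_sq.2 (h g)) (hρ g)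

lemma wmax {β C D : ℝ} (hβ : 1/2 ≤ β) (hβ1 : β < 1) (hC : 1 ≤ C) (hD : 0 ≤ D) (φ : ℝ × ℝ →ₜ+ G)
    (W : Finset (ℝ × ℝ)) (hMB : MB ν φ W (2 - β) D) (v : C(G, ℝ)) (hv : ∀ g, 0 < v g)
    (hA : ∀ w ∈ W, ∀ g, AA φ w v g ≤ C * v g) (F : C(G, ℝ)) :
    NW ν (cpow v (-β)) (mx φ W |F|) ^ 2 ≤ C * D * NW ν (cpow v (-β)) F ^ 2 := by
  have hp : ∀ g, 0 < cpow v (-β) g := fun g => by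
    rw [cpow_pos v hv]; exact Real.rpow_pos_of_pos (hv g) _
  set N := NW ν (cpow v (-β)) with hN
  have hm : ∀ n : ℕ, N (mx φ W |F|) ^ 2 ≤ C * D * (N F + (1 / ((n:ℝ) + 1)) * N 1) ^ 2 := by
    intro n
    have he : 0 < 1 / ((n:ℝ) + 1) := by positivity
    set F' : C(G, ℝ) := |F| + (1 / ((n:ℝ) + 1)) • 1 with hF'
    have hF'0 : ∀ g, 0 < F' g := fun g => by
      simp only [hF', ContinuousMap.add_apply, ContinuousMap.smul_apply, ContinuousMap.one_apply,
        ContinuousMap.abs_apply, smul_eq_mul, mul_one]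
      positivity
    have hle : ∀ g, |F| g ≤ F' g := fun g => by
      simp only [hF', ContinuousMap.add_apply, ContinuousMap.smul_apply, ContinuousMap.one_apply,
        smul_eq_mul, mul_one]
      linarith
    have h1 := wmax_pos ν hβ hβ1 hC φ W hMB v hv hA F' hF'0
    have h2 : N (mx φ W |F|) ≤ N (mx φ W F') := by
      refine NW_mono ν _ _ _ (fun g => (hp g).le) fun g => ?_
      have e1 : 0 ≤ mx φ W |F| g := le_trans (by simp) (mx_ge φ W |F| g)
      rw [abs_of_nonneg e1, abs_of_pos (mx_pos φ W hF'0 g), mx_le_iff]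
      exact ⟨(hle g).trans (mx_ge _ _ _ _), fun w hw => (AA_mono φ w hle g).trans (mx_ge' _ _ _ _ w hw)⟩
    have h3 : N F' ≤ N F + (1 / ((n:ℝ) + 1)) * N 1 := by
      have := map_add_le_add N |F| ((1 / ((n:ℝ) + 1)) • 1)
      rw [map_smul_eq_mul, Real.norm_of_nonneg he.le] at this
      have e : N |F| ≤ N F := NW_mono ν _ _ _ (fun g => (hp g).le) fun g => by simp
      linarith
    calc N (mx φ W |F|) ^ 2 ≤ N (mx φ W F') ^ 2 := pow_le_pow_left₀ (apply_nonneg _ _) h2 2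
      _ ≤ _ := h1
      _ ≤ _ := by
        have : N F' ^ 2 ≤ (N F + (1 / ((n:ℝ) + 1)) * N 1) ^ 2 :=
          pow_le_pow_left₀ (apply_nonneg _ _) h3 2
        exact mul_le_mul_of_nonneg_left this (by positivity)
  have ht : Tendsto (fun n : ℕ => C * D * (N F + (1 / ((n:ℝ) + 1)) * N 1) ^ 2) atTop
      (𝓝 (C * D * (N F + 0 * N 1) ^ 2)) :=
    ((((tendsto_one_div_add_atTop_nhds_zero_nat).mul_const _).const_add _).pow 2).const_mul _
  have := ge_of_tendsto' ht hm
  simpa using this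

/-! ## Commutative algebra of resolvents -/

end flow6

section alg
variable {A : Type*} [CommRing A]

def al (t : A) : A := t ^ 2 + 4 * (1 - t) * t + 6 * (1 - t) ^ 2
def ga (t p : A) : A := 18 + 10 * p + 3 * p ^ 2 - 3 * t
def ph (t : A) : A := t ^ 2 * al t

lemma ph_diff (t p : A) (ht : t = 2 * p - t * p) :
    ph t - ph p = (1 - t) * (ga t p * (t - p) ^ 2) := by
  have h1 : t ^ 2 * (t ^ 2 + 4 * (1 - t) * t + 6 * (1 - t) ^ 2)
      - p ^ 2 * (p ^ 2 + 4 * (1 - p) * p + 6 * (1 - p) ^ 2)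
      = (1 - t) ^ 3 * p ^ 2 * (18 + 10 * p + 3 * p ^ 2 - 3 * t) := by grind
  have h2 : t - p = (1 - t) * p := by linear_combination ht
  unfold ph al ga
  rw [h1, h2]; ring

lemma ph_half (t p h : A) (ht : t = 2 * p - t * p) (hh : h + h = 1) :
    ph p = t * (h * (1 + p) * p * al p) := by
  unfold ph
  linear_combination (-(p ^ 2 * al p)) * hh - (h * p * al p) * ht

/-- factors -/
def Q1 (t p s : A) : A := (2 - p) * (2 - t) * ga t p * (2 - s) * al s
def Q2 (p s s' h : A) : A := (2 - s') * (2 - s) * ga s s' * (h * (1 + p) * al p)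
def HH (t p s s' h : A) : A :=
  t * s * (ga t p * (t - p) ^ 2 * (s * al s) + h * (1 + p) * p * al p * (ga s s' * (s - s') ^ 2))

lemma step_id (t p t2 s s' s2 h r κ : A) (ht : t = 2 * p - t * p) (hp : p = 2 * t2 - p * t2)
    (hs : s = 2 * s' - s * s') (hs' : s' = 2 * s2 - s' * s2) (hh : h + h = 1)
    (hr : r * ((1 - t) * s + t * (1 - s)) = κ * ((1 - r) * (t * s))) :
    r * (ph t * ph s - ph p * ph s') =
      - (r * (t2 * (t - p) * (Q1 t p s * ((t - p) * (s - s'))) +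
          s2 * (s - s') * (Q2 p s s' h * ((t - p) * (s - s'))))) + κ * (1 - r) * HH t p s s' h := by
  have e1 := ph_diff t p ht
  have e2 := ph_diff s s' hs
  have e3 := ph_half t p h ht hh
  have e4 : t = t2 * (2 - p) * (2 - t) := by linear_combination ht + (2 - t) * hp
  have e5 : s = s2 * (2 - s') * (2 - s) := by linear_combination hs + (2 - s) * hs'
  have e6 : (1 - s) * s = (s - s') * (2 - s) := by linear_combination -hs
  have e7 : (1 - t) * p = t - p := by linear_combination -ht
  have e8 : ph s = s * (s * al s) := by unfold ph; ring
  set X := ga t p * (t - p) ^ 2 with hX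
  set Y := ga s s' * (s - s') ^ 2 with hY
  have f1 : t2 * (t - p) * (Q1 t p s * ((t - p) * (s - s'))) = t * X * ((1 - s) * s * al s) := by
    rw [e6, hX]; unfold Q1
    linear_combination (-(ga t p * (t - p) ^ 2 * ((s - s') * (2 - s) * al s))) * e4
  have f2 : s2 * (s - s') * (Q2 p s s' h * ((t - p) * (s - s'))) =
      s * Y * ((1 - t) * (h * (1 + p) * p * al p)) := by
    rw [hY]; unfold Q2
    linear_combination (-(ga s s' * (s - s') ^ 2 * (h * (1 + p) * al p) * (t - p))) * e5
      - s * (ga s s' * (s - s') ^ 2) * (h * (1 + p) * al p) * e7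
  have f3 : HH t p s s' h = t * s * (X * (s * al s) + h * (1 + p) * p * al p * Y) := rfl
  rw [f1, f2, f3]
  have e9 : ph t * ph s - ph p * ph s' = (ph t - ph p) * ph s + ph p * (ph s - ph s') := by ring
  rw [e9, e1, e2, e8, e3]
  linear_combination (X * (s * al s) + h * (1 + p) * p * al p * Y) * hr

def Q3 (t p s s' h : A) : A :=
  ga t p * (1 - t) * (t - p) * ((2 - s) * al s) + h * (1 + p) * al p * (ga s s' * (1 - s) * (s - s'))

lemma err_hi (t p s s' h X Y κ κ' : A) (ht : t = 2 * p - t * p)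
    (hs : s = 2 * s' - s * s') (hκ : κ * κ' = 1) (hX : κ * (t * (1 - X)) = (1 - t) * X)
    (hY : κ * (s * (1 - Y)) = (1 - s) * Y) :
    κ * ((1 - X) * (1 - Y)) * HH t p s s' h =
      κ' * (X * Y * Q3 t p s s' h * ((t - p) * (s - s'))) := by
  have e6 : (1 - s) * s = (s - s') * (2 - s) := by linear_combination -hs
  have e7 : (1 - t) * p = t - p := by linear_combination -ht
  set B := ga t p * (t - p) ^ 2 * (s * al s) + h * (1 + p) * p * al p * (ga s s' * (s - s') ^ 2) with hB
  have f : κ * ((1 - X) * (1 - Y)) * HH t p s s' h = κ' * (X * Y * ((1 - t) * (1 - s) * B)) := by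
    have : HH t p s s' h = t * s * B := rfl
    rw [this]
    have e : κ * ((1 - X) * (1 - Y)) * (t * s * B) =
      κ' * ((κ * (t * (1 - X))) * (κ * (s * (1 - Y))) * B) := by
      linear_combination (-(κ * (t * (1 - X)) * (s * (1 - Y)) * B)) * hκ
    rw [e, hX, hY]; ring
  have g : (1 - t) * (1 - s) * B = Q3 t p s s' h * ((t - p) * (s - s')) := by
    rw [hB]; unfold Q3
    linear_combination ((1 - t) * ga t p * (t - p) ^ 2 * al s) * e6 +
      (1 - s) * h * (1 + p) * al p * (ga s s' * (s - s') ^ 2) * e7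
  rw [f, g]; ring

def Q4 (t p s X : A) : A := t * (1 - X) * ga t p * (t - p) * s * al s
def Q5 (p s s' h Y : A) : A := s * (1 - Y) * (h * (1 + p) * p * al p) * ga s s' * (s - s')

lemma err_lo (t p s s' h X Y : A) (SX SY : A) (hSX : t * (1 - X) = (2 - t) * (t - p) + t * SX)
    (hSY : s * (1 - Y) = (2 - s) * (s - s') + s * SY) :
    ((1 - X) * (1 - Y)) * HH t p s s' h =
      (Q4 t p s X * (2 - s) + Q5 p s s' h Y * (2 - t)) * ((t - p) * (s - s')) +
      (Q4 t p s X * s * ((t - p) * SY) + Q5 p s s' h Y * t * (SX * (s - s'))) := by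
  unfold Q4 Q5 HH
  linear_combination (t * (1 - X) * ga t p * (t - p) * s * al s) * (t - p) * hSY +
    (s * (1 - Y) * (h * (1 + p) * p * al p) * ga s s' * (s - s')) * (s - s') * hSX

lemma err_top (t p s s' X Y κ κ' : A) (ht : t = 2 * p - t * p)
    (hs : s = 2 * s' - s * s') (hκ : κ * κ' = 1) (hX : κ * (t * (1 - X)) = (1 - t) * X)
    (hY : κ * (s * (1 - Y)) = (1 - s) * Y) :
    ((1 - X) * (1 - Y)) * (ph t * ph s) =
      κ' * (κ' * (X * Y * (al t * al s * (2 - t) * (2 - s)) * ((t - p) * (s - s')))) := by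
  have e6 : (1 - s) * s = (s - s') * (2 - s) := by linear_combination -hs
  have e7 : (1 - t) * t = (t - p) * (2 - t) := by linear_combination -ht
  have e : ((1 - X) * (1 - Y)) * (ph t * ph s) =
      κ' * κ' * ((κ * (t * (1 - X))) * (κ * (s * (1 - Y))) * (t * s * al t * al s)) := by
    unfold ph
    linear_combination (-(κ * κ' + 1) * (((1 - X) * (1 - Y)) * (t ^ 2 * al t * (s ^ 2 * al s)))) * hκ
  rw [e, hX, hY]
  linear_combination (κ' * κ' * X * Y * al t * al s * ((1 - t) * t)) * e6 +
    (κ' * κ' * X * Y * al t * al s * ((s - s') * (2 - s))) * e7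

end alg

section nrm
variable {A : Type*} [CommRing A] [Algebra ℝ A] {V : Type*} [AddCommGroup V] [Module ℝ V] [Module A V]
  [IsScalarTower ℝ A V]

def Bd (N : Seminorm ℝ V) (C : ℝ) (j : ℕ) (z : A) : Prop := ∀ f : V, N (z • f) ≤ C ^ j * N f

variable {N : Seminorm ℝ V} {C : ℝ}

lemma Bd.mono (hC : 2 ≤ C) {j k : ℕ} {z : A} (h : Bd N C j z) (hjk : j ≤ k) : Bd N C k z := fun f =>
  (h f).trans (mul_le_mul_of_nonneg_right (pow_le_pow_right₀ (by linarith) hjk) (apply_nonneg _ _))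

lemma Bd.mul (hC : 2 ≤ C) {j k : ℕ} {z w : A} (h : Bd N C j z) (h' : Bd N C k w) :
    Bd N C (j + k) (z * w) := fun f => by
  rw [mul_smul, pow_add, mul_assoc]
  exact (h _).trans (mul_le_mul_of_nonneg_left (h' f) (by positivity))

lemma pow_add_le (hC : 2 ≤ C) (j k : ℕ) : C ^ j + C ^ k ≤ C ^ (j + k + 1) := by
  have h1 : C ^ j ≤ C ^ (j + k) := pow_le_pow_right₀ (by linarith) (by omega)
  have h2 : C ^ k ≤ C ^ (j + k) := pow_le_pow_right₀ (by linarith) (by omega)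
  have h3 : 0 ≤ C ^ (j + k) := by positivity
  rw [pow_succ]; nlinarith

lemma Bd.add (hC : 2 ≤ C) {j k : ℕ} {z w : A} (h : Bd N C j z) (h' : Bd N C k w) :
    Bd N C (j + k + 1) (z + w) := fun f => by
  rw [add_smul]
  refine (map_add_le_add N _ _).trans ((add_le_add (h f) (h' f)).trans ?_)
  rw [← add_mul]
  exact mul_le_mul_of_nonneg_right (pow_add_le hC j k) (apply_nonneg _ _)

lemma Bd.sub (hC : 2 ≤ C) {j k : ℕ} {z w : A} (h : Bd N C j z) (h' : Bd N C k w) :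
    Bd N C (j + k + 1) (z - w) := fun f => by
  rw [sub_smul]
  refine (map_sub_le_add N _ _).trans ((add_le_add (h f) (h' f)).trans ?_)
  rw [← add_mul]
  exact mul_le_mul_of_nonneg_right (pow_add_le hC j k) (apply_nonneg _ _)

lemma Bd.num (hC : 2 ≤ C) (c : ℝ) (j : ℕ) (hc : |c| ≤ 2 ^ j) : Bd N C j (algebraMap ℝ A c) := fun f => by
  rw [algebraMap_smul, map_smul_eq_mul, Real.norm_eq_abs]
  exact mul_le_mul_of_nonneg_right (hc.trans (pow_le_pow_left₀ (by norm_num) hC _)) (apply_nonneg _ _)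

lemma Bd.nat (hC : 2 ≤ C) (n j : ℕ) (hc : n ≤ 2 ^ j) : Bd N C j (n : A) := by
  have := Bd.num (A := A) (N := N) hC (n : ℝ) j (by rw [Nat.abs_cast]; exact_mod_cast hc)
  simpa using this

lemma Bd.one (hC : 2 ≤ C) : Bd N C 0 (1 : A) := by
  have := Bd.nat (A := A) (N := N) hC 1 0 (by norm_num); simpa using this
lemma Bd.two (hC : 2 ≤ C) : Bd N C 1 (2 : A) := by
  have := Bd.nat (A := A) (N := N) hC 2 1 (by norm_num); simpa using this
lemma Bd.c3 (hC : 2 ≤ C) : Bd N C 2 (3 : A) := by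
  have := Bd.nat (A := A) (N := N) hC 3 2 (by norm_num); simpa using this
lemma Bd.c4 (hC : 2 ≤ C) : Bd N C 2 (4 : A) := by
  have := Bd.nat (A := A) (N := N) hC 4 2 (by norm_num); simpa using this
lemma Bd.c6 (hC : 2 ≤ C) : Bd N C 3 (6 : A) := by
  have := Bd.nat (A := A) (N := N) hC 6 3 (by norm_num); simpa using this
lemma Bd.c10 (hC : 2 ≤ C) : Bd N C 4 (10 : A) := by
  have := Bd.nat (A := A) (N := N) hC 10 4 (by norm_num); simpa using this
lemma Bd.c18 (hC : 2 ≤ C) : Bd N C 5 (18 : A) := by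
  have := Bd.nat (A := A) (N := N) hC 18 5 (by norm_num); simpa using this

lemma Bd.sq (hC : 2 ≤ C) {j : ℕ} {z : A} (h : Bd N C j z) : Bd N C (j + j) (z ^ 2) := by
  rw [pow_two]; exact h.mul hC h

lemma Bd.al (hC : 2 ≤ C) {t : A} (h : Bd N C 1 t) : Bd N C 16 (al t) := by
  unfold _root_.al
  exact ((((h.sq hC).add hC (((Bd.c4 hC).mul hC ((Bd.one hC).sub hC h)).mul hC h)).add hC
    ((Bd.c6 hC).mul hC (((Bd.one hC).sub hC h).sq hC)))).mono hC (by norm_num)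

lemma Bd.ga (hC : 2 ≤ C) {t p : A} (h : Bd N C 1 t) (hp : Bd N C 1 p) : Bd N C 20 (ga t p) := by
  unfold _root_.ga
  exact (((((Bd.c18 hC).add hC ((Bd.c10 hC).mul hC hp)).add hC ((Bd.c3 hC).mul hC (hp.sq hC))).sub hC
    ((Bd.c3 hC).mul hC h))).mono hC (by norm_num)

lemma Bd.t2 (hC : 2 ≤ C) {t : A} (h : Bd N C 1 t) : Bd N C 3 (2 - t) := (Bd.two hC).sub hC h
lemma Bd.t1 (hC : 2 ≤ C) {t : A} (h : Bd N C 1 t) : Bd N C 2 (1 - t) := (Bd.one hC).sub hC h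
lemma Bd.p1 (hC : 2 ≤ C) {t : A} (h : Bd N C 1 t) : Bd N C 2 (1 + t) := (Bd.one hC).add hC h

lemma Bd.Q1 (hC : 2 ≤ C) {t p s : A} (h : Bd N C 1 t) (hp : Bd N C 1 p) (hs : Bd N C 1 s) :
    Bd N C 60 (Q1 t p s) := by
  unfold _root_.Q1
  exact (((((hp.t2 hC).mul hC (h.t2 hC)).mul hC (h.ga hC hp)).mul hC (hs.t2 hC)).mul hC (hs.al hC)).mono hC
    (by norm_num)

lemma Bd.Q2 (hC : 2 ≤ C) {p s s' h : A} (hh : Bd N C 0 h) (hp : Bd N C 1 p) (hs : Bd N C 1 s)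
    (hs' : Bd N C 1 s') : Bd N C 60 (Q2 p s s' h) := by
  unfold _root_.Q2
  exact ((((hs'.t2 hC).mul hC (hs.t2 hC)).mul hC (hs.ga hC hs')).mul hC
    ((hh.mul hC (hp.p1 hC)).mul hC (hp.al hC))).mono hC (by norm_num)

lemma Bd.Q3 (hC : 2 ≤ C) {t p s s' h : A} (hh : Bd N C 0 h) (ht : Bd N C 1 t) (hp : Bd N C 1 p)
    (hs : Bd N C 1 s) (hs' : Bd N C 1 s') : Bd N C 100 (Q3 t p s s' h) := by
  unfold _root_.Q3
  exact (((((ht.ga hC hp).mul hC (ht.t1 hC)).mul hC (ht.sub hC hp)).mul hC ((hs.t2 hC).mul hC (hs.al hC))).add hC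
   (((hh.mul hC (hp.p1 hC)).mul hC (hp.al hC)).mul hC
    (((hs.ga hC hs').mul hC (hs.t1 hC)).mul hC (hs.sub hC hs')))).mono hC (by norm_num)

lemma Bd.Q4 (hC : 2 ≤ C) {t p s X : A} (ht : Bd N C 1 t) (hp : Bd N C 1 p)
    (hs : Bd N C 1 s) (hX : Bd N C 1 X) : Bd N C 60 (Q4 t p s X) := by
  unfold _root_.Q4
  exact (((((ht.mul hC (hX.t1 hC)).mul hC (ht.ga hC hp)).mul hC (ht.sub hC hp)).mul hC hs).mul hC
    (hs.al hC)).mono hC (by norm_num)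

lemma Bd.Q5 (hC : 2 ≤ C) {p s s' h Y : A} (hh : Bd N C 0 h) (hp : Bd N C 1 p)
    (hs : Bd N C 1 s) (hs' : Bd N C 1 s') (hY : Bd N C 1 Y) : Bd N C 60 (Q5 p s s' h Y) := by
  unfold _root_.Q5
  exact ((((hs.mul hC (hY.t1 hC)).mul hC (((hh.mul hC (hp.p1 hC)).mul hC hp).mul hC (hp.al hC))).mul hC
    (hs.ga hC hs')).mul hC (hs.sub hC hs')).mono hC (by norm_num)

end nrm

/-! ## Error estimate -/

section err
variable {A : Type*} [CommRing A] [Algebra ℝ A] {V : Type*} [AddCommGroup V] [Module ℝ V] [Module A V]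
  [IsScalarTower ℝ A V]

def kap (A : Type*) [CommRing A] [Algebra ℝ A] (n a : ℕ) : A := algebraMap ℝ A ((2:ℝ) ^ ((a:ℤ) - (n:ℤ)))

lemma kap_mul (n a : ℕ) : kap A n a * kap A a n = 1 := by
  unfold kap
  rw [← map_mul, ← zpow_add₀ (by norm_num)]
  simp

lemma kap_succ (n a : ℕ) : kap A n (a + 1) = 2 * kap A n a := by
  unfold kap
  have : (2:A) = algebraMap ℝ A 2 := (map_ofNat _ 2).symm
  rw [this, ← map_mul]
  congr 1
  rw [show (((a + 1 : ℕ):ℤ) - (n:ℤ)) = ((a:ℤ) - n) + 1 by push_cast; ring, zpow_add₀ (by norm_num)]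
  simp [mul_comm]

lemma kap_self (n : ℕ) : kap A n n = 1 := by unfold kap; simp

lemma scale_rel (x : ℕ → A) (hx : ∀ a, x a = 2 * x (a + 1) - x a * x (a + 1)) (n a : ℕ) (h : n ≤ a) :
    kap A n a * (x a * (1 - x n)) = (1 - x a) * x n := by
  induction a, h using Nat.le_induction with
  | base => rw [kap_self]; ring
  | succ a h ih =>
    rw [kap_succ]
    linear_combination (1 + x (a + 1)) * ih + (-(kap A n a * (1 - x n)) - x n) * hx a

lemma tele (x : ℕ → A) (hx : ∀ a, x a = 2 * x (a + 1) - x a * x (a + 1)) (n a : ℕ) (h : a ≤ n) :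
    x a * (1 - x n) = (2 - x a) * (x a - x (a + 1)) +
      x a * ∑ i ∈ Finset.range (n - a), (x (a + i) - x (a + i + 1)) := by
  have := Finset.sum_range_sub' (fun i => x (a + i)) (n - a)
  simp only [← add_assoc] at this
  rw [this, show a + (n - a) = n by omega, add_zero]
  linear_combination -hx a

def dd (N : Seminorm ℝ V) (x y : ℕ → A) (f : V) (a b : ℕ) : ℝ :=
  N (((x a - x (a + 1)) * (y b - y (b + 1))) • f)

def DD (N : Seminorm ℝ V) (x y : ℕ → A) (f : V) (M i a : ℕ) : ℝ :=
  if a + i ≤ M then dd N x y f a (a + i) + dd N x y f (a + i) a else 0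

def wt (n a : ℕ) : ℝ := (3/4:ℝ) ^ ((n - a) + (a - n))

lemma dd_nonneg (N : Seminorm ℝ V) (x y : ℕ → A) (f : V) (a b : ℕ) : 0 ≤ dd N x y f a b := apply_nonneg _ _

lemma DD_nonneg (N : Seminorm ℝ V) (x y : ℕ → A) (f : V) (M i a : ℕ) : 0 ≤ DD N x y f M i a := by
  unfold DD; split_ifs
  · exact add_nonneg (dd_nonneg _ _ _ _ _ _) (dd_nonneg _ _ _ _ _ _)
  · exact le_rfl

variable {N : Seminorm ℝ V} {C : ℝ}

lemma N_kap (n a : ℕ) (z : A) (f : V) : N ((kap A n a * z) • f) = (2:ℝ) ^ ((a:ℤ) - (n:ℤ)) * N (z • f) := by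
  unfold kap
  rw [mul_smul, algebraMap_smul, map_smul_eq_mul, Real.norm_of_nonneg (by positivity)]

lemma kap_le_hi (n a : ℕ) (h : n ≤ a) : (2:ℝ) ^ ((n:ℤ) - (a:ℤ)) ≤ wt n a := by
  unfold wt
  rw [show n - a + (a - n) = a - n by omega,
    show (n:ℤ) - (a:ℤ) = -((a - n : ℕ) : ℤ) by push_cast [h]; ring, zpow_neg, zpow_natCast,
    ← inv_pow]
  exact pow_le_pow_left₀ (by norm_num) (by norm_num) _

lemma kap_le_lo (n a i : ℕ) (h : a ≤ n) (hi : i ≤ n - a) :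
    (2:ℝ) ^ ((a:ℤ) - (n:ℤ)) ≤ wt n a * (3/4) ^ i := by
  unfold wt
  rw [show n - a + (a - n) = n - a by omega,
    show (a:ℤ) - (n:ℤ) = -((n - a : ℕ) : ℤ) by push_cast [h]; ring, zpow_neg, zpow_natCast,
    ← inv_pow]
  calc ((2:ℝ)⁻¹) ^ (n - a) ≤ ((3/4:ℝ) * (3/4)) ^ (n - a) := pow_le_pow_left₀ (by norm_num) (by norm_num) _
    _ = (3/4:ℝ) ^ (n - a) * (3/4) ^ (n - a) := mul_pow _ _ _
    _ ≤ _ := mul_le_mul_of_nonneg_left (pow_le_pow_of_le_one (by norm_num) (by norm_num) hi) (by positivity)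

lemma N_sum {ι : Type*} (s : Finset ι) (F : ι → V) : N (∑ i ∈ s, F i) ≤ ∑ i ∈ s, N (F i) :=
  Finset.le_sum_of_subadditive N (map_zero N).le (map_add_le_add N) s F

lemma two_powC (hC : 2 ≤ C) (m : ℕ) {T : ℝ} (hT : 0 ≤ T) : 2 * (C ^ m * T) ≤ C ^ (m + 1) * T := by
  rw [pow_succ', mul_assoc]
  exact mul_le_mul_of_nonneg_right hC (by positivity)

def hlf (A : Type*) [CommRing A] [Algebra ℝ A] : A := algebraMap ℝ A (1/2)

lemma hlf_add : hlf A + hlf A = 1 := by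
  unfold hlf; rw [← map_add]; norm_num

lemma Bd.hlf (hC : 2 ≤ C) : Bd N C 0 (hlf A) := Bd.num hC _ _ (by norm_num [abs_le])

/-- the error terms -/
def HE (x y : ℕ → A) (r : A) (n a : ℕ) : A :=
  kap A n a * ((1 - r) * (((1 - x n) * (1 - y n)) * HH (x a) (x (a+1)) (y a) (y (a+1)) (hlf A)))

lemma err_term (hC : 2 ≤ C) (x y : ℕ → A) (r : A) (hx : ∀ a, x a = 2 * x (a + 1) - x a * x (a + 1))
    (hy : ∀ a, y a = 2 * y (a + 1) - y a * y (a + 1)) (M n a : ℕ) (hn : n ≤ M) (ha : a ≤ M)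
    (bx : ∀ a ≤ M + 1, Bd N C 1 (x a)) (by' : ∀ a ≤ M + 1, Bd N C 1 (y a)) (br : Bd N C 1 r) (f : V) :
    N (HE x y r n a • f) ≤ C ^ 130 * ∑ i ∈ Finset.range (M + 1), wt n a * (3/4) ^ i * DD N x y f M i a := by
  have b1 := bx a (by omega)
  have b2 := bx (a + 1) (by omega)
  have b3 := by' a (by omega)
  have b4 := by' (a + 1) (by omega)
  have b5 := bx n (by omega)
  have b6 := by' n (by omega)
  have bh : Bd N C 0 (hlf A) := Bd.hlf hC
  have hw : 0 ≤ wt n a := by unfold wt; positivity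
  have hterm : ∀ i ∈ Finset.range (M + 1), 0 ≤ wt n a * (3/4) ^ i * DD N x y f M i a :=
    fun i _ => mul_nonneg (by positivity) (DD_nonneg _ _ _ _ _ _ _)
  have hC0 : (0:ℝ) ≤ C ^ 130 := by positivity
  rcases le_total n a with h | h
  · have e : HE x y r n a = kap A a n * (((1 - r) * (x n * y n * Q3 (x a) (x (a+1)) (y a) (y (a+1)) (hlf A))) *
        ((x a - x (a + 1)) * (y a - y (a + 1)))) := by
      have := err_hi (x a) (x (a+1)) (y a) (y (a+1)) (hlf A) (x n) (y n) (kap A n a) (kap A a n)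
        (hx a) (hy a) (kap_mul n a) (scale_rel x hx n a h) (scale_rel y hy n a h)
      unfold HE
      linear_combination (1 - r) * this
    rw [e, N_kap, mul_smul]
    have B : Bd N C 130 ((1 - r) * (x n * y n * Q3 (x a) (x (a+1)) (y a) (y (a+1)) (hlf A))) :=
      ((br.t1 hC).mul hC ((b5.mul hC b6).mul hC (Bd.Q3 hC bh b1 b2 b3 b4))).mono hC (by norm_num)
    have hB := B (((x a - x (a + 1)) * (y a - y (a + 1))) • f)
    have hk := kap_le_hi n a h
    have hDD : dd N x y f a a ≤ DD N x y f M 0 a := by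
      unfold DD; rw [if_pos (by omega)]
      have := dd_nonneg N x y f a a
      simp only [add_zero]; linarith
    have hs : wt n a * (3/4) ^ 0 * DD N x y f M 0 a ≤
        ∑ i ∈ Finset.range (M + 1), wt n a * (3/4) ^ i * DD N x y f M i a :=
      Finset.single_le_sum hterm (Finset.mem_range.2 (by omega))
    have hdd := dd_nonneg N x y f a a
    calc _ ≤ wt n a * (C ^ 130 * dd N x y f a a) := by
          apply mul_le_mul hk hB (apply_nonneg _ _) hw
      _ ≤ wt n a * (C ^ 130 * DD N x y f M 0 a) := by gcongr
      _ = C ^ 130 * (wt n a * (3/4) ^ 0 * DD N x y f M 0 a) := by ring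
      _ ≤ _ := mul_le_mul_of_nonneg_left hs hC0
  · set SX := ∑ i ∈ Finset.range (n - a), (x (a + i) - x (a + i + 1)) with hSX
    set SY := ∑ i ∈ Finset.range (n - a), (y (a + i) - y (a + i + 1)) with hSY
    have e := err_lo (x a) (x (a+1)) (y a) (y (a+1)) (hlf A) (x n) (y n) SX SY
      (tele x hx n a h) (tele y hy n a h)
    unfold HE
    rw [N_kap, e, mul_smul, add_smul]
    set S : ℕ → ℝ := fun i => dd N x y f a (a + i) + dd N x y f (a + i) a with hS
    have hS0 : ∀ i, 0 ≤ S i := fun i => add_nonneg (dd_nonneg _ _ _ _ _ _) (dd_nonneg _ _ _ _ _ _)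
    have q4 := Bd.Q4 hC b1 b2 b3 b5
    have q5 := Bd.Q5 hC bh b2 b3 b4 b6
    have B1 : Bd N C 127 (Q4 (x a) (x (a+1)) (y a) (x n) * (2 - y a) +
        Q5 (x (a+1)) (y a) (y (a+1)) (hlf A) (y n) * (2 - x a)) :=
      ((q4.mul hC (b3.t2 hC)).add hC (q5.mul hC (b1.t2 hC))).mono hC (by norm_num)
    have B2 : Bd N C 127 (Q4 (x a) (x (a+1)) (y a) (x n) * y a) := (q4.mul hC b3).mono hC (by norm_num)
    have B3 : Bd N C 127 (Q5 (x (a+1)) (y a) (y (a+1)) (hlf A) (y n) * x a) :=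
      (q5.mul hC b1).mono hC (by norm_num)
    have k1 : N (((x a - x (a + 1)) * SY) • f) ≤ ∑ i ∈ Finset.range (n - a), dd N x y f a (a + i) := by
      rw [hSY, Finset.mul_sum, Finset.sum_smul]
      exact N_sum _ _
    have k2 : N ((SX * (y a - y (a + 1))) • f) ≤ ∑ i ∈ Finset.range (n - a), dd N x y f (a + i) a := by
      rw [hSX, Finset.sum_mul, Finset.sum_smul]
      exact N_sum _ _
    have k3 : dd N x y f a a ≤ ∑ i ∈ Finset.range (n - a + 1), S i := by
      have : S 0 ≤ ∑ i ∈ Finset.range (n - a + 1), S i :=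
        Finset.single_le_sum (fun i _ => hS0 i) (Finset.mem_range.2 (by omega))
      have := dd_nonneg N x y f a a
      simp only [hS, add_zero] at *; linarith
    have k4 : ∑ i ∈ Finset.range (n - a), dd N x y f a (a + i) + ∑ i ∈ Finset.range (n - a), dd N x y f (a + i) a
        ≤ ∑ i ∈ Finset.range (n - a + 1), S i := by
      rw [← Finset.sum_add_distrib, Finset.sum_range_succ]
      have := hS0 (n - a)
      simp only [hS] at *; linarith
    set T := ∑ i ∈ Finset.range (n - a + 1), S i with hT
    have hT0 : 0 ≤ T := Finset.sum_nonneg fun i _ => hS0 i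
    set u1 := (Q4 (x a) (x (a+1)) (y a) (x n) * (2 - y a) +
        Q5 (x (a+1)) (y a) (y (a+1)) (hlf A) (y n) * (2 - x a))
    set u2 := Q4 (x a) (x (a+1)) (y a) (x n) * y a
    set u3 := Q5 (x (a+1)) (y a) (y (a+1)) (hlf A) (y n) * x a
    have k5 : N ((u1 * ((x a - x (a + 1)) * (y a - y (a + 1)))) • f + (u2 * ((x a - x (a + 1)) * SY) +
        u3 * (SX * (y a - y (a + 1)))) • f) ≤ C ^ 128 * T := by
      rw [add_smul, mul_smul u1, mul_smul u2, mul_smul u3]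
      have t1 := map_add_le_add N (u1 • ((x a - x (a + 1)) * (y a - y (a + 1))) • f)
        (u2 • ((x a - x (a + 1)) * SY) • f + u3 • (SX * (y a - y (a + 1))) • f)
      have t2 := map_add_le_add N (u2 • ((x a - x (a + 1)) * SY) • f) (u3 • (SX * (y a - y (a + 1))) • f)
      have t3 := B1 (((x a - x (a + 1)) * (y a - y (a + 1))) • f)
      have t4 := B2 (((x a - x (a + 1)) * SY) • f)
      have t5 := B3 ((SX * (y a - y (a + 1))) • f)
      have t6 : N (((x a - x (a + 1)) * (y a - y (a + 1))) • f) ≤ T := k3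
      have hc : (0:ℝ) ≤ C ^ 127 := by positivity
      have t7 : C ^ 127 * (N (((x a - x (a + 1)) * SY) • f) + N ((SX * (y a - y (a + 1))) • f)) ≤ C ^ 127 * T :=
        mul_le_mul_of_nonneg_left (by linarith) hc
      have t8 : C ^ 127 * N (((x a - x (a + 1)) * (y a - y (a + 1))) • f) ≤ C ^ 127 * T :=
        mul_le_mul_of_nonneg_left t6 hc
      have t9 : 2 * (C ^ 127 * T) ≤ C ^ 128 * T := two_powC hC 127 hT0
      linarith
    have k6 := (br.t1 hC) ((u1 * ((x a - x (a + 1)) * (y a - y (a + 1)))) • f + (u2 * ((x a - x (a + 1)) * SY) +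
        u3 * (SX * (y a - y (a + 1)))) • f)
    have k7 : (2:ℝ) ^ ((a:ℤ) - (n:ℤ)) * T ≤ ∑ i ∈ Finset.range (M + 1), wt n a * (3/4) ^ i * DD N x y f M i a := by
      rw [hT, Finset.mul_sum]
      calc _ ≤ ∑ i ∈ Finset.range (n - a + 1), wt n a * (3/4) ^ i * DD N x y f M i a := by
            refine Finset.sum_le_sum fun i hi => ?_
            have hi' := Finset.mem_range.1 hi
            have : DD N x y f M i a = S i := by unfold DD; rw [if_pos (by omega)]
            rw [this]
            exact mul_le_mul_of_nonneg_right (kap_le_lo n a i h (by omega)) (hS0 i)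
        _ ≤ _ := Finset.sum_le_sum_of_subset_of_nonneg
            (Finset.range_mono (by omega)) fun i hi _ => hterm i hi
    have hk0 : (0:ℝ) ≤ (2:ℝ) ^ ((a:ℤ) - (n:ℤ)) := by positivity
    calc _ ≤ (2:ℝ) ^ ((a:ℤ) - (n:ℤ)) * (C ^ 2 * (C ^ 128 * T)) := by
          refine mul_le_mul_of_nonneg_left ?_ hk0
          exact k6.trans (mul_le_mul_of_nonneg_left k5 (by positivity))
      _ = C ^ 130 * ((2:ℝ) ^ ((a:ℤ) - (n:ℤ)) * T) := by ring
      _ ≤ _ := mul_le_mul_of_nonneg_left k7 hC0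

lemma err_topN (hC : 2 ≤ C) (x y : ℕ → A) (r : A) (hx : ∀ a, x a = 2 * x (a + 1) - x a * x (a + 1))
    (hy : ∀ a, y a = 2 * y (a + 1) - y a * y (a + 1)) (M n : ℕ) (hn : n ≤ M)
    (bx : ∀ a ≤ M + 1, Bd N C 1 (x a)) (by' : ∀ a ≤ M + 1, Bd N C 1 (y a)) (br : Bd N C 1 r) (f : V) :
    N ((r * ((1 - x n) * (1 - y n)) * (ph (x M) * ph (y M))) • f) ≤
      C ^ 130 * ∑ i ∈ Finset.range (M + 1), wt n M * (3/4) ^ i * DD N x y f M i M := by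
  have b1 := bx M (by omega)
  have b3 := by' M (by omega)
  have b5 := bx n (by omega)
  have b6 := by' n (by omega)
  have hw : 0 ≤ wt n M := by unfold wt; positivity
  have hterm : ∀ i ∈ Finset.range (M + 1), 0 ≤ wt n M * (3/4) ^ i * DD N x y f M i M :=
    fun i _ => mul_nonneg (by positivity) (DD_nonneg _ _ _ _ _ _ _)
  have e : r * ((1 - x n) * (1 - y n)) * (ph (x M) * ph (y M)) = kap A M n * (kap A M n *
      ((r * (x n * y n * (al (x M) * al (y M) * (2 - x M) * (2 - y M)))) *
        ((x M - x (M + 1)) * (y M - y (M + 1))))) := by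
    have := err_top (x M) (x (M+1)) (y M) (y (M+1)) (x n) (y n) (kap A n M) (kap A M n)
        (hx M) (hy M) (kap_mul n M) (scale_rel x hx n M hn) (scale_rel y hy n M hn)
    linear_combination r * this
  rw [e, N_kap, N_kap, mul_smul]
  have B : Bd N C 130 (r * (x n * y n * (al (x M) * al (y M) * (2 - x M) * (2 - y M)))) :=
    (br.mul hC ((b5.mul hC b6).mul hC ((((b1.al hC).mul hC (b3.al hC)).mul hC (b1.t2 hC)).mul hC
      (b3.t2 hC)))).mono hC (by norm_num)
  have hB := B (((x M - x (M + 1)) * (y M - y (M + 1))) • f)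
  have hk := kap_le_hi n M hn
  have hDD : dd N x y f M M ≤ DD N x y f M 0 M := by
    unfold DD; rw [if_pos (by omega)]
    have := dd_nonneg N x y f M M
    simp only [add_zero]; linarith
  have hs : wt n M * (3/4) ^ 0 * DD N x y f M 0 M ≤
      ∑ i ∈ Finset.range (M + 1), wt n M * (3/4) ^ i * DD N x y f M i M :=
    Finset.single_le_sum hterm (Finset.mem_range.2 (by omega))
  have hk1 : (2:ℝ) ^ ((n:ℤ) - (M:ℤ)) ≤ 1 := zpow_le_one_of_nonpos₀ (by norm_num) (by omega)
  have hdd := dd_nonneg N x y f M M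
  have hX : 0 ≤ wt n M * (C ^ 130 * dd N x y f M M) := by positivity
  calc _ ≤ 1 * (wt n M * (C ^ 130 * dd N x y f M M)) :=
        mul_le_mul hk1 (mul_le_mul hk hB (apply_nonneg _ _) hw)
          (mul_nonneg (by positivity) (apply_nonneg _ _)) zero_le_one
    _ ≤ wt n M * (C ^ 130 * DD N x y f M 0 M) := by rw [one_mul]; gcongr
    _ = C ^ 130 * (wt n M * (3/4) ^ 0 * DD N x y f M 0 M) := by ring
    _ ≤ _ := mul_le_mul_of_nonneg_left hs (by positivity)

/-- main part operator -/
def PP (x y : ℕ → A) (M : ℕ) : A := ∑ a ∈ Finset.range M,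
  (x (a+2) * (x a - x (a+1)) * (Q1 (x a) (x (a+1)) (y a) * ((x a - x (a+1)) * (y a - y (a+1)))) +
    y (a+2) * (y a - y (a+1)) * (Q2 (x (a+1)) (y a) (y (a+1)) (hlf A) * ((x a - x (a+1)) * (y a - y (a+1)))))

def ER (x y : ℕ → A) (r : A) (M n : ℕ) : A :=
  r * ((1 - x n) * (1 - y n)) * (ph (x M) * ph (y M)) + ∑ a ∈ Finset.range M, HE x y r n a

lemma decomp (x y : ℕ → A) (r : A) (hx : ∀ a, x a = 2 * x (a + 1) - x a * x (a + 1))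
    (hy : ∀ a, y a = 2 * y (a + 1) - y a * y (a + 1)) (M n : ℕ)
    (hr : ∀ a, r * ((1 - x a) * y a + x a * (1 - y a)) = kap A n a * ((1 - r) * (x a * y a))) :
    r = x n * y n + r * ((1 - x n) * (1 - y n)) * (1 - ph (x 0) * ph (y 0))
      - r * ((1 - x n) * (1 - y n)) * PP x y M + ER x y r M n := by
  have h1 : r = x n * y n + r * ((1 - x n) * (1 - y n)) := by
    have := hr n
    rw [kap_self] at this
    linear_combination this
  have h2 := Finset.sum_range_sub' (fun a => r * (ph (x a) * ph (y a))) M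
  have h3 : ∑ a ∈ Finset.range M, (r * (ph (x a) * ph (y a)) - r * (ph (x (a+1)) * ph (y (a+1)))) =
      - (r * PP x y M) + ∑ a ∈ Finset.range M, kap A n a * (1 - r) * HH (x a) (x (a+1)) (y a) (y (a+1)) (hlf A) := by
    unfold PP
    rw [Finset.mul_sum, ← Finset.sum_neg_distrib, ← Finset.sum_add_distrib]
    refine Finset.sum_congr rfl fun a _ => ?_
    have := step_id (x a) (x (a+1)) (x (a+2)) (y a) (y (a+1)) (y (a+2)) (hlf A) r (kap A n a)
      (hx a) (hx (a+1)) (hy a) (hy (a+1)) hlf_add (hr a)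
    rw [← this]; ring
  have h4 : ∑ a ∈ Finset.range M, HE x y r n a = ((1 - x n) * (1 - y n)) *
      ∑ a ∈ Finset.range M, kap A n a * (1 - r) * HH (x a) (x (a+1)) (y a) (y (a+1)) (hlf A) := by
    rw [Finset.mul_sum]
    refine Finset.sum_congr rfl fun a _ => ?_
    unfold HE; ring
  unfold ER
  rw [h4]
  rw [h3] at h2
  linear_combination h1 - ((1 - x n) * (1 - y n)) * h2

lemma ER_bd (hC : 2 ≤ C) (x y : ℕ → A) (r : A) (hx : ∀ a, x a = 2 * x (a + 1) - x a * x (a + 1))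
    (hy : ∀ a, y a = 2 * y (a + 1) - y a * y (a + 1)) (M n : ℕ) (hn : n ≤ M)
    (bx : ∀ a ≤ M + 1, Bd N C 1 (x a)) (by' : ∀ a ≤ M + 1, Bd N C 1 (y a)) (br : Bd N C 1 r) (f : V) :
    N (ER x y r M n • f) ≤ C ^ 130 * ∑ a ∈ Finset.range (M + 1), ∑ i ∈ Finset.range (M + 1),
      wt n a * (3/4) ^ i * DD N x y f M i a := by
  unfold ER
  rw [add_smul, Finset.sum_smul, Finset.sum_range_succ _ M, mul_add, add_comm (C ^ 130 * _)]
  refine (map_add_le_add N _ _).trans (add_le_add (err_topN hC x y r hx hy M n hn bx by' br f) ?_)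
  refine (N_sum _ _).trans ?_
  rw [Finset.mul_sum]
  exact Finset.sum_le_sum fun a ha => err_term hC x y r hx hy M n a hn (Finset.mem_range.1 ha).le bx by' br f

end err

/-! ## Summation of the errors -/

section summ

lemma wt_nonneg (n a : ℕ) : 0 ≤ wt n a := by unfold wt; positivity

lemma wt_symm (n a : ℕ) : wt n a = wt a n := by unfold wt; rw [add_comm]

lemma wt_sum_lo (n m : ℕ) (h : m ≤ n) : ∑ a ∈ Finset.range m, wt n a ≤ 3 * (3/4) ^ (n - m) := by
  induction m with
  | zero => simp; positivity
  | succ m ih =>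
    rw [Finset.sum_range_succ]
    have h1 := ih (by omega)
    have h2 : wt n m = (3/4) ^ (n - m) := by
      unfold wt; rw [show n - m + (m - n) = n - m by omega]
    rw [show n - m = (n - (m + 1)) + 1 by omega, pow_succ] at h1 h2
    rw [h2]; linarith

lemma wt_sum_hi (n j : ℕ) : ∑ a ∈ Finset.range (n + j), wt n a ≤ 7 - 4 * (3/4) ^ j := by
  induction j with
  | zero => have := wt_sum_lo n n le_rfl; simp at this ⊢; linarith
  | succ j ih =>
    rw [← add_assoc, Finset.sum_range_succ]
    have h2 : wt n (n + j) = (3/4) ^ j := by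
      unfold wt; rw [show n - (n + j) + (n + j - n) = j by omega]
    rw [h2, pow_succ]; linarith

lemma wt_sum (n m : ℕ) : ∑ a ∈ Finset.range m, wt n a ≤ 8 := by
  have h1 : ∑ a ∈ Finset.range m, wt n a ≤ ∑ a ∈ Finset.range (n + m), wt n a :=
    Finset.sum_le_sum_of_subset_of_nonneg (Finset.range_mono (by omega)) fun i _ _ => wt_nonneg _ _
  have h2 := wt_sum_hi n m
  have : (0:ℝ) ≤ 4 * (3/4) ^ m := by positivity
  linarith

lemma geo_sum (m : ℕ) : ∑ i ∈ Finset.range m, (3/4:ℝ) ^ i ≤ 4 := by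
  have : ∑ i ∈ Finset.range m, (3/4:ℝ) ^ i = 4 - 4 * (3/4) ^ m := by
    induction m with
    | zero => simp
    | succ m ih => rw [Finset.sum_range_succ, ih, pow_succ]; ring
  rw [this]
  have : (0:ℝ) ≤ 4 * (3/4) ^ m := by positivity
  linarith

lemma schur (m K : ℕ) (D : ℕ → ℕ → ℕ → ℝ) (E : ℝ)
    (hE : ∀ i, ∑ k ∈ Finset.range K, ∑ a ∈ Finset.range m, D k i a ^ 2 ≤ E) :
    ∑ n ∈ Finset.range m, ∑ k ∈ Finset.range K,
      (∑ a ∈ Finset.range m, ∑ i ∈ Finset.range m, wt n a * (3/4) ^ i * D k i a) ^ 2 ≤ 1024 * E := by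
  have h1 : ∀ n k, (∑ a ∈ Finset.range m, ∑ i ∈ Finset.range m, wt n a * (3/4) ^ i * D k i a) ^ 2 ≤
      32 * ∑ a ∈ Finset.range m, ∑ i ∈ Finset.range m, wt n a * (3/4) ^ i * D k i a ^ 2 := by
    intro n k
    rw [← Finset.sum_product', ← Finset.sum_product']
    refine (Finset.sum_sq_le_sum_mul_sum_of_sq_eq_mul (Finset.range m ×ˢ Finset.range m)
      (f := fun x => wt n x.1 * (3/4) ^ x.2) (g := fun x => wt n x.1 * (3/4) ^ x.2 * D k x.2 x.1 ^ 2)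
      (fun x _ => mul_nonneg (wt_nonneg _ _) (by positivity))
      (fun x _ => mul_nonneg (mul_nonneg (wt_nonneg _ _) (by positivity)) (sq_nonneg _))
      (fun x _ => by ring)).trans ?_
    refine mul_le_mul_of_nonneg_right ?_
      (Finset.sum_nonneg fun x _ => mul_nonneg (mul_nonneg (wt_nonneg _ _) (by positivity)) (sq_nonneg _))
    rw [Finset.sum_product]
    simp_rw [← Finset.mul_sum]
    rw [← Finset.sum_mul]
    calc _ ≤ (8:ℝ) * 4 := mul_le_mul (wt_sum n m) (geo_sum m) (Finset.sum_nonneg fun i _ => by positivity) (by norm_num)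
      _ = 32 := by norm_num
  have hE0 : 0 ≤ E := le_trans (Finset.sum_nonneg fun k _ => Finset.sum_nonneg fun a _ => sq_nonneg _) (hE 0)
  calc _ ≤ ∑ n ∈ Finset.range m, ∑ k ∈ Finset.range K,
        32 * ∑ a ∈ Finset.range m, ∑ i ∈ Finset.range m, wt n a * (3/4) ^ i * D k i a ^ 2 :=
        Finset.sum_le_sum fun n _ => Finset.sum_le_sum fun k _ => h1 n k
    _ = 32 * ∑ i ∈ Finset.range m, (3/4) ^ i * ∑ k ∈ Finset.range K, ∑ a ∈ Finset.range m,
        (∑ n ∈ Finset.range m, wt n a) * D k i a ^ 2 := by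
        simp_rw [← Finset.mul_sum]
        congr 1
        simp_rw [Finset.mul_sum, Finset.sum_mul, Finset.mul_sum]
        -- order n k a i on the left, i k a n on the right
        rw [Finset.sum_comm]
        rw [Finset.sum_comm (s := Finset.range m) (t := Finset.range K)]
        refine Finset.sum_congr rfl fun k _ => ?_
        rw [Finset.sum_comm]
        rw [Finset.sum_comm (s := Finset.range m) (t := Finset.range m)
          (f := fun i a => ∑ n ∈ Finset.range m, (3/4:ℝ) ^ i * (wt n a * D k i a ^ 2))]
        refine Finset.sum_congr rfl fun a _ => ?_
        rw [Finset.sum_comm]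
        exact Finset.sum_congr rfl fun i _ => Finset.sum_congr rfl fun n _ => by ring
    _ ≤ 32 * ∑ i ∈ Finset.range m, (3/4) ^ i * (8 * E) := by
        refine mul_le_mul_of_nonneg_left (Finset.sum_le_sum fun i _ => ?_) (by norm_num)
        refine mul_le_mul_of_nonneg_left ?_ (by positivity)
        calc _ ≤ ∑ k ∈ Finset.range K, ∑ a ∈ Finset.range m, 8 * D k i a ^ 2 := by
              refine Finset.sum_le_sum fun k _ => Finset.sum_le_sum fun a _ => ?_
              refine mul_le_mul_of_nonneg_right ?_ (sq_nonneg _)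
              simp_rw [fun n => wt_symm n a]
              exact wt_sum a m
          _ = 8 * ∑ k ∈ Finset.range K, ∑ a ∈ Finset.range m, D k i a ^ 2 := by simp_rw [← Finset.mul_sum]
          _ ≤ _ := mul_le_mul_of_nonneg_left (hE i) (by norm_num)
    _ ≤ _ := by
        rw [← Finset.sum_mul]
        have := geo_sum m
        nlinarith

variable {A : Type*} [CommRing A] [Algebra ℝ A] {V : Type*} [AddCommGroup V] [Module ℝ V] [Module A V]
  [IsScalarTower ℝ A V] {N : Seminorm ℝ V} {C : ℝ}

/-- the bundled hypotheses -/
structure Sys (N : Seminorm ℝ V) (C : ℝ) (M K : ℕ) (x : ℕ → A) (y : ℕ → ℕ → A) : Prop where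
  hC : 2 ≤ C
  hx : ∀ a, x a = 2 * x (a + 1) - x a * x (a + 1)
  hy : ∀ k a, y k a = 2 * y k (a + 1) - y k a * y k (a + 1)
  bx : ∀ a ≤ M + 1, Bd N C 1 (x a)
  bdy : ∀ k < K, ∀ a ≤ M + 1, Bd N C 1 (y k a)
  sqX : ∀ f : V, ∑ a ∈ Finset.range (M + 1), N ((x a - x (a + 1)) • f) ^ 2 ≤ C * N f ^ 2
  sqY : ∀ b ≤ M, ∀ f : V, ∑ k ∈ Finset.range K, N ((y k b - y k (b + 1)) • f) ^ 2 ≤ C * N f ^ 2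
  dX : ∀ F : ℕ → V, N (∑ a ∈ Finset.range M, (x (a + 2) * (x a - x (a + 1))) • F a) ^ 2 ≤
    C * ∑ a ∈ Finset.range M, N (F a) ^ 2
  dY : ∀ k < K, ∀ F : ℕ → V, N (∑ a ∈ Finset.range M, (y k (a + 2) * (y k a - y k (a + 1))) • F a) ^ 2 ≤
    C * ∑ a ∈ Finset.range M, N (F a) ^ 2

variable {M K : ℕ} {x : ℕ → A} {y : ℕ → ℕ → A}

lemma Sys.sum_dd (h : Sys N C M K x y) (p q : ℕ → ℕ) (s : Finset ℕ) (hp : ∀ a ∈ s, p a ∈ Finset.range (M+1))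
    (hpi : Set.InjOn p s) (hq : ∀ a ∈ s, q a ≤ M) (f : V) :
    ∑ k ∈ Finset.range K, ∑ a ∈ s, dd N x (y k) f (p a) (q a) ^ 2 ≤ C ^ 2 * N f ^ 2 := by
  have hC := h.hC
  rw [Finset.sum_comm]
  calc _ ≤ ∑ a ∈ s, C * N ((x (p a) - x (p a + 1)) • f) ^ 2 := by
        refine Finset.sum_le_sum fun a ha => ?_
        refine le_trans (le_of_eq ?_) (h.sqY (q a) (hq a ha) ((x (p a) - x (p a + 1)) • f))
        refine Finset.sum_congr rfl fun k _ => ?_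
        unfold dd; rw [mul_comm, mul_smul]
    _ = C * ∑ a ∈ s.image p, N ((x a - x (a + 1)) • f) ^ 2 := by
        rw [Finset.sum_image hpi, Finset.mul_sum]
    _ ≤ C * ∑ a ∈ Finset.range (M + 1), N ((x a - x (a + 1)) • f) ^ 2 := by
        refine mul_le_mul_of_nonneg_left (Finset.sum_le_sum_of_subset_of_nonneg ?_ fun _ _ _ => sq_nonneg _) (by linarith)
        exact Finset.image_subset_iff.2 hp
    _ ≤ C * (C * N f ^ 2) := mul_le_mul_of_nonneg_left (h.sqX f) (by linarith)
    _ = _ := by ring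

lemma Sys.sum_DD (h : Sys N C M K x y) (f : V) (i : ℕ) :
    ∑ k ∈ Finset.range K, ∑ a ∈ Finset.range (M + 1), DD N x (y k) f M i a ^ 2 ≤ 4 * C ^ 2 * N f ^ 2 := by
  set s := (Finset.range (M + 1)).filter (fun a => a + i ≤ M) with hs
  have hm : ∀ a ∈ s, a + i ≤ M := fun a ha => (Finset.mem_filter.1 ha).2
  have h1 := h.sum_dd (fun a => a) (fun a => a + i) s (fun a ha => (Finset.mem_filter.1 ha).1)
    (fun a _ b _ e => e) hm f
  have h2 := h.sum_dd (fun a => a + i) (fun a => a) s (fun a ha => Finset.mem_range.2 (by have := hm a ha; omega))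
    (fun a _ b _ e => by simpa using e) (fun a ha => by have := hm a ha; omega) f
  calc _ ≤ ∑ k ∈ Finset.range K, ∑ a ∈ s, (2 * dd N x (y k) f a (a + i) ^ 2 + 2 * dd N x (y k) f (a + i) a ^ 2) := by
        refine Finset.sum_le_sum fun k _ => ?_
        rw [hs, Finset.sum_filter]
        refine Finset.sum_le_sum fun a _ => ?_
        unfold DD
        split_ifs
        · nlinarith [sq_nonneg (dd N x (y k) f a (a + i) - dd N x (y k) f (a + i) a)]
        · simp
    _ = 2 * ∑ k ∈ Finset.range K, ∑ a ∈ s, dd N x (y k) f a (a + i) ^ 2 +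
        2 * ∑ k ∈ Finset.range K, ∑ a ∈ s, dd N x (y k) f (a + i) a ^ 2 := by
        simp_rw [Finset.sum_add_distrib, Finset.mul_sum]
    _ ≤ _ := by linarith

lemma Sys.sum_ER (h : Sys N C M K x y) (r : ℕ → ℕ → A) (br : ∀ k < K, ∀ n ≤ M, Bd N C 1 (r k n)) (f : V) :
    ∑ n ∈ Finset.range (M + 1), ∑ k ∈ Finset.range K, N (ER x (y k) (r k n) M n • f) ^ 2 ≤
      (C ^ 130) ^ 2 * (1024 * (4 * C ^ 2)) * N f ^ 2 := by
  have hC := h.hC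
  have := schur (M + 1) K (fun k i a => DD N x (y k) f M i a) (4 * C ^ 2 * N f ^ 2) (h.sum_DD f)
  calc _ ≤ ∑ n ∈ Finset.range (M + 1), ∑ k ∈ Finset.range K, (C ^ 130) ^ 2 * (∑ a ∈ Finset.range (M + 1),
        ∑ i ∈ Finset.range (M + 1), wt n a * (3/4) ^ i * DD N x (y k) f M i a) ^ 2 := by
        refine Finset.sum_le_sum fun n hn => Finset.sum_le_sum fun k hk => ?_
        rw [← mul_pow]
        have hn' : n ≤ M := by have := Finset.mem_range.1 hn; omega
        have hk' := Finset.mem_range.1 hk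
        exact pow_le_pow_left₀ (apply_nonneg _ _)
          (ER_bd hC x (y k) (r k n) h.hx (h.hy k) M n hn' h.bx (h.bdy k hk') (br k hk' n hn') f) 2
    _ = (C ^ 130) ^ 2 * ∑ n ∈ Finset.range (M + 1), ∑ k ∈ Finset.range K, (∑ a ∈ Finset.range (M + 1),
        ∑ i ∈ Finset.range (M + 1), wt n a * (3/4) ^ i * DD N x (y k) f M i a) ^ 2 := by
        simp_rw [← Finset.mul_sum]
    _ ≤ (C ^ 130) ^ 2 * (1024 * (4 * C ^ 2 * N f ^ 2)) := mul_le_mul_of_nonneg_left this (by positivity)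
    _ = _ := by ring

lemma Sys.PP_bd (h : Sys N C M K x y) (f : V) (k : ℕ) (hk : k < K) :
    N (PP x (y k) M • f) ^ 2 ≤ 4 * C * (C ^ 60) ^ 2 * ∑ a ∈ Finset.range M, dd N x (y k) f a a ^ 2 := by
  have hC := h.hC
  set F1 : ℕ → V := fun a => Q1 (x a) (x (a+1)) (y k a) • ((x a - x (a+1)) * (y k a - y k (a+1))) • f with hF1
  set F2 : ℕ → V := fun a => Q2 (x (a+1)) (y k a) (y k (a+1)) (hlf A) • ((x a - x (a+1)) * (y k a - y k (a+1))) • f with hF2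
  have e : PP x (y k) M • f = ∑ a ∈ Finset.range M, (x (a + 2) * (x a - x (a + 1))) • F1 a +
      ∑ a ∈ Finset.range M, (y k (a + 2) * (y k a - y k (a + 1))) • F2 a := by
    unfold PP
    rw [Finset.sum_smul, ← Finset.sum_add_distrib]
    refine Finset.sum_congr rfl fun a _ => ?_
    rw [add_smul]
    simp only [hF1, hF2, smul_smul]
  have h1 := h.dX F1
  have h2 := h.dY k hk F2
  have g1 : ∑ a ∈ Finset.range M, N (F1 a) ^ 2 ≤ (C ^ 60) ^ 2 * ∑ a ∈ Finset.range M, dd N x (y k) f a a ^ 2 := by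
    rw [Finset.mul_sum]
    refine Finset.sum_le_sum fun a ha => ?_
    have ha' := Finset.mem_range.1 ha
    rw [← mul_pow]
    exact pow_le_pow_left₀ (apply_nonneg _ _) (Bd.Q1 hC (h.bx a (by omega)) (h.bx (a+1) (by omega))
      (h.bdy k hk a (by omega)) _) 2
  have g2 : ∑ a ∈ Finset.range M, N (F2 a) ^ 2 ≤ (C ^ 60) ^ 2 * ∑ a ∈ Finset.range M, dd N x (y k) f a a ^ 2 := by
    rw [Finset.mul_sum]
    refine Finset.sum_le_sum fun a ha => ?_
    have ha' := Finset.mem_range.1 ha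
    rw [← mul_pow]
    exact pow_le_pow_left₀ (apply_nonneg _ _) (Bd.Q2 hC (Bd.hlf hC) (h.bx (a+1) (by omega))
      (h.bdy k hk a (by omega)) (h.bdy k hk (a+1) (by omega)) _) 2
  rw [e]
  set P1 := ∑ a ∈ Finset.range M, (x (a + 2) * (x a - x (a + 1))) • F1 a
  set P2 := ∑ a ∈ Finset.range M, (y k (a + 2) * (y k a - y k (a + 1))) • F2 a
  set T := ∑ a ∈ Finset.range M, dd N x (y k) f a a ^ 2
  set B := (C ^ 60) ^ 2
  have h3 := map_add_le_add N P1 P2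
  have h4 : N (P1 + P2) ^ 2 ≤ (N P1 + N P2) ^ 2 := pow_le_pow_left₀ (apply_nonneg _ _) h3 2
  have h5 : C * ∑ a ∈ Finset.range M, N (F1 a) ^ 2 ≤ C * (B * T) := mul_le_mul_of_nonneg_left g1 (by linarith)
  have h6 : C * ∑ a ∈ Finset.range M, N (F2 a) ^ 2 ≤ C * (B * T) := mul_le_mul_of_nonneg_left g2 (by linarith)
  nlinarith [sq_nonneg (N P1 - N P2)]

lemma Sys.sum_PP (h : Sys N C M K x y) (f : V) :
    ∑ k ∈ Finset.range K, N (PP x (y k) M • f) ^ 2 ≤ 4 * C * (C ^ 60) ^ 2 * C ^ 2 * N f ^ 2 := by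
  have hC := h.hC
  calc _ ≤ ∑ k ∈ Finset.range K, 4 * C * (C ^ 60) ^ 2 * ∑ a ∈ Finset.range M, dd N x (y k) f a a ^ 2 :=
        Finset.sum_le_sum fun k hk => h.PP_bd f k (Finset.mem_range.1 hk)
    _ = 4 * C * (C ^ 60) ^ 2 * ∑ k ∈ Finset.range K, ∑ a ∈ Finset.range M, dd N x (y k) f a a ^ 2 := by
        rw [Finset.mul_sum]
    _ ≤ 4 * C * (C ^ 60) ^ 2 * (C ^ 2 * N f ^ 2) := by
        refine mul_le_mul_of_nonneg_left ?_ (by positivity)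
        exact h.sum_dd (fun a => a) (fun a => a) _ (fun a ha => by simp at ha ⊢; omega)
          (fun a _ b _ e => e) (fun a ha => by simp at ha; omega) f
    _ = _ := by ring

end summ

/-! ## The weighted theorem -/

section wtd

variable {G : Type*} [AddCommGroup G] [TopologicalSpace G] [IsTopologicalAddGroup G]
  [CompactSpace G]

/-- the algebra generated by the averages -/
abbrev AL (φ : ℝ × ℝ →ₜ+ G) : Subalgebra ℝ (Module.End ℝ C(G, ℝ)) := Algebra.adjoin ℝ (Set.range (AA φ))

instance AL_comm (φ : ℝ × ℝ →ₜ+ G) : CommRing (AL φ) :=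
  { (inferInstance : Ring (AL φ)) with
    mul_comm := fun a b => by
      have := Algebra.isMulCommutative_adjoin ℝ (s := Set.range (AA φ)) (by
        rintro _ ⟨v, rfl⟩ _ ⟨w, rfl⟩; exact AA_comm φ v w)
      exact this.is_comm.comm a b }

/-- an average as an element of the algebra -/
def al1 (φ : ℝ × ℝ →ₜ+ G) (w : ℝ × ℝ) : AL φ := ⟨AA φ w, Algebra.subset_adjoin ⟨w, rfl⟩⟩

lemma al1_smul (φ : ℝ × ℝ →ₜ+ G) (w : ℝ × ℝ) (f : C(G, ℝ)) : al1 φ w • f = AA φ w f := rfl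

lemma al1_two (φ : ℝ × ℝ →ₜ+ G) (v w : ℝ × ℝ) (h : w = (2:ℝ) • v) :
    al1 φ v = 2 * al1 φ w - al1 φ v * al1 φ w := by
  subst h
  apply Subtype.ext
  have := AA_hilbert φ 2 (by norm_num) v
  norm_num at this
  have e : ((2 * al1 φ ((2:ℝ) • v) - al1 φ v * al1 φ ((2:ℝ) • v) : AL φ) : Module.End ℝ C(G, ℝ)) =
    2 * AA φ ((2:ℝ) • v) - AA φ v * AA φ ((2:ℝ) • v) := rfl
  have e2 : (2:ℝ) • AA φ ((2:ℝ) • v) = 2 * AA φ ((2:ℝ) • v) := by rw [two_smul, two_mul]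
  rw [e, ← e2, this, AA_comm φ v]; simp [al1]

lemma al1_star (φ : ℝ × ℝ →ₜ+ G) (n a : ℕ) (v w : ℝ × ℝ) :
    al1 φ ((2:ℝ) ^ n • (v + w)) * ((1 - al1 φ ((2:ℝ) ^ a • v)) * al1 φ ((2:ℝ) ^ a • w) +
      al1 φ ((2:ℝ) ^ a • v) * (1 - al1 φ ((2:ℝ) ^ a • w))) =
    kap (AL φ) n a * ((1 - al1 φ ((2:ℝ) ^ n • (v + w))) * (al1 φ ((2:ℝ) ^ a • v) * al1 φ ((2:ℝ) ^ a • w))) := by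
  have h := AA_star φ ((2:ℝ) ^ ((n:ℤ) - a)) (by positivity) ((2:ℝ) ^ a • v) ((2:ℝ) ^ a • w)
  have e1 : (2:ℝ) ^ ((n:ℤ) - a) • ((2:ℝ) ^ a • v + (2:ℝ) ^ a • w) = (2:ℝ) ^ n • (v + w) := by
    rw [← smul_add, smul_smul, zpow_sub₀ (by norm_num), zpow_natCast, zpow_natCast, div_mul_cancel₀ _ (by positivity)]
  rw [e1] at h
  set c : ℝ := (2:ℝ) ^ ((n:ℤ) - a) with hc
  set r := al1 φ ((2:ℝ) ^ n • (v + w))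
  set x := al1 φ ((2:ℝ) ^ a • v)
  set y := al1 φ ((2:ℝ) ^ a • w)
  have h' : c • (r * x + r * y) + r * (x * y) = x * y + (2 * c) • (r * (x * y)) := Subtype.ext h
  have hk : kap (AL φ) n a = algebraMap ℝ (AL φ) c⁻¹ := by
    unfold kap; rw [hc, ← zpow_neg]; congr 2; ring
  have hcc : c⁻¹ * c = 1 := inv_mul_cancel₀ (by rw [hc]; positivity)
  rw [hk, ← Algebra.smul_def]
  have h2 := congrArg (fun z => c⁻¹ • z) h'
  simp only [smul_add, smul_smul] at h2
  rw [hcc, show c⁻¹ * (2 * c) = 2 * (c⁻¹ * c) by ring, hcc] at h2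
  simp only [one_smul, mul_one] at h2
  have h3 : (1 - r) * (x * y) = x * y - r * (x * y) := by ring
  have h4 : (2:ℝ) • (r * (x * y)) = 2 * (r * (x * y)) := by rw [two_smul, two_mul]
  rw [h4] at h2
  rw [h3, smul_sub]
  linear_combination h2

/-- horizontal, vertical and slanted directions -/
def XX (t : ℝ) (M : ℕ) : Finset (ℝ × ℝ) := (Finset.range M).image fun a => (2:ℝ) ^ a • (t, (0:ℝ))
def Yk (U : ℕ → ℝ) (k : ℕ) (M : ℕ) : Finset (ℝ × ℝ) := (Finset.range M).image fun a => (2:ℝ) ^ a • ((0:ℝ), U k)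
def YY (U : ℕ → ℝ) (K M : ℕ) : Finset (ℝ × ℝ) := (Finset.range K).biUnion fun k => Yk U k M
def Rk (t : ℝ) (U : ℕ → ℝ) (k : ℕ) (M : ℕ) : Finset (ℝ × ℝ) :=
  (Finset.range M).image fun a => (2:ℝ) ^ a • ((t, 0) + ((0:ℝ), U k))
def RR (t : ℝ) (U : ℕ → ℝ) (K M : ℕ) : Finset (ℝ × ℝ) := (Finset.range K).biUnion fun k => Rk t U k M

variable [MeasurableSpace G] [BorelSpace G] (ν : Measure G) [IsProbabilityMeasure ν] [ν.IsAddLeftInvariant]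

/-- the system -/
lemma mkSys {β C : ℝ} (hβ : 1/2 ≤ β) (hβ1 : β < 1) (hC : 1 ≤ C) (φ : ℝ × ℝ →ₜ+ G) (t : ℝ) (U : ℕ → ℝ)
    (hU : ∀ k, 0 < U k) (hU2 : ∀ k, 2 * U (k + 1) ≤ U k) (M K : ℕ) (v : C(G, ℝ)) (hv : ∀ g, 0 < v g)
    (hX : ∀ a < M + 2, ∀ g, AA φ ((2:ℝ) ^ a • (t, (0:ℝ))) v g ≤ C * v g)
    (hY : ∀ k < K, ∀ a < M + 2, ∀ g, AA φ ((2:ℝ) ^ a • ((0:ℝ), U k)) v g ≤ C * v g) :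
    Sys (A := AL φ) (NW ν (cpow v (-β))) (64 * C / (1 - β)) M K (fun a => al1 φ ((2:ℝ) ^ a • (t, (0:ℝ))))
      (fun k a => al1 φ ((2:ℝ) ^ a • ((0:ℝ), U k))) := by
  have hb : 0 < 1 - β := by linarith
  have hCC : 64 * C ≤ 64 * C / (1 - β) := by rw [le_div_iff₀ hb]; nlinarith
  have hCC2 : 16 * C / (1 - β) ≤ 64 * C / (1 - β) := by gcongr; norm_num
  have hN : ∀ f, 0 ≤ NW ν (cpow v (-β)) f := fun f => apply_nonneg _ _
  have hsm : ∀ (a : ℕ) (w : ℝ × ℝ), (2:ℝ) ^ (a + 1) • w = (2:ℝ) • (2:ℝ) ^ a • w := by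
    intro a w; rw [smul_smul, pow_succ, mul_comm]
  have hbd : ∀ w, (∀ g, AA φ w v g ≤ C * v g) → Bd (NW ν (cpow v (-β))) (64 * C / (1 - β)) 1 (al1 φ w) := by
    intro w hw f
    rw [pow_one, al1_smul]
    exact (bddN ν hβ hβ1 hC φ w f v hv hw).trans (mul_le_mul_of_nonneg_right (by linarith) (hN f))
  refine ⟨by linarith, fun a => al1_two φ _ _ (hsm _ _), fun k a => al1_two φ _ _ (hsm _ _),
    fun a ha => hbd _ (hX a (by omega)), fun k hk a ha => hbd _ (hY k hk a (by omega)), ?_, ?_, ?_, ?_⟩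
  · intro f
    refine le_trans (le_of_eq ?_) ((sqfN ν hβ hβ1 hC φ (t, (0:ℝ)) (fun k => (2:ℝ) ^ ((M:ℤ) - k))
      (fun k => by positivity) (fun k => by
        push_cast; rw [sub_add_eq_sub_sub, zpow_sub_one₀ (by norm_num)]; linarith) (M + 1) f v hv ?_ ?_).trans
      (mul_le_mul_of_nonneg_right hCC2 (sq_nonneg _)))
    · rw [← Finset.sum_range_reflect]
      refine Finset.sum_congr rfl fun k hk => ?_
      have hk := Finset.mem_range.1 hk
      have : (M + 1 - 1 - k : ℕ) = ((M:ℤ) - k) := by omega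
      rw [← this, zpow_natCast, sub_smul, al1_smul, al1_smul, hsm]
    · intro k hk
      have : ((M - k : ℕ) : ℤ) = ((M:ℤ) - k) := by omega
      rw [← this, zpow_natCast]
      exact hX _ (by omega)
    · intro k hk
      have : ((M - k : ℕ) : ℤ) = ((M:ℤ) - k) := by omega
      rw [← this, zpow_natCast, ← hsm]
      exact hX _ (by omega)
  · intro b hb f
    have e : ∀ k (c : ℝ), c • ((0:ℝ), U k) = (c * U k) • ((0:ℝ), (1:ℝ)) := by intro k c; simp
    refine le_trans (le_of_eq ?_) ((sqfN ν hβ hβ1 hC φ ((0:ℝ), (1:ℝ)) (fun k => (2:ℝ) ^ b * U k)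
      (fun k => mul_pos (by positivity) (hU k)) (fun k => by
        have := mul_le_mul_of_nonneg_left (hU2 k) (show (0:ℝ) ≤ 2 ^ b by positivity); linarith) K f v hv ?_ ?_).trans
      (mul_le_mul_of_nonneg_right hCC2 (sq_nonneg _)))
    · refine Finset.sum_congr rfl fun k hk => ?_
      simp only [sub_smul, al1_smul, hsm, e]
    · intro k hk; rw [← e]; exact hY k hk b (by omega)
    · intro k hk; rw [← e, ← hsm]; exact hY k hk (b+1) (by omega)
  · intro F
    refine le_trans (le_of_eq ?_) (dualN ν hβ hβ1 hC φ _ M v hv hX F)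
    congr 2
  · intro k hk F
    refine le_trans (le_of_eq ?_) (dualN ν hβ hβ1 hC φ _ M v hv (hY k hk) F)
    congr 2

/-- maximal function along a ray -/
lemma MB_ray (φ : ℝ × ℝ →ₜ+ G) (w : ℝ × ℝ) (L : Finset ℝ) (hL : ∀ c ∈ L, 0 < c) {s : ℝ} (hs : 1 < s) :
    MB ν φ (L.image fun c => c • w) s (2 ^ s * D1 s) := by
  obtain ⟨c0, hc0, hcl⟩ : ∃ c0 : ℝ, 0 < c0 ∧ ∀ c ∈ L, c0 ≤ c := by
    rcases L.eq_empty_or_nonempty with h | h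
    · exact ⟨1, one_pos, by simp [h]⟩
    · exact ⟨L.min' h, hL _ (L.min'_mem h), fun c hc => L.min'_le c hc⟩
  have hj : ∀ c ∈ L, ∃ j : ℕ, c ≤ 2 ^ j * c0 ∧ 2 ^ j * c0 ≤ 2 * c := by
    intro c hc
    obtain ⟨j, h1, h2⟩ := exists_nat_pow_near (x := c / c0) (y := 2) ((one_le_div hc0).2 (hcl c hc)) (by norm_num)
    rw [le_div_iff₀ hc0] at h1
    rw [div_lt_iff₀ hc0] at h2
    exact ⟨j + 1, h2.le, by rw [pow_succ]; linarith⟩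
  choose! j hj1 hj2 using hj
  obtain ⟨N, hN⟩ : ∃ N, ∀ c ∈ L, j c < N := ⟨L.sup j + 1, fun c hc => Nat.lt_succ_of_le (Finset.le_sup hc)⟩
  intro f hf
  have h1 := max1D ν φ (c0 • w) N hs f hf
  rw [mul_assoc]
  refine le_trans ?_ (mul_le_mul_of_nonneg_left h1 (by positivity))
  rw [← integral_const_mul]
  have hp : ∀ g, 0 ≤ mx φ (dy (c0 • w) N) f g := fun g => (mx_pos φ _ hf g).le
  refine integral_mono (pow_int ν (fun g => mx_pos φ _ hf g) s) ((pow_int ν (fun g => mx_pos φ _ hf g) s).const_mul _) fun g => ?_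
  show _ ≤ (2:ℝ) ^ s * _ ^ s
  rw [← Real.mul_rpow (by norm_num) (hp g)]
  refine Real.rpow_le_rpow (mx_pos φ _ hf g).le ?_ (by linarith)
  rw [mx_le_iff]
  refine ⟨(mx_ge φ (dy (c0 • w) N) f g).trans (by linarith [hp g]), ?_⟩
  intro w' hw'
  obtain ⟨c, hc, rfl⟩ := Finset.mem_image.1 hw'
  have hcp := hL c hc
  have h3 := AA_le_mul φ (2 ^ j c * c0 / c) ((one_le_div hcp).2 (hj1 c hc)) (c • w) (fun g => (hf g).le) g
  rw [smul_smul, div_mul_cancel₀ _ hcp.ne'] at h3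
  have h4 : (2 ^ j c * c0) • w ∈ dy (c0 • w) N := by
    unfold dy; exact Finset.mem_image.2 ⟨j c, Finset.mem_range.2 (hN c hc), by rw [smul_smul]⟩
  have h5 := mx_ge' φ _ f g _ h4
  refine h3.trans (mul_le_mul ?_ h5 (AA_nonneg φ _ (fun g => (hf g).le) g) (by norm_num))
  rw [div_le_iff₀ hcp]; exact hj2 c hc

lemma MB_XX (φ : ℝ × ℝ →ₜ+ G) (t : ℝ) (M : ℕ) {s : ℝ} (hs : 1 < s) : MB ν φ (XX t M) s (2 ^ s * D1 s) := by
  have := MB_ray ν φ (t, 0) ((Finset.range M).image fun a => (2:ℝ) ^ a) (by simp) hs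
  rwa [Finset.image_image] at this

lemma MB_Rk (φ : ℝ × ℝ →ₜ+ G) (t : ℝ) (U : ℕ → ℝ) (k M : ℕ) {s : ℝ} (hs : 1 < s) :
    MB ν φ (Rk t U k M) s (2 ^ s * D1 s) := by
  have := MB_ray ν φ ((t, 0) + (0, U k)) ((Finset.range M).image fun a => (2:ℝ) ^ a) (by simp) hs
  rwa [Finset.image_image] at this

lemma MB_YY (φ : ℝ × ℝ →ₜ+ G) (U : ℕ → ℝ) (hU : ∀ k, 0 < U k) (K M : ℕ) {s : ℝ} (hs : 1 < s) :
    MB ν φ (YY U K M) s (2 ^ s * D1 s) := by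
  have := MB_ray ν φ (0, 1) ((Finset.range K).biUnion fun k => (Finset.range M).image fun a => (2:ℝ) ^ a * U k)
    (by simp only [Finset.mem_biUnion, Finset.mem_image]; rintro _ ⟨k, _, a, _, rfl⟩; have := hU k; positivity) hs
  rw [Finset.biUnion_image] at this
  convert this using 3
  unfold YY
  congr 1; ext1 k
  rw [Finset.image_image]; unfold Yk
  refine Finset.image_congr fun a _ => ?_
  simp

end wtd

section wtd2

variable {G : Type*} [AddCommGroup G] [TopologicalSpace G] [IsTopologicalAddGroup G]
  [CompactSpace G]

/-- iterated maximal function -/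
def m3 (φ : ℝ × ℝ →ₜ+ G) (W X Y : Finset (ℝ × ℝ)) (h : C(G, ℝ)) : C(G, ℝ) := mx φ W (mx φ X (mx φ Y |h|))

lemma mx_nn (φ : ℝ × ℝ →ₜ+ G) (W : Finset (ℝ × ℝ)) {f : C(G, ℝ)} (hf : ∀ g, 0 ≤ f g) (g : G) :
    0 ≤ mx φ W f g := (hf g).trans (mx_ge φ W f g)

lemma m3_bound (φ : ℝ × ℝ →ₜ+ G) (W X Y : Finset (ℝ × ℝ)) (h : C(G, ℝ)) (r x y : ℝ × ℝ) (hr : r ∈ W)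
    (hx : x ∈ X) (hy : y ∈ Y) (g : G) :
    |((al1 φ r * ((1 - al1 φ x) * (1 - al1 φ y))) • h) g| ≤ 4 * m3 φ W X Y h g := by
  have h0 : ∀ g, |h| g = |h g| := fun g => rfl
  set H := mx φ X (mx φ Y |h|)
  have hY0 : ∀ g, |h| g ≤ mx φ Y |h| g := fun g => mx_ge φ Y _ g
  have hX0 : ∀ g, mx φ Y |h| g ≤ H g := fun g => mx_ge φ X _ g
  have b0 : ∀ g, |h g| ≤ H g := fun g => (h0 g ▸ hY0 g).trans (hX0 g)
  have by1 : ∀ g, |AA φ y h g| ≤ mx φ Y |h| g := fun g => (AA_abs φ y h g).trans (mx_ge' φ Y _ g y hy)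
  have bx : ∀ g, |AA φ x h g| ≤ H g := fun g => (AA_abs φ x h g).trans
    ((AA_mono φ x hY0 g).trans (mx_ge' φ X _ g x hx))
  have bxy : ∀ g, |AA φ x (AA φ y h) g| ≤ H g := fun g => (AA_abs φ x _ g).trans
    ((AA_mono φ x (h := mx φ Y |h|) (fun g => by1 g) g).trans (mx_ge' φ X _ g x hx))
  have key : ∀ z : C(G, ℝ), (∀ g, |z g| ≤ H g) → |AA φ r z g| ≤ m3 φ W X Y h g := fun z hz =>
    (AA_abs φ r z g).trans ((AA_mono φ r (h := H) (fun g => hz g) g).trans (mx_ge' φ W _ g r hr))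
  have e : (al1 φ r * ((1 - al1 φ x) * (1 - al1 φ y))) • h =
      AA φ r h - AA φ r (AA φ x h) - AA φ r (AA φ y h) + AA φ r (AA φ x (AA φ y h)) := by
    have : al1 φ r * ((1 - al1 φ x) * (1 - al1 φ y)) = al1 φ r - al1 φ r * al1 φ x - al1 φ r * al1 φ y +
      al1 φ r * (al1 φ x * al1 φ y) := by ring
    rw [this]; simp only [add_smul, sub_smul, mul_smul, al1_smul]
  rw [e]
  have k1 := abs_le.1 (key h b0)
  have k2 := abs_le.1 (key _ bx)
  have k3 := abs_le.1 (key _ fun g => (by1 g).trans (hX0 g))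
  have k4 := abs_le.1 (key _ bxy)
  simp only [ContinuousMap.add_apply, ContinuousMap.sub_apply]
  rw [abs_le]; constructor <;> linarith [k1.1, k1.2, k2.1, k2.2, k3.1, k3.2, k4.1, k4.2]

variable [MeasurableSpace G] [BorelSpace G] (ν : Measure G) [IsProbabilityMeasure ν] [ν.IsAddLeftInvariant]

lemma wmax' {β C D : ℝ} (hβ : 1/2 ≤ β) (hβ1 : β < 1) (hC : 1 ≤ C) (hD : 0 ≤ D) (φ : ℝ × ℝ →ₜ+ G)
    (W : Finset (ℝ × ℝ)) (hMB : MB ν φ W (2 - β) D) (v : C(G, ℝ)) (hv : ∀ g, 0 < v g)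
    (hA : ∀ w ∈ W, ∀ g, AA φ w v g ≤ C * v g) (F : C(G, ℝ)) (hF : ∀ g, 0 ≤ F g) :
    NW ν (cpow v (-β)) (mx φ W F) ^ 2 ≤ C * D * NW ν (cpow v (-β)) F ^ 2 := by
  have := wmax ν hβ hβ1 hC hD φ W hMB v hv hA F
  rwa [show |F| = F from ContinuousMap.ext fun g => abs_of_nonneg (hF g)] at this

instance AL_tower (φ : ℝ × ℝ →ₜ+ G) : IsScalarTower ℝ (AL φ) C(G, ℝ) := ⟨fun _ _ _ => rfl⟩

/-- leftover at the finest scale -/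
def lo (φ : ℝ × ℝ →ₜ+ G) (x y : ℝ × ℝ) (f : C(G, ℝ)) : C(G, ℝ) := (1 - ph (al1 φ x) * ph (al1 φ y)) • f

def EW (β C : ℝ) : ℝ :=
  1 + 4 * ((C * (2 ^ (2 - β) * D1 (2 - β))) ^ 2 + 16 * (C * (2 ^ (2 - β) * D1 (2 - β))) ^ 3 *
    (1 + 4 * (64 * C / (1 - β)) * ((64 * C / (1 - β)) ^ 60) ^ 2 * (64 * C / (1 - β)) ^ 2) +
    ((64 * C / (1 - β)) ^ 130) ^ 2 * (1024 * (4 * (64 * C / (1 - β)) ^ 2)))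

set_option maxHeartbeats 2000000 in
lemma wthm {β C : ℝ} (hβ : 1/2 ≤ β) (hβ1 : β < 1) (hC : 1 ≤ C) (φ : ℝ × ℝ →ₜ+ G) (t : ℝ) (U : ℕ → ℝ)
    (hU : ∀ k, 0 < U k) (hU2 : ∀ k, 2 * U (k + 1) ≤ U k) (M K : ℕ) (v : C(G, ℝ)) (hv : ∀ g, 0 < v g)
    (hA : ∀ w ∈ XX t (M + 2) ∪ YY U K (M + 2) ∪ RR t U K (M + 2), ∀ g, AA φ w v g ≤ C * v g)
    (f : C(G, ℝ)) (hf : ∀ g, 0 < f g) :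
    NW ν (cpow v (-β)) (mx φ (RR t U K (M + 1)) f) ^ 2 ≤ EW β C * (NW ν (cpow v (-β)) f ^ 2 +
      ∑ k ∈ Finset.range K, NW ν (cpow v (-β)) (lo φ (t, 0) (0, U k) f) ^ 2) := by
  set N := NW ν (cpow v (-β)) with hN
  set D := C * (2 ^ (2 - β) * D1 (2 - β)) with hD
  set C1 := 64 * C / (1 - β) with hC1
  have hs : 1 < 2 - β := by linarith
  have hD0 : 0 ≤ 2 ^ (2 - β) * D1 (2 - β) := mul_nonneg (by positivity) (D1_pos hs).le
  have hDD : 0 ≤ D := mul_nonneg (by linarith) hD0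
  have hAX : ∀ w ∈ XX t (M + 2), ∀ g, AA φ w v g ≤ C * v g := fun w hw =>
    hA w (Finset.mem_union_left _ (Finset.mem_union_left _ hw))
  have hAY : ∀ w ∈ YY U K (M + 2), ∀ g, AA φ w v g ≤ C * v g := fun w hw =>
    hA w (Finset.mem_union_left _ (Finset.mem_union_right _ hw))
  have hAR : ∀ k < K, ∀ w ∈ Rk t U k (M + 2), ∀ g, AA φ w v g ≤ C * v g := fun k hk w hw =>
    hA w (Finset.mem_union_right _ (Finset.mem_biUnion.2 ⟨k, Finset.mem_range.2 hk, hw⟩))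
  have memX : ∀ a < M + 2, (2:ℝ) ^ a • (t, (0:ℝ)) ∈ XX t (M + 2) := fun a ha =>
    Finset.mem_image.2 ⟨a, Finset.mem_range.2 ha, rfl⟩
  have memY : ∀ k < K, ∀ a < M + 2, (2:ℝ) ^ a • ((0:ℝ), U k) ∈ YY U K (M + 2) := fun k hk a ha =>
    Finset.mem_biUnion.2 ⟨k, Finset.mem_range.2 hk, Finset.mem_image.2 ⟨a, Finset.mem_range.2 ha, rfl⟩⟩
  have memR : ∀ k, ∀ a < M + 2, (2:ℝ) ^ a • ((t, 0) + ((0:ℝ), U k)) ∈ Rk t U k (M + 2) := fun k a ha =>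
    Finset.mem_image.2 ⟨a, Finset.mem_range.2 ha, rfl⟩
  have sys := mkSys ν hβ hβ1 hC φ t U hU hU2 M K v hv (fun a ha => hAX _ (memX a ha))
    (fun k hk a ha => hAY _ (memY k hk a ha))
  set x : ℕ → AL φ := fun a => al1 φ ((2:ℝ) ^ a • (t, (0:ℝ))) with hx
  set y : ℕ → ℕ → AL φ := fun k a => al1 φ ((2:ℝ) ^ a • ((0:ℝ), U k)) with hy
  set r : ℕ → ℕ → AL φ := fun k a => al1 φ ((2:ℝ) ^ a • ((t, 0) + ((0:ℝ), U k))) with hr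
  have sPP := sys.sum_PP f
  have sER := sys.sum_ER r (fun k hk n hn => by
    intro f
    rw [pow_one]
    refine (bddN ν hβ hβ1 hC φ _ f v hv (hAR k hk _ (memR k n (by omega)))).trans
      (mul_le_mul_of_nonneg_right ?_ (apply_nonneg _ _))
    rw [le_div_iff₀ (by linarith)]; nlinarith) f
  -- iterated maximal bounds
  have b2 : ∀ h : C(G, ℝ), N (mx φ (XX t (M+2)) (mx φ (YY U K (M+2)) |h|)) ^ 2 ≤ D ^ 2 * N h ^ 2 := by
    intro h
    have h1 := wmax ν hβ hβ1 hC hD0 φ _ (MB_YY ν φ U hU K (M+2) hs) v hv hAY h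
    have h2 := wmax' ν hβ hβ1 hC hD0 φ _ (MB_XX ν φ t (M+2) hs) v hv hAX (mx φ (YY U K (M+2)) |h|)
      (fun g => mx_nn φ _ (fun g => abs_nonneg _) g)
    refine h2.trans ((mul_le_mul_of_nonneg_left h1 hDD).trans (le_of_eq (by ring)))
  have b3 : ∀ k < K, ∀ h : C(G, ℝ), N (m3 φ (Rk t U k (M+2)) (XX t (M+2)) (YY U K (M+2)) h) ^ 2 ≤ D ^ 3 * N h ^ 2 := by
    intro k hk h
    have h2 := wmax' ν hβ hβ1 hC hD0 φ _ (MB_Rk ν φ t U k (M+2) hs) v hv (hAR k hk)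
      (mx φ (XX t (M+2)) (mx φ (YY U K (M+2)) |h|))
      (fun g => mx_nn φ _ (fun g => mx_nn φ _ (fun g => abs_nonneg _) g) g)
    refine h2.trans ((mul_le_mul_of_nonneg_left (b2 h) hDD).trans (le_of_eq (by ring)))
  set B1 := mx φ (XX t (M+2)) (mx φ (YY U K (M+2)) |f|) with hB1
  set B2 := fun k => m3 φ (Rk t U k (M+2)) (XX t (M+2)) (YY U K (M+2)) (lo φ (t, 0) (0, U k) f) with hB2
  set B3 := fun k => m3 φ (Rk t U k (M+2)) (XX t (M+2)) (YY U K (M+2)) (PP x (y k) M • f) with hB3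
  have sq4 : ∀ a b c d : ℝ, (a + b - c + d) ^ 2 ≤ 4 * (a ^ 2 + b ^ 2 + c ^ 2 + d ^ 2) := fun a b c d => by
    nlinarith [sq_nonneg (a - b), sq_nonneg (a + c), sq_nonneg (a - d), sq_nonneg (b + c), sq_nonneg (b - d),
      sq_nonneg (c + d)]
  have pw : ∀ g, mx φ (RR t U K (M + 1)) f g ^ 2 ≤ f g ^ 2 + 4 * (B1 g ^ 2 + ∑ k ∈ Finset.range K, 16 * B2 k g ^ 2 +
      ∑ k ∈ Finset.range K, 16 * B3 k g ^ 2 + ∑ n ∈ Finset.range (M + 1), ∑ k ∈ Finset.range K,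
        (ER x (y k) (r k n) M n • f) g ^ 2) := by
    intro g
    have n1 : 0 ≤ ∑ k ∈ Finset.range K, 16 * B2 k g ^ 2 := Finset.sum_nonneg fun _ _ => by positivity
    have n2 : 0 ≤ ∑ k ∈ Finset.range K, 16 * B3 k g ^ 2 := Finset.sum_nonneg fun _ _ => by positivity
    have n3 : 0 ≤ ∑ n ∈ Finset.range (M + 1), ∑ k ∈ Finset.range K, (ER x (y k) (r k n) M n • f) g ^ 2 :=
      Finset.sum_nonneg fun _ _ => Finset.sum_nonneg fun _ _ => sq_nonneg _
    rcases mx_mem φ (RR t U K (M + 1)) f g with h | ⟨w, hw, h⟩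
    · rw [h]; linarith [sq_nonneg (B1 g)]
    · obtain ⟨k, hk, hw⟩ := Finset.mem_biUnion.1 hw
      obtain ⟨n, hn, rfl⟩ := Finset.mem_image.1 hw
      have hk' := Finset.mem_range.1 hk
      have hn' := Finset.mem_range.1 hn
      have dc := decomp x (y k) (r k n) sys.hx (sys.hy k) M n (fun a => al1_star φ n a _ _)
      have e0 : (1 - ph (x 0) * ph (y k 0)) • f = lo φ (t, 0) (0, U k) f := by
        simp only [hx, hy, pow_zero, one_smul]; rfl
      have dcg : (r k n • f) g = ((x n * y k n) • f) g +
          ((r k n * ((1 - x n) * (1 - y k n))) • lo φ (t, 0) (0, U k) f) g -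
          ((r k n * ((1 - x n) * (1 - y k n))) • PP x (y k) M • f) g + (ER x (y k) (r k n) M n • f) g := by
        conv_lhs => rw [dc]
        rw [add_smul, sub_smul, add_smul, mul_smul _ (PP x (y k) M), mul_smul _ (1 - ph (x 0) * ph (y k 0)), e0]
        rfl
      rw [h, ← al1_smul]
      change (r k n • f) g ^ 2 ≤ _
      rw [dcg]
      have t1 : ((x n * y k n) • f) g ^ 2 ≤ B1 g ^ 2 := by
        have hle : ((x n * y k n) • f) g ≤ B1 g := by
          rw [mul_smul]
          refine (AA_mono φ _ (fun g => ?_) g).trans (mx_ge' φ _ (mx φ (YY U K (M+2)) |f|) g _ (memX n (by omega)))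
          exact (AA_mono φ _ (fun g => le_abs_self (f g)) g).trans (mx_ge' φ _ |f| g _ (memY k hk' n (by omega)))
        have h0 : 0 ≤ ((x n * y k n) • f) g := by
          rw [mul_smul]; exact AA_nonneg φ _ (fun g => AA_nonneg φ _ (fun g => (hf g).le) g) g
        exact pow_le_pow_left₀ h0 hle 2
      have t2 := m3_bound φ _ _ _ (lo φ (t, 0) (0, U k) f) _ _ _ (memR k n (by omega)) (memX n (by omega)) (memY k hk' n (by omega)) g
      have t3 := m3_bound φ _ _ _ (PP x (y k) M • f) _ _ _ (memR k n (by omega)) (memX n (by omega)) (memY k hk' n (by omega)) g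
      have s2 := Finset.single_le_sum (f := fun k => 16 * B2 k g ^ 2) (fun _ _ => by positivity) hk
      have s3 := Finset.single_le_sum (f := fun k => 16 * B3 k g ^ 2) (fun _ _ => by positivity) hk
      have s4 : (ER x (y k) (r k n) M n • f) g ^ 2 ≤ ∑ n ∈ Finset.range (M + 1), ∑ k ∈ Finset.range K,
          (ER x (y k) (r k n) M n • f) g ^ 2 :=
        (Finset.single_le_sum (f := fun k => (ER x (y k) (r k n) M n • f) g ^ 2) (fun _ _ => sq_nonneg _) hk).trans
          (Finset.single_le_sum (f := fun n => ∑ k ∈ Finset.range K, (ER x (y k) (r k n) M n • f) g ^ 2)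
            (fun _ _ => Finset.sum_nonneg fun _ _ => sq_nonneg _) hn)
      have q2 := sq_le_sq' (neg_le_of_abs_le t2) (le_of_abs_le t2)
      have q3 := sq_le_sq' (neg_le_of_abs_le t3) (le_of_abs_le t3)
      refine (sq4 _ _ _ _).trans ?_
      have q2' : (4 * B2 k g) ^ 2 = 16 * B2 k g ^ 2 := by ring
      have q3' : (4 * B3 k g) ^ 2 = 16 * B3 k g ^ 2 := by ring
      change _ ≤ (4 * B2 k g) ^ 2 at q2
      change _ ≤ (4 * B3 k g) ^ 2 at q3
      rw [q2'] at q2; rw [q3'] at q3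
      linarith [sq_nonneg (f g)]
  have hρ : ∀ g, 0 ≤ cpow v (-β) g := fun g => by rw [cpow_pos v hv]; exact Real.rpow_nonneg (hv g).le _
  have ig : ∀ z : C(G, ℝ), Integrable (fun g => z g ^ 2 * cpow v (-β) g) ν := fun z => C_int ν (z ^ 2 * cpow v (-β))
  have hmain : N (mx φ (RR t U K (M + 1)) f) ^ 2 ≤ N f ^ 2 + 4 * (N B1 ^ 2 + ∑ k ∈ Finset.range K, 16 * N (B2 k) ^ 2 +
      ∑ k ∈ Finset.range K, 16 * N (B3 k) ^ 2 + ∑ n ∈ Finset.range (M + 1), ∑ k ∈ Finset.range K,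
        N (ER x (y k) (r k n) M n • f) ^ 2) := by
    have hq : ∀ z : C(G, ℝ), N z ^ 2 = Iν ν (z ^ 2 * cpow v (-β)) := fun z => by
      rw [hN, NW_sq ν _ _ hρ, Iν_apply]; rfl
    simp only [hq, ← smul_eq_mul (16:ℝ), ← smul_eq_mul (4:ℝ), ← map_smul, ← map_sum, ← map_add]
    rw [Iν_apply, Iν_apply]
    refine integral_mono (C_int ν _) (C_int ν _) fun g => ?_
    have := mul_le_mul_of_nonneg_right (pw g) (hρ g)
    simp only [add_mul, Finset.sum_mul, mul_assoc] at this
    simpa [ContinuousMap.sum_apply, mul_assoc, mul_add] using this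
  have c2 : ∑ k ∈ Finset.range K, 16 * N (B2 k) ^ 2 ≤ 16 * D ^ 3 * ∑ k ∈ Finset.range K, N (lo φ (t, 0) (0, U k) f) ^ 2 := by
    rw [Finset.mul_sum]
    exact Finset.sum_le_sum fun k hk => by have := b3 k (Finset.mem_range.1 hk) (lo φ (t, 0) (0, U k) f); linarith
  have c3 : ∑ k ∈ Finset.range K, 16 * N (B3 k) ^ 2 ≤ 16 * D ^ 3 * ∑ k ∈ Finset.range K, N (PP x (y k) M • f) ^ 2 := by
    rw [Finset.mul_sum]
    exact Finset.sum_le_sum fun k hk => by have := b3 k (Finset.mem_range.1 hk) (PP x (y k) M • f); linarith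
  have c3' := c3.trans (mul_le_mul_of_nonneg_left sPP (by positivity : 0 ≤ 16 * D ^ 3))
  have hb1 := b2 f
  set Sg := ∑ k ∈ Finset.range K, N (lo φ (t, 0) (0, U k) f) ^ 2
  have hSg : 0 ≤ Sg := Finset.sum_nonneg fun _ _ => sq_nonneg _
  have hC1' : 0 ≤ C1 := by rw [hC1]; exact div_nonneg (by linarith) (by linarith)
  have hE : EW β C = 1 + 4 * (D ^ 2 + 16 * D ^ 3 * (1 + 4 * C1 * (C1 ^ 60) ^ 2 * C1 ^ 2) +
    (C1 ^ 130) ^ 2 * (1024 * (4 * C1 ^ 2))) := rfl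
  have hE0 : 4 * (16 * D ^ 3) ≤ EW β C := by
    rw [hE]
    have p1 : 0 ≤ 16 * D ^ 3 * (4 * C1 * (C1 ^ 60) ^ 2 * C1 ^ 2) := by positivity
    have p2 : 0 ≤ (C1 ^ 130) ^ 2 * (1024 * (4 * C1 ^ 2)) := by positivity
    linarith [sq_nonneg D]
  have hE1 : 1 + 4 * (D ^ 2 + 16 * D ^ 3 * (4 * C1 * (C1 ^ 60) ^ 2 * C1 ^ 2) +
    (C1 ^ 130) ^ 2 * (1024 * (4 * C1 ^ 2))) ≤ EW β C := by
    rw [hE]; have : 0 ≤ 16 * D ^ 3 := by positivity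
    linarith
  have f1 := mul_le_mul_of_nonneg_right hE0 hSg
  have f2 := mul_le_mul_of_nonneg_right hE1 (sq_nonneg (N f))
  linarith [hmain]

end wtd2

/-! ## Extrapolation -/
section rdf

variable {G : Type*} [AddCommGroup G] [TopologicalSpace G] [IsTopologicalAddGroup G]
  [CompactSpace G]

lemma AA_norm (φ : ℝ × ℝ →ₜ+ G) (w : ℝ × ℝ) (f : C(G, ℝ)) : ‖AA φ w f‖ ≤ ‖f‖ := by
  rw [ContinuousMap.norm_le _ (norm_nonneg _)]
  intro g
  rw [Real.norm_eq_abs]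
  refine (AA_abs φ w f g).trans ((AA_mono φ w (h := ContinuousMap.const G ‖f‖) (fun g => ?_) g).trans
    (AA_const φ w _ g).le)
  exact f.norm_coe_le_norm g

lemma lo_small (φ : ℝ × ℝ →ₜ+ G) (x y : ℝ × ℝ) (f : C(G, ℝ)) {ε : ℝ} (hε : 0 < ε) :
    ∃ τ0 : ℝ, 0 < τ0 ∧ ∀ τ : ℝ, 0 < τ → τ ≤ τ0 → ‖lo φ (τ • x) (τ • y) f‖ ≤ ε := by
  obtain ⟨a, ha, ha'⟩ := AA_approx φ f x (ε := ε / 2 ^ 27) (by positivity)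
  obtain ⟨b, hb, hb'⟩ := AA_approx φ f y (ε := ε / 2 ^ 27) (by positivity)
  refine ⟨min a b, lt_min ha hb, fun τ h0 hτ => ?_⟩
  have h1 := ha' τ h0 (hτ.trans (min_le_left _ _))
  have h2 := hb' τ h0 (hτ.trans (min_le_right _ _))
  have h22 : (2:ℝ) ≤ 2 := le_rfl
  have hB : ∀ w, Bd (normSeminorm ℝ C(G, ℝ)) 2 1 (al1 φ w) := fun w f => by
    show ‖AA φ w f‖ ≤ 2 ^ 1 * ‖f‖
    have := AA_norm φ w f
    have := norm_nonneg f
    linarith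
  set X := al1 φ (τ • x) with hX
  set Y := al1 φ (τ • y) with hY
  have hb1 : ∀ w, Bd (normSeminorm ℝ C(G, ℝ)) 2 8 ((1 - al1 φ w) ^ 2 * (1 + 3 * al1 φ w)) := fun w =>
    ((((hB w).t1 h22).sq h22).mul h22 ((Bd.one h22).add h22 ((Bd.c3 h22).mul h22 (hB w)))).mono h22 (by norm_num)
  have hb2 : Bd (normSeminorm ℝ C(G, ℝ)) 2 26 (ph X * ((1 - Y) ^ 2 * (1 + 3 * Y))) :=
    ((((hB _).sq h22).mul h22 ((hB _).al h22)).mul h22 (hb1 _)).mono h22 (by norm_num)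
  have e : lo φ (τ • x) (τ • y) f = ((1 - X) ^ 2 * (1 + 3 * X)) • (f - AA φ (τ • x) f) +
      (ph X * ((1 - Y) ^ 2 * (1 + 3 * Y))) • (f - AA φ (τ • y) f) := by
    have e1 : f - AA φ (τ • x) f = (1 - X) • f := by rw [sub_smul, one_smul]; rfl
    have e2 : f - AA φ (τ • y) f = (1 - Y) • f := by rw [sub_smul, one_smul]; rfl
    rw [e1, e2, smul_smul, smul_smul, ← add_smul]
    unfold lo
    congr 1
    simp only [ph, al, ← hX, ← hY]; ring
  rw [e]
  have q1 : ‖((1 - X) ^ 2 * (1 + 3 * X)) • (f - AA φ (τ • x) f)‖ ≤ 2 ^ 8 * ‖f - AA φ (τ • x) f‖ := hb1 _ _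
  have q2 : ‖(ph X * ((1 - Y) ^ 2 * (1 + 3 * Y))) • (f - AA φ (τ • y) f)‖ ≤ 2 ^ 26 * ‖f - AA φ (τ • y) f‖ := hb2 _
  rw [norm_sub_rev] at q1 q2
  have := norm_nonneg (AA φ (τ • x) f - f)
  refine (norm_add_le _ _).trans ?_
  nlinarith

lemma mx_lip (φ : ℝ × ℝ →ₜ+ G) (W : Finset (ℝ × ℝ)) (f h : C(G, ℝ)) : ‖mx φ W f - mx φ W h‖ ≤ ‖f - h‖ := by
  have key : ∀ f h : C(G, ℝ), ∀ g, mx φ W f g ≤ mx φ W h g + ‖f - h‖ := by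
    intro f h g
    have hb : ∀ k : C(G, ℝ), ∀ g, k g ≤ ‖k‖ := fun k g => (le_abs_self _).trans (k.norm_coe_le_norm g)
    rw [mx_le_iff]
    constructor
    · have := hb (f - h) g; rw [ContinuousMap.sub_apply] at this; linarith [mx_ge φ W h g]
    · intro w hw
      have h1 := (hb (AA φ w (f - h)) g).trans (AA_norm φ w _)
      rw [map_sub, ContinuousMap.sub_apply] at h1
      linarith [mx_ge' φ W h g w hw]
  rw [ContinuousMap.norm_le _ (norm_nonneg _)]
  intro g
  rw [Real.norm_eq_abs, ContinuousMap.sub_apply, abs_le]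
  have h1 := key f h g
  have h2 := key h f g
  rw [norm_sub_rev] at h2
  constructor <;> linarith

lemma exists_lb [Nonempty G] (f : C(G, ℝ)) (hf : ∀ g, 0 < f g) : ∃ m : ℝ, 0 < m ∧ ∀ g, m ≤ f g := by
  obtain ⟨g, -, hg⟩ := isCompact_univ.exists_isMinOn univ_nonempty f.continuous.continuousOn
  exact ⟨f g, hf g, fun g' => hg (mem_univ g')⟩

variable [MeasurableSpace G] [BorelSpace G] (ν : Measure G) [IsProbabilityMeasure ν] [ν.IsAddLeftInvariant]

lemma neG (ν : Measure G) [IsProbabilityMeasure ν] : Nonempty G := by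
  by_contra h
  rw [not_nonempty_iff] at h
  have := measure_univ (μ := ν)
  simp [Set.eq_empty_of_isEmpty] at this

/-- the Rubio de Francia weight -/
lemma rubio (φ : ℝ × ℝ →ₜ+ G) (W : Finset (ℝ × ℝ)) {s A : ℝ} (hs : 1 ≤ s) (hA : 1 ≤ A) (hMB : MB ν φ W s A)
    (h : C(G, ℝ)) (hh : ∀ g, 0 < h g) :
    ∃ v : C(G, ℝ), (∀ g, h g ≤ v g) ∧ (∀ g, mx φ W v g ≤ 4 * A * v g) ∧ ∫ g, v g ^ s ∂ν ≤ 2 ^ s * ∫ g, h g ^ s ∂ν := by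
  have := neG ν
  have hA0 : 0 < A := by linarith
  obtain ⟨m, hm, hmh⟩ := exists_lb h hh
  obtain ⟨V, V0, V1⟩ : ∃ V : ℕ → C(G, ℝ), V 0 = h ∧ ∀ j, V (j + 1) = h + (2 * A)⁻¹ • mx φ W (V j) :=
    ⟨fun j => Nat.rec h (fun _ w => h + (2 * A)⁻¹ • mx φ W w) j, rfl, fun _ => rfl⟩
  have hVh : ∀ j, ∀ g, h g ≤ V j g := by
    intro j
    induction j with
    | zero => intro g; rw [V0]
    | succ j ih =>
      intro g
      rw [V1, ContinuousMap.add_apply, ContinuousMap.smul_apply, smul_eq_mul]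
      have := mx_pos φ W (f := V j) (fun g => (hh g).trans_le (ih g)) g
      have : 0 ≤ (2 * A)⁻¹ * mx φ W (V j) g := by positivity
      linarith
  have hVp : ∀ j g, 0 < V j g := fun j g => (hh g).trans_le (hVh j g)
  have hint : ∀ j, ∫ g, V j g ^ s ∂ν ≤ 2 ^ s * ∫ g, h g ^ s ∂ν := by
    intro j
    have hI : 0 ≤ ∫ g, h g ^ s ∂ν := integral_nonneg fun g => Real.rpow_nonneg (hh g).le _
    induction j with
    | zero =>
      rw [V0]; exact le_mul_of_one_le_left hI (Real.one_le_rpow (by norm_num) (by linarith))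
    | succ j ih =>
      have pw : ∀ g, V (j + 1) g ^ s ≤ 1/2 * 2 ^ s * h g ^ s + 1/2 * A⁻¹ * mx φ W (V j) g ^ s := by
        intro g
        have hp := mx_pos φ W (hVp j) g
        have e : V (j + 1) g = (1/2:ℝ) • (2 * h g) + (1/2:ℝ) • (A⁻¹ * mx φ W (V j) g) := by
          rw [V1, ContinuousMap.add_apply, ContinuousMap.smul_apply]; simp only [smul_eq_mul, mul_inv]; ring
        have hcx := (convexOn_rpow hs).2 (mem_Ici.2 (by have := hh g; positivity : 0 ≤ 2 * h g))
          (mem_Ici.2 (by positivity : 0 ≤ A⁻¹ * mx φ W (V j) g)) (by norm_num : (0:ℝ) ≤ 1/2) (by norm_num : (0:ℝ) ≤ 1/2) (by norm_num)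
        rw [e]
        refine hcx.trans ?_
        beta_reduce
        rw [Real.mul_rpow (by norm_num) (hh g).le, Real.mul_rpow (by positivity) hp.le, smul_eq_mul, smul_eq_mul, ← mul_assoc]
        have : A⁻¹ ^ s ≤ A⁻¹ := by
          have := Real.rpow_le_rpow_of_exponent_ge (x := A⁻¹) (by positivity) (inv_le_one_of_one_le₀ hA) hs
          rwa [Real.rpow_one] at this
        have h3 := mul_le_mul_of_nonneg_right this (Real.rpow_nonneg hp.le s)
        linarith
      have h1 := hMB (V j) (hVp j)
      calc ∫ g, V (j + 1) g ^ s ∂ν ≤ ∫ g, (1/2 * 2 ^ s * h g ^ s + 1/2 * A⁻¹ * mx φ W (V j) g ^ s) ∂ν :=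
            integral_mono (pow_int ν (hVp _) s) (((pow_int ν hh s).const_mul _).add
              ((pow_int ν (fun g => mx_pos φ W (hVp j) g) s).const_mul _)) pw
        _ = 1/2 * 2 ^ s * ∫ g, h g ^ s ∂ν + 1/2 * A⁻¹ * ∫ g, mx φ W (V j) g ^ s ∂ν := by
            rw [integral_add ((pow_int ν hh s).const_mul _)
              ((pow_int ν (fun g => mx_pos φ W (hVp j) g) s).const_mul _), integral_const_mul, integral_const_mul]
        _ ≤ 1/2 * 2 ^ s * ∫ g, h g ^ s ∂ν + 1/2 * A⁻¹ * (A * (2 ^ s * ∫ g, h g ^ s ∂ν)) := by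
            gcongr
            exact h1.trans (mul_le_mul_of_nonneg_left ih hA0.le)
        _ = _ := by field_simp; ring
  have hinc : ∀ j, ‖V (j + 1) - V j‖ ≤ (1/2) ^ j * ‖V 1 - V 0‖ := by
    intro j
    induction j with
    | zero => simp
    | succ j ih =>
      rw [V1 (j + 1)]
      nth_rw 2 [V1 j]
      rw [add_sub_add_left_eq_sub, ← smul_sub, norm_smul, pow_succ]
      have h1 := mx_lip φ W (V (j + 1)) (V j)
      have h2 : ‖(2 * A)⁻¹‖ ≤ 1/2 := by
        rw [Real.norm_of_nonneg (by positivity), one_div]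
        exact inv_anti₀ (by norm_num) (by linarith)
      calc _ ≤ 1/2 * ((1/2) ^ j * ‖V 1 - V 0‖) := mul_le_mul h2 (h1.trans ih) (norm_nonneg _) (by norm_num)
        _ = _ := by ring
  obtain ⟨j, hj⟩ : ∃ j : ℕ, (1/2:ℝ) ^ j * ‖V 1 - V 0‖ < m := by
    have : Tendsto (fun j : ℕ => (1/2:ℝ) ^ j * ‖V 1 - V 0‖) atTop (𝓝 (0 * ‖V 1 - V 0‖)) :=
      (tendsto_pow_atTop_nhds_zero_of_lt_one (by norm_num) (by norm_num)).mul_const _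
    rw [zero_mul] at this
    exact (this.eventually (gt_mem_nhds hm)).exists
  refine ⟨V j, hVh j, fun g => ?_, hint j⟩
  have h1 : V (j + 1) g - V j g ≤ m := by
    have := (V (j + 1) - V j).norm_coe_le_norm g
    rw [Real.norm_eq_abs, ContinuousMap.sub_apply] at this
    exact (le_abs_self _).trans (this.trans ((hinc j).trans hj.le))
  have h2 : V (j + 1) g = h g + (2 * A)⁻¹ * mx φ W (V j) g := by rw [V1]; rfl
  have h3 : (2 * A)⁻¹ * mx φ W (V j) g ≤ 2 * V j g := by
    have := hmh g; have := hVh j g; have := hh g; linarith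
  have h4 := mul_le_mul_of_nonneg_left h3 (show 0 ≤ 2 * A by positivity)
  rw [← mul_assoc, mul_inv_cancel₀ (by positivity), one_mul] at h4
  linarith

/-- the inductive claim -/
def CL (s D : ℝ) : Prop := ∀ (φ : ℝ × ℝ →ₜ+ G) (t : ℝ) (U : ℕ → ℝ) (K M : ℕ), (∀ k, 0 < U k) →
  (∀ k, 2 * U (k + 1) ≤ U k) → MB ν φ (RR t U K M) s D

lemma NW_w (v : C(G, ℝ)) (hv : ∀ g, 0 < v g) (β : ℝ) (f : C(G, ℝ)) :
    NW ν (cpow v (-β)) f ^ 2 = ∫ g, f g ^ 2 * v g ^ (-β) ∂ν := by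
  rw [NW_sq ν _ _ fun g => by rw [cpow_pos v hv]; exact Real.rpow_nonneg (hv g).le _]
  simp_rw [cpow_pos v hv]

/-- weighted estimate with no leftover; the scales can be refined first -/
lemma wclean (φ : ℝ × ℝ →ₜ+ G) (t : ℝ) (U : ℕ → ℝ) (hU : ∀ k, 0 < U k) (hU2 : ∀ k, 2 * U (k + 1) ≤ U k)
    (M K : ℕ) (f : C(G, ℝ)) (hf : ∀ g, 0 < f g) :
    ∃ (t' : ℝ) (U' : ℕ → ℝ) (M' : ℕ), (∀ k, 0 < U' k) ∧ (∀ k, 2 * U' (k + 1) ≤ U' k) ∧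
      ∀ (β C : ℝ), 1/2 ≤ β → β < 1 → 1 ≤ C → ∀ v : C(G, ℝ), (∀ g, 0 < v g) →
      (∀ w ∈ XX t' (M' + 2) ∪ YY U' K (M' + 2) ∪ RR t' U' K (M' + 2), ∀ g, AA φ w v g ≤ C * v g) →
      ∫ g, mx φ (RR t U K M) f g ^ 2 * v g ^ (-β) ∂ν ≤ 2 * EW β C * ∫ g, f g ^ 2 * v g ^ (-β) ∂ν := by
  have := neG ν
  obtain ⟨m, hm, hmf⟩ := exists_lb f hf
  have hε : 0 < m / (K + 1) := by positivity
  choose τ hτ hτ' using fun k : ℕ => lo_small φ (t, 0) (0, U k) f hε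
  obtain ⟨J, hJ⟩ : ∃ J : ℕ, ∀ k < K, (1/2:ℝ) ^ J ≤ τ k := by
    have : ∀ᶠ J : ℕ in atTop, ∀ k ∈ Finset.range K, (1/2:ℝ) ^ J ≤ τ k := by
      rw [Finset.eventually_all]
      intro k _
      exact (tendsto_pow_atTop_nhds_zero_of_lt_one (by norm_num) (by norm_num)).eventually_le_const (hτ k)
    obtain ⟨J, hJ⟩ := this.exists
    exact ⟨J, fun k hk => hJ k (Finset.mem_range.2 hk)⟩
  set c : ℝ := (1/2) ^ J with hc
  have hc0 : 0 < c := by positivity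
  refine ⟨c * t, fun k => c * U k, M + J, fun k => mul_pos hc0 (hU k), fun k => by nlinarith [hU2 k], ?_⟩
  intro β C hβ hβ1 hC v hv hA
  have h1 := wthm ν hβ hβ1 hC φ (c * t) (fun k => c * U k) (fun k => mul_pos hc0 (hU k))
    (fun k => by nlinarith [hU2 k]) (M + J) K v hv hA f hf
  have hρ : ∀ g, 0 ≤ cpow v (-β) g := fun g => by rw [cpow_pos v hv]; exact Real.rpow_nonneg (hv g).le _
  have hN0 : 0 ≤ NW ν (cpow v (-β)) f := apply_nonneg _ _
  have h2 : ∀ k ∈ Finset.range K, NW ν (cpow v (-β)) (lo φ (c * t, 0) (0, c * U k) f) ^ 2 ≤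
      ((K + 1 : ℝ)⁻¹) ^ 2 * NW ν (cpow v (-β)) f ^ 2 := by
    intro k hk
    rw [← mul_pow]
    refine pow_le_pow_left₀ (apply_nonneg _ _) ?_ 2
    have e : NW ν (cpow v (-β)) ((K + 1 : ℝ)⁻¹ • f) = (K + 1 : ℝ)⁻¹ * NW ν (cpow v (-β)) f := by
      rw [map_smul_eq_mul, Real.norm_of_nonneg (by positivity)]
    rw [← e]
    refine NW_mono ν _ _ _ hρ fun g => ?_
    have h3 := hτ' k c hc0 (hJ k (Finset.mem_range.1 hk))
    have h4 := (lo φ (c • (t, (0:ℝ))) (c • ((0:ℝ), U k)) f).norm_coe_le_norm g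
    have e2 : lo φ (c • (t, (0:ℝ))) (c • ((0:ℝ), U k)) f = lo φ (c * t, 0) (0, c * U k) f := by simp
    rw [e2] at h3 h4
    rw [Real.norm_eq_abs] at h4
    refine (h4.trans h3).trans (le_trans ?_ (le_abs_self _))
    show m / (K + 1) ≤ (K + 1 : ℝ)⁻¹ * f g
    rw [div_eq_inv_mul]
    exact mul_le_mul_of_nonneg_left (hmf g) (by positivity)
  have h3 : ∑ k ∈ Finset.range K, NW ν (cpow v (-β)) (lo φ (c * t, 0) (0, c * U k) f) ^ 2 ≤ NW ν (cpow v (-β)) f ^ 2 := by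
    refine (Finset.sum_le_sum h2).trans ?_
    rw [Finset.sum_const, Finset.card_range, nsmul_eq_mul, ← mul_assoc]
    refine mul_le_of_le_one_left (sq_nonneg _) ?_
    rw [inv_pow, ← div_eq_mul_inv, div_le_one (by positivity)]
    have : (0:ℝ) ≤ K := by positivity
    nlinarith
  have hE : 0 ≤ EW β C := by
    have hs : 1 < 2 - β := by linarith
    have := D1_pos hs
    have hb : 0 < 1 - β := by linarith
    unfold EW; positivity
  have h4 : NW ν (cpow v (-β)) (mx φ (RR t U K M) f) ≤
      NW ν (cpow v (-β)) (mx φ (RR (c * t) (fun k => c * U k) K (M + J + 1)) f) := by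
    refine NW_mono ν _ _ _ hρ fun g => ?_
    rw [abs_of_pos (mx_pos φ _ hf g), abs_of_pos (mx_pos φ _ hf g), mx_le_iff]
    refine ⟨mx_ge φ _ f g, fun w hw => mx_ge' φ _ f g w ?_⟩
    obtain ⟨k, hk, hw⟩ := Finset.mem_biUnion.1 hw
    obtain ⟨n, hn, rfl⟩ := Finset.mem_image.1 hw
    refine Finset.mem_biUnion.2 ⟨k, hk, Finset.mem_image.2 ⟨n + J, ?_, ?_⟩⟩
    · have := Finset.mem_range.1 hn; exact Finset.mem_range.2 (by omega)
    · have : (2:ℝ) ^ (n + J) * c = 2 ^ n := by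
        rw [hc, pow_add, mul_assoc, ← mul_pow]; norm_num
      simp only [Prod.mk_add_mk, Prod.smul_mk, smul_eq_mul, add_zero, zero_add, ← mul_assoc, this]
  rw [← NW_w ν v hv, ← NW_w ν v hv]
  have h5 := pow_le_pow_left₀ (apply_nonneg _ _) h4 2
  nlinarith

lemma CL_two : ∃ D, 0 ≤ D ∧ CL (G := G) ν 2 D := by
  have hE : 0 ≤ EW (1/2) 1 := by
    have := D1_pos (show (1:ℝ) < 2 - 1/2 by norm_num)
    unfold EW; norm_num at this ⊢; positivity
  refine ⟨2 * EW (1/2) 1, by positivity, fun φ t U K M hU hU2 f hf => ?_⟩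
  obtain ⟨t', U', M', _, _, h⟩ := wclean ν φ t U hU hU2 M K f hf
  have := h (1/2) 1 le_rfl (by norm_num) le_rfl (ContinuousMap.const G 1) (fun g => by simp)
    (fun w _ g => by rw [AA_const]; simp)
  simpa using this

lemma CL_step {s D β : ℝ} (hs : 1 < s) (hβ : 1/2 ≤ β) (hβ1 : β < 1) (hD : 0 ≤ D) (h : CL (G := G) ν s D) :
    ∃ D', 0 ≤ D' ∧ CL (G := G) ν (2 * s / (β + s)) D' := by
  set A := 1 + (2 ^ s * D1 s + 2 ^ s * D1 s + D) with hAd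
  have hD1 := D1_pos hs
  have hA : 1 ≤ A := by
    have : 0 < (2:ℝ) ^ s := by positivity
    nlinarith
  set p := 2 * s / (β + s) with hp
  have hβs : 0 < β + s := by linarith
  have hp2 : 2 - p = 2 * β / (β + s) := by rw [hp]; field_simp; ring
  have hp0 : 0 < p := by rw [hp]; positivity
  have hE : 0 ≤ EW β (4 * A) := by
    have := D1_pos (show 1 < 2 - β by linarith)
    have hb : 0 < 1 - β := by linarith
    unfold EW; positivity
  refine ⟨2 * EW β (4 * A) + 2 ^ s, by positivity, fun φ t U K M hU hU2 f hf => ?_⟩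
  obtain ⟨t', U', M', hU', hU2', hw⟩ := wclean ν φ t U hU hU2 M K f hf
  have hh : ∀ g, 0 < cpow f ((2 - p) / β) g := fun g => by rw [cpow_pos f hf]; exact Real.rpow_pos_of_pos (hf g) _
  set W := XX t' (M' + 2) ∪ YY U' K (M' + 2) ∪ RR t' U' K (M' + 2) with hW
  have hMB : MB ν φ W s A := by
    have h1 := MB_union ν φ (MB_union ν φ (MB_XX ν φ t' (M' + 2) hs) (MB_YY ν φ U' hU' K (M' + 2) hs))
      (h φ t' U' K (M' + 2) hU' hU2')
    intro f hf
    refine (h1 f hf).trans (mul_le_mul_of_nonneg_right (by linarith) (integral_nonneg fun g => Real.rpow_nonneg (hf g).le _))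
  obtain ⟨v, hv1, hv2, hv3⟩ := rubio ν φ W hs.le hA hMB _ hh
  have hv : ∀ g, 0 < v g := fun g => (hh g).trans_le (hv1 g)
  have h1 := hw β (4 * A) hβ hβ1 (by linarith) v hv (fun w hw g => (mx_ge' φ W v g w hw).trans (hv2 g))
  have e1 : ∀ g, cpow f ((2 - p) / β) g ^ s = f g ^ p := fun g => by
    rw [cpow_pos f hf, ← Real.rpow_mul (hf g).le]; congr 1; rw [hp2, hp]; field_simp
  simp_rw [e1] at hv3
  have h2 : ∫ g, f g ^ 2 * v g ^ (-β) ∂ν ≤ ∫ g, f g ^ p ∂ν := by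
    refine integral_mono (wint ν f hv (-β)) (pow_int ν hf p) fun g => ?_
    have h3 : v g ^ (-β) ≤ f g ^ (p - 2) := by
      have := Real.rpow_le_rpow_of_nonpos (hh g) (hv1 g) (show -β ≤ 0 by linarith)
      rw [cpow_pos f hf, ← Real.rpow_mul (hf g).le] at this
      refine this.trans (le_of_eq ?_)
      congr 1; field_simp; ring
    calc f g ^ 2 * v g ^ (-β) ≤ f g ^ 2 * f g ^ (p - 2) := mul_le_mul_of_nonneg_left h3 (sq_nonneg _)
      _ = f g ^ p := by rw [← Real.rpow_natCast, ← Real.rpow_add (hf g)]; congr 1; push_cast; ring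
  have h3 : ∫ g, mx φ (RR t U K M) f g ^ p ∂ν ≤ ∫ g, (mx φ (RR t U K M) f g ^ 2 * v g ^ (-β) + v g ^ s) ∂ν := by
    refine integral_mono (pow_int ν (fun g => mx_pos φ _ hf g) p) ((wint ν _ hv (-β)).add (pow_int ν hv s)) fun g => ?_
    have hm := mx_pos φ (RR t U K M) hf g
    have hvg := hv g
    have y := Real.geom_mean_le_arith_mean2_weighted (w₁ := p / 2) (w₂ := 1 - p / 2) (by positivity)
      (by have : 0 ≤ 2 - p := by rw [hp2]; positivity
          linarith)
      (p₁ := mx φ (RR t U K M) f g ^ 2 * v g ^ (-β)) (p₂ := v g ^ s) (by positivity) (by positivity) (by ring)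
    have e : (mx φ (RR t U K M) f g ^ 2 * v g ^ (-β)) ^ (p / 2) * (v g ^ s) ^ (1 - p / 2) = mx φ (RR t U K M) f g ^ p := by
      rw [Real.mul_rpow (by positivity) (by positivity), ← Real.rpow_natCast, ← Real.rpow_mul hm.le,
        ← Real.rpow_mul hvg.le, ← Real.rpow_mul hvg.le, mul_assoc, ← Real.rpow_add hvg]
      have : -β * (p / 2) + s * (1 - p / 2) = 0 := by rw [hp]; field_simp; ring
      rw [this, Real.rpow_zero, mul_one]; congr 1; push_cast; ring
    rw [e] at y
    refine y.trans ?_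
    have q1 : 0 ≤ mx φ (RR t U K M) f g ^ 2 * v g ^ (-β) := by positivity
    have q2 : 0 ≤ v g ^ s := by positivity
    have : p / 2 ≤ 1 := by
      have : 0 ≤ 2 - p := by rw [hp2]; positivity
      linarith
    nlinarith
  rw [integral_add (wint ν _ hv (-β)) (pow_int ν hv s)] at h3
  have h4 := mul_le_mul_of_nonneg_left h2 (show 0 ≤ 2 * EW β (4 * A) by positivity)
  linarith

lemma CL_all {p : ℝ} (hp : 1 < p) : ∃ q D, 1 < q ∧ q < p ∧ 0 ≤ D ∧ CL (G := G) ν q D := by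
  set β := max (1/2) (1 - (p - 1) / 2) with hβd
  have hβ : 1/2 ≤ β := le_max_left _ _
  have hβ1 : β < 1 := max_lt (by norm_num) (by linarith)
  have hβp : 2 - β < p := by have : 1 - (p - 1) / 2 ≤ β := le_max_right _ _; linarith
  have key : ∀ j : ℕ, ∃ s D, 2 - β ≤ s ∧ s - (2 - β) ≤ (1/2) ^ j ∧ 0 ≤ D ∧ CL (G := G) ν s D := by
    intro j
    induction j with
    | zero => obtain ⟨D, h0, h⟩ := CL_two (G := G) ν; exact ⟨2, D, by linarith, by norm_num; linarith, h0, h⟩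
    | succ j ih =>
      obtain ⟨s, D, h1, h2, h0, h⟩ := ih
      obtain ⟨D', h0', h'⟩ := CL_step ν (by linarith) hβ hβ1 h0 h
      have hbs : 0 < β + s := by linarith
      have e : 2 * s / (β + s) - (2 - β) = β / (β + s) * (s - (2 - β)) := by field_simp; ring
      have hr : β / (β + s) ≤ 1 / 2 := by rw [div_le_div_iff₀ hbs (by norm_num)]; linarith
      have hr0 : 0 ≤ β / (β + s) := by positivity
      refine ⟨_, D', ?_, ?_, h0', h'⟩
      · have := mul_nonneg hr0 (sub_nonneg.2 h1); linarith
      · rw [e, pow_succ]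
        calc _ ≤ 1/2 * (1/2:ℝ) ^ j := mul_le_mul hr h2 (sub_nonneg.2 h1) (by norm_num)
          _ = _ := by ring
  obtain ⟨j, hj⟩ := exists_pow_lt_of_lt_one (show 0 < p - (2 - β) by linarith) (show (1/2:ℝ) < 1 by norm_num)
  obtain ⟨s, D, h1, h2, h0, h⟩ := key j
  exact ⟨s, D, by linarith, by linarith, h0, h⟩

end rdf

section P13
variable {G : Type*} [AddCommGroup G] [TopologicalSpace G] [IsTopologicalAddGroup G] [CompactSpace G]
  [MeasurableSpace G] [BorelSpace G] (ν : Measure G) [IsProbabilityMeasure ν] [ν.IsAddLeftInvariant]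

lemma MB_mono (φ ψ : ℝ × ℝ →ₜ+ G) {V W : Finset (ℝ × ℝ)} {s D : ℝ} (hs : 0 ≤ s)
    (hVW : ∀ v ∈ V, ∃ w ∈ W, ∀ f : C(G, ℝ), ∀ g, AA φ v f g = AA ψ w f g) (h : MB ν ψ W s D) : MB ν φ V s D := by
  intro f hf
  refine le_trans ?_ (h f hf)
  refine integral_mono (pow_int ν (mx_pos φ _ hf) s) (pow_int ν (mx_pos ψ _ hf) s) fun g => ?_
  refine Real.rpow_le_rpow (mx_pos φ _ hf g).le ?_ hs
  rw [mx_le_iff]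
  refine ⟨mx_ge _ _ _ _, fun v hv => ?_⟩
  obtain ⟨w, hw, e⟩ := hVW v hv
  rw [e]
  exact mx_ge' ψ W f g w hw

lemma MB_pm (φ : ℝ × ℝ →ₜ+ G) {W : Finset (ℝ × ℝ)} {s D : ℝ} (hs : 0 ≤ s)
    (h : ∀ ψ : ℝ × ℝ →ₜ+ G, MB ν ψ W s D) : MB ν φ (W ∪ W.image fun w => -w) s (D + D) := by
  refine MB_union ν φ (h φ) (MB_mono ν φ (-φ) hs (fun v hv => ?_) (h (-φ)))
  obtain ⟨w, hw, rfl⟩ := Finset.mem_image.1 hv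
  refine ⟨w, hw, fun f g => ?_⟩
  rw [AA_apply, AA_apply]
  congr 1; ext t
  rw [smul_neg, map_neg]; rfl

lemma MB_bU (φ : ℝ × ℝ →ₜ+ G) {s D : ℝ} (hD : 0 ≤ D) (hs : 0 ≤ s) (W : ℕ → Finset (ℝ × ℝ)) (m : ℕ)
    (h : ∀ r < m, MB ν φ (W r) s D) : MB ν φ ((Finset.range m).biUnion W) s (m * D + 1) := by
  induction m with
  | zero =>
    intro f hf
    have : ∀ g, mx φ ((Finset.range 0).biUnion W) f g = f g := fun g =>
      le_antisymm ((mx_le_iff _ _ _ _ _).2 ⟨le_rfl, by simp⟩) (mx_ge _ _ _ _)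
    simp_rw [this]; simp
  | succ m ih =>
    rw [Finset.range_add_one, Finset.biUnion_insert]
    have := MB_union ν φ (h m (by omega)) (ih fun r hr => h r (by omega))
    convert this using 1
    push_cast; ring

lemma bigmax {p : ℝ} (hp : 1 < p) (u : ℕ → ℝ) (hu : ∀ k, 0 < u k)
    (hlac : ∃ l ∈ Set.Ioo (0 : ℝ) 1, ∀ k, u (k + 1) ≤ l * u k) :
    ∃ q D, 1 < q ∧ q < p ∧ 0 ≤ D ∧ ∀ (φ : ℝ × ℝ →ₜ+ G) (N : ℕ) (k : ℕ → ℕ) (L w : ℕ → ℝ), (∀ n, 1 ≤ L n) → (∀ n, 0 < w n) →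
      ∀ F : C(G, ℝ), (∀ g, 0 < F g) → ∃ Z : C(G, ℝ), (∀ g, 0 < Z g) ∧ ∫ g, Z g ^ q ∂ν ≤ D * ∫ g, F g ^ q ∂ν ∧
        ∀ n < N, ∀ e1 e2 : ℝ, (e1 = 1 ∨ e1 = -1) → (e2 = 1 ∨ e2 = -1) → ∀ g,
          AA φ (e1 • (L n, L n * u (k n))) (AA φ (e2 • (0, w n)) F) g ≤ 2 * Z g := by
  obtain ⟨q, D, hq, hqp, hD, hCL⟩ := CL_all (G := G) ν hp
  obtain ⟨l, ⟨hl0, hl1⟩, hl⟩ := hlac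
  obtain ⟨m, hm⟩ := exists_pow_lt_of_lt_one (show (0:ℝ) < 1/2 by norm_num) hl1
  have hm0 : 0 < m := by
    rcases Nat.eq_zero_or_pos m with h | h
    · rw [h, pow_zero] at hm; norm_num at hm
    · exact h
  have hpow : ∀ j k, u (k + j) ≤ l ^ j * u k := by
    intro j
    induction j with
    | zero => simp
    | succ j ih =>
      intro k
      rw [← add_assoc, pow_succ']
      calc _ ≤ l * u (k + j) := hl _
        _ ≤ l * (l ^ j * u k) := mul_le_mul_of_nonneg_left (ih k) hl0.le
        _ = _ := by ring
  have hq0 : 0 ≤ q := by linarith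
  set D2 := 2 ^ q * D1 q
  have hD2 : 0 ≤ D2 := mul_nonneg (by positivity) (D1_pos hq).le
  set DD := (m * D + 1) + (m * D + 1)
  have hDD : 0 ≤ DD := by positivity
  refine ⟨q, DD * (D2 + D2), hq, hqp, by positivity, ?_⟩
  intro φ N k L w hL hw F hF
  obtain ⟨K, hK⟩ : ∃ K, ∀ n < N, k n < K := ⟨(Finset.range N).sup k + 1, fun n hn =>
    Nat.lt_succ_of_le (Finset.le_sup (f := k) (Finset.mem_range.2 hn))⟩
  choose a ha1 ha2 using fun n => exists_nat_pow_near (hL n) (one_lt_two (α := ℝ))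
  obtain ⟨M, hM⟩ : ∃ M, ∀ n < N, a n + 1 < M := ⟨(Finset.range N).sup (fun n => a n + 1) + 1, fun n hn =>
    Nat.lt_succ_of_le (Finset.le_sup (f := fun n => a n + 1) (Finset.mem_range.2 hn))⟩
  set W := (Finset.range m).biUnion fun r => RR 1 (fun j => u (m * j + r)) K M
  have hW : ∀ ψ : ℝ × ℝ →ₜ+ G, MB ν ψ W q (m * D + 1) := fun ψ => MB_bU ν ψ hD hq0 _ m fun r hr =>
    hCL ψ 1 _ K M (fun j => hu _) (fun j => by
      have := hpow m (m * j + r)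
      rw [show m * (j + 1) + r = m * j + r + m by ring]
      have h2 := mul_le_mul_of_nonneg_right hm.le (hu (m * j + r)).le
      linarith)
  set Y := ((Finset.range N).image w).image fun c => c • ((0:ℝ), (1:ℝ))
  have hY : ∀ ψ : ℝ × ℝ →ₜ+ G, MB ν ψ Y q D2 := fun ψ => MB_ray ν ψ (0, 1) ((Finset.range N).image w)
    (by intro c hc; obtain ⟨n, _, rfl⟩ := Finset.mem_image.1 hc; exact hw n) hq
  have hWp := MB_pm ν φ hq0 hW
  have hYp := MB_pm ν φ hq0 hY
  set W' := W ∪ W.image fun w => -w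
  set Y' := Y ∪ Y.image fun w => -w
  have hF1 : ∀ g, 0 < mx φ Y' F g := mx_pos φ Y' hF
  refine ⟨mx φ W' (mx φ Y' F), mx_pos φ W' hF1, ?_, ?_⟩
  · calc _ ≤ DD * ∫ g, mx φ Y' F g ^ q ∂ν := hWp _ hF1
      _ ≤ DD * ((D2 + D2) * ∫ g, F g ^ q ∂ν) := mul_le_mul_of_nonneg_left (hYp F hF) hDD
      _ = _ := by ring
  intro n hn e1 e2 he1 he2 g
  have mem : ∀ (V : Finset (ℝ × ℝ)) (v : ℝ × ℝ), v ∈ V → ∀ e : ℝ, (e = 1 ∨ e = -1) → e • v ∈ V ∪ V.image fun w => -w := by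
    intro V v hv e he
    rcases he with rfl | rfl
    · rw [one_smul]; exact Finset.mem_union_left _ hv
    · rw [neg_one_smul]; exact Finset.mem_union_right _ (Finset.mem_image_of_mem _ hv)
  have hy : e2 • ((0:ℝ), w n) ∈ Y' := mem Y _ (Finset.mem_image.2 ⟨w n, Finset.mem_image_of_mem _ (Finset.mem_range.2 hn), by simp⟩) e2 he2
  have hx : e1 • ((2:ℝ) ^ (a n + 1), (2:ℝ) ^ (a n + 1) * u (k n)) ∈ W' := by
    refine mem W _ (Finset.mem_biUnion.2 ⟨k n % m, Finset.mem_range.2 (Nat.mod_lt _ hm0), ?_⟩) e1 he1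
    refine Finset.mem_biUnion.2 ⟨k n / m, Finset.mem_range.2 ((Nat.div_le_self _ _).trans_lt (hK n hn)), ?_⟩
    refine Finset.mem_image.2 ⟨a n + 1, Finset.mem_range.2 (hM n hn), ?_⟩
    simp only [Nat.div_add_mod]
    simp
  have hL0 : 0 < L n := by linarith [hL n]
  have hc1 : 1 ≤ 2 ^ (a n + 1) / L n := (one_le_div hL0).2 (ha2 n).le
  have hc2 : 2 ^ (a n + 1) / L n ≤ 2 := by rw [div_le_iff₀ hL0, pow_succ]; linarith [ha1 n]
  have e : (2 ^ (a n + 1) / L n) • e1 • (L n, L n * u (k n)) = e1 • ((2:ℝ) ^ (a n + 1), (2:ℝ) ^ (a n + 1) * u (k n)) := by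
    rw [smul_comm]; congr 1; ext <;> simp <;> field_simp
  have hpos : ∀ v, ∀ g, 0 ≤ AA φ v (mx φ Y' F) g := fun v g => by
    have := AA_mono φ v (f := 0) (h := mx φ Y' F) (fun g => (hF1 g).le) g
    rwa [map_zero] at this
  calc _ ≤ AA φ (e1 • (L n, L n * u (k n))) (mx φ Y' F) g := AA_mono φ _ (fun g => mx_ge' φ Y' F g _ hy) g
    _ ≤ _ := AA_le_mul φ _ hc1 _ (fun g => (hF1 g).le) g
    _ ≤ 2 * AA φ (e1 • ((2:ℝ) ^ (a n + 1), (2:ℝ) ^ (a n + 1) * u (k n))) (mx φ Y' F) g := by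
        rw [e]; exact mul_le_mul_of_nonneg_right hc2 (hpos _ _)
    _ ≤ _ := mul_le_mul_of_nonneg_left (mx_ge' φ W' _ g _ hx) (by norm_num)
end P13

section P14
variable {G : Type*} [AddCommGroup G] [TopologicalSpace G] [IsTopologicalAddGroup G] [CompactSpace G]

lemma sumlow (φ : ℝ × ℝ →ₜ+ G) (f : C(G, ℝ)) (hf : ∀ g, 0 ≤ f g) (v : ℝ × ℝ) (g : G) {L : ℝ} (hL : 0 < L) (m : ℕ)
    (hm : m ≤ 3 * L) (c : ℕ → ℝ) (hc0 : ∀ i, 0 ≤ c i)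
    (hc : ∀ i < m, ∀ x ∈ Icc (i:ℝ) (i + 1), c i ≤ f (g + φ (x • v))) :
    ∑ i ∈ Finset.range m, c i ≤ Real.exp 3 * L * AA φ (L • v) f g := by
  set H : ℝ → ℝ := fun t => Real.exp (-t) * f (g + φ (t • L • v)) with hH
  have hcont : Continuous H := by fun_prop
  have hH0 : ∀ t, 0 ≤ H t := fun t => mul_nonneg (Real.exp_nonneg _) (hf _)
  have hint : IntegrableOn H (Ioi 0) := by
    refine Integrable.mono' (g := fun t => Real.exp (-t) * ‖f‖) ((integrableOn_exp_neg_Ioi 0).mul_const _)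
      hcont.aestronglyMeasurable (Eventually.of_forall fun t => ?_)
    rw [Real.norm_of_nonneg (hH0 t)]
    exact mul_le_mul_of_nonneg_left ((le_abs_self _).trans (f.norm_coe_le_norm _)) (Real.exp_nonneg _)
  have e1 : AA φ (L • v) f g = ∫ t in Ioi 0, H t := by
    rw [AA_apply, EE_integral]; simp [H]
  have h2 : ∫ t in (0:ℝ)..(m / L), H t ≤ ∫ t in Ioi 0, H t := by
    rw [intervalIntegral.integral_of_le (by positivity)]
    exact setIntegral_mono_set hint (Eventually.of_forall hH0) (Ioc_subset_Ioi_self.eventuallyLE)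
  have h3 := intervalIntegral.sum_integral_adjacent_intervals (f := H) (a := fun i : ℕ => (i:ℝ) / L) (n := m) (μ := volume)
    (fun k _ => hcont.intervalIntegrable _ _)
  simp only [Nat.cast_zero, zero_div] at h3
  have h4 : ∀ i ∈ Finset.range m, Real.exp (-3) * L⁻¹ * c i ≤ ∫ t in ((i:ℝ) / L)..((i + 1 : ℕ) / L), H t := by
    intro i hi
    have hi := Finset.mem_range.1 hi
    have hle : (i:ℝ) / L ≤ (i + 1 : ℕ) / L := by gcongr; simp
    have := intervalIntegral.integral_mono_on (μ := volume) hle (f := fun _ => Real.exp (-3) * c i) (g := H) (by simp)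
      (hcont.intervalIntegrable _ _) (fun t ht => by
        have ht1 : (i:ℝ) ≤ t * L := (div_le_iff₀ hL).1 ht.1
        have ht2 : t * L ≤ i + 1 := by have := (le_div_iff₀ hL).1 ht.2; push_cast at this; exact this
        have := hc i hi (t * L) ⟨ht1, ht2⟩
        rw [mul_smul] at this
        refine mul_le_mul (Real.exp_le_exp.2 ?_) this (hc0 i) (Real.exp_nonneg _)
        have : ((i:ℝ) + 1) ≤ m := by exact_mod_cast hi
        have : t * L ≤ 3 * L := by linarith
        linarith [le_of_mul_le_mul_right this hL])
    refine le_trans (le_of_eq ?_) this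
    rw [intervalIntegral.integral_const, smul_eq_mul]; push_cast; field_simp; ring
  have h5 := Finset.sum_le_sum h4
  rw [h3, ← Finset.mul_sum] at h5
  have h6 := mul_le_mul_of_nonneg_left (h5.trans h2) (show 0 ≤ Real.exp 3 * L by positivity)
  rw [← e1, ← mul_assoc] at h6
  refine le_trans (le_of_eq ?_) h6
  rw [show Real.exp 3 * L * (Real.exp (-3) * L⁻¹) = (Real.exp 3 * Real.exp (-3)) * (L * L⁻¹) by ring, ← Real.exp_add,
    mul_inv_cancel₀ hL.ne']
  simp

abbrev TT := UnitAddCircle × UnitAddCircle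
abbrev νT : Measure TT := (volume : Measure UnitAddCircle).prod volume

instance volU_prob : IsProbabilityMeasure (volume : Measure UnitAddCircle) := ⟨UnitAddCircle.measure_univ⟩

lemma νT_prob : IsProbabilityMeasure νT := inferInstance
lemma νT_inv : νT.IsAddLeftInvariant := inferInstance

def phT (Q : ℝ) : ℝ × ℝ →ₜ+ TT where
  toFun v := ((↑(v.1 / Q) : UnitAddCircle), (↑(v.2 / Q) : UnitAddCircle))
  map_zero' := by simp
  map_add' x y := by simp [add_div]
  continuous_toFun := by
    refine Continuous.prodMk ?_ ?_ <;> exact (AddCircle.continuous_mk' 1).comp (by fun_prop)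

lemma phT_apply (Q : ℝ) (v : ℝ × ℝ) : phT Q v = ((↑(v.1 / Q) : UnitAddCircle), (↑(v.2 / Q) : UnitAddCircle)) := rfl

lemma cn_le (x : ℝ) : ‖(x : UnitAddCircle)‖ ≤ |x| := by
  rw [UnitAddCircle.norm_eq]; simpa using round_le x 0

lemma cn_rep (z : UnitAddCircle) : ∃ x : ℝ, (x : UnitAddCircle) = z ∧ |x| = ‖z‖ := by
  obtain ⟨y, rfl⟩ := QuotientAddGroup.mk_surjective z
  refine ⟨y - round y, ?_, ?_⟩
  · have := AddCircle.coe_period (1:ℝ)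
    have h2 : ((round y : ℝ) : UnitAddCircle) = 0 := by
      rw [← mul_one ((round y : ℤ) : ℝ), ← zsmul_eq_mul, AddCircle.coe_zsmul, this, smul_zero]
    rw [AddCircle.coe_sub, h2, sub_zero]
  · exact (UnitAddCircle.norm_eq (x := y)).symm

def et (Q : ℝ) : C(UnitAddCircle, ℝ) := ⟨fun z => max 0 (min 1 (5 - Q * ‖z‖)), by fun_prop⟩

lemma et_nn (Q : ℝ) (z) : 0 ≤ et Q z := le_max_left _ _

lemma et_one (Q : ℝ) (hQ : 0 < Q) (x : ℝ) (hx : |x| ≤ 4) : et Q ↑(x / Q) = 1 := by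
  have h := cn_le (x / Q)
  rw [abs_div, abs_of_pos hQ, le_div_iff₀ hQ] at h
  have : 1 ≤ 5 - Q * ‖(↑(x / Q) : UnitAddCircle)‖ := by linarith
  show max 0 (min 1 (5 - Q * ‖(↑(x / Q) : UnitAddCircle)‖)) = 1
  rw [min_eq_left this]; simp

lemma et_int (Q : ℝ) (hQ : 0 < Q) : ∫ z, et Q z ≤ 10 / Q := by
  have h1 : ∀ z, et Q z ≤ (Metric.closedBall (0 : UnitAddCircle) (5 / Q)).indicator (fun _ => (1:ℝ)) z := by
    intro z
    by_cases hz : z ∈ Metric.closedBall (0 : UnitAddCircle) (5 / Q)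
    · rw [indicator_of_mem hz]; exact max_le zero_le_one (min_le_left _ _)
    · rw [indicator_of_notMem hz]
      rw [mem_closedBall_zero_iff, not_le, div_lt_iff₀ hQ] at hz
      exact max_le le_rfl ((min_le_right _ _).trans (by linarith))
  have h2 := integral_mono (μ := (volume : Measure UnitAddCircle)) (C_int _ (et Q)) ((integrable_const (1:ℝ)).indicator
    Metric.isClosed_closedBall.measurableSet) h1
  refine h2.trans ?_
  rw [integral_indicator Metric.isClosed_closedBall.measurableSet, setIntegral_const, smul_eq_mul, mul_one, Measure.real,
    AddCircle.volume_closedBall]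
  refine ENNReal.toReal_le_of_le_ofReal (by positivity) (ENNReal.ofReal_le_ofReal ((min_le_right _ _).trans (le_of_eq (by ring))))

lemma ball_vol (c : TT) (Q : ℝ) (hQ : 1 ≤ Q) : νT.real (Metric.closedBall c (1 / (4 * Q))) = (1 / (2 * Q)) ^ 2 := by
  rw [show c = (c.1, c.2) from rfl, ← closedBall_prod_same, Measure.real, Measure.prod_prod, AddCircle.volume_closedBall, AddCircle.volume_closedBall,
    min_eq_right, ENNReal.toReal_mul, ENNReal.toReal_ofReal (by positivity)]
  · field_simp; norm_num
  · rw [← mul_div_assoc, div_le_one (by positivity)]; linarith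

lemma ball_disj (Q : ℕ) (hQ : 0 < Q) (a b : ℤ × ℤ) (ha : a ∈ Finset.Ico (0:ℤ) Q ×ˢ Finset.Ico (0:ℤ) Q)
    (hb : b ∈ Finset.Ico (0:ℤ) Q ×ˢ Finset.Ico (0:ℤ) Q) (hab : a ≠ b) :
    Disjoint (Metric.closedBall (phT Q (a.1, a.2)) (1 / (4 * Q))) (Metric.closedBall (phT Q (b.1, b.2)) (1 / (4 * Q))) := by
  have hQ' : (0:ℝ) < Q := by exact_mod_cast hQ
  have key : ∀ i j : ℤ, i ∈ Finset.Ico (0:ℤ) Q → j ∈ Finset.Ico (0:ℤ) Q →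
      ‖(↑((i:ℝ) / Q) - ↑((j:ℝ) / Q) : UnitAddCircle)‖ ≤ 1 / (2 * Q) → i = j := by
    intro i j hi hj h
    rw [Finset.mem_Ico] at hi hj
    rw [← AddCircle.coe_sub, UnitAddCircle.norm_eq] at h
    set r := round ((i:ℝ) / Q - j / Q)
    have h2 : |((i - j - r * Q : ℤ) : ℝ)| ≤ 1 / 2 := by
      have : ((i - j - r * Q : ℤ) : ℝ) = ((i:ℝ) / Q - j / Q - r) * Q := by push_cast; field_simp
      rw [this, abs_mul, abs_of_pos hQ']
      calc _ ≤ 1 / (2 * Q) * (Q:ℝ) := by gcongr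
        _ = _ := by field_simp
    have h3 : i - j - r * Q = 0 := by
      rw [← Int.abs_lt_one_iff]
      have : |((i - j - r * Q : ℤ) : ℝ)| < 1 := by linarith
      exact_mod_cast this
    have hr : r = 0 := by
      by_contra hr
      rcases lt_or_gt_of_ne hr with h | h
      · have : r * Q ≤ -1 * Q := mul_le_mul_of_nonneg_right (by omega) (by positivity)
        omega
      · have : 1 * (Q:ℤ) ≤ r * Q := mul_le_mul_of_nonneg_right (by omega) (by positivity)
        omega
    rw [hr] at h3; omega
  rw [Set.disjoint_left]
  intro z hz1 hz2
  rw [mem_closedBall_iff_norm'] at hz1 hz2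
  have h := norm_sub_le (phT Q (a.1, a.2) - z) (phT Q (b.1, b.2) - z)
  rw [sub_sub_sub_cancel_right] at h
  have h' : ‖phT Q (a.1, a.2) - phT Q (b.1, b.2)‖ ≤ 1 / (2 * Q) := h.trans ((add_le_add hz1 hz2).trans (le_of_eq (by field_simp; norm_num)))
  rw [Prod.norm_def] at h'
  rw [Finset.mem_product] at ha hb
  exact hab (Prod.ext (key _ _ ha.1 hb.1 ((le_max_left _ _).trans h')) (key _ _ ha.2 hb.2 ((le_max_right _ _).trans h')))
end P14

section P15
def gsum (γ : ℤ × ℤ → ℝ) (u : ℝ) (m m' : ℕ) (e1 e2 : ℤ) (a : ℤ × ℤ) : ℝ :=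
  ∑ i ∈ Finset.range m, ∑ j ∈ Finset.range m', γ (a.1 + e1 * i, a.2 + ⌊u * (e1 * i)⌋ + e2 * j)

lemma gsum_le (Q : ℕ) (hQ : 0 < Q) (γ : ℤ × ℤ → ℝ) (hγ : ∀ a, 0 ≤ γ a) (F : C(TT, ℝ)) (hF : ∀ g, 0 ≤ F g)
    (hFγ : ∀ (c : ℤ × ℤ) (x y : ℝ), |x - c.1| ≤ 4 → |y - c.2| ≤ 4 → γ c ≤ F (phT Q (x, y)))
    (u : ℝ) (hu : 0 < u) (hu1 : u < 1) (L w : ℝ) (hL : 0 < L) (hw : 0 < w) (m m' : ℕ) (hm : m ≤ 3 * L) (hm' : m' ≤ 3 * w)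
    (e1 e2 : ℤ) (he1 : e1 = 1 ∨ e1 = -1) (he2 : e2 = 1 ∨ e2 = -1) (a : ℤ × ℤ) (z : TT)
    (hz : z ∈ Metric.closedBall (phT Q (a.1, a.2)) (1 / (4 * Q))) :
    gsum γ u m m' e1 e2 a ≤ Real.exp 6 * (L * w) *
      AA (phT Q) ((e1:ℝ) • (L, L * u)) (AA (phT Q) ((e2:ℝ) • (0, w)) F) z := by
  have hQ' : (0:ℝ) < Q := by exact_mod_cast hQ
  obtain ⟨x, y, hx, hy, rfl⟩ : ∃ x y : ℝ, |x - a.1| ≤ 1/4 ∧ |y - a.2| ≤ 1/4 ∧ z = phT Q (x, y) := by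
    rw [mem_closedBall_iff_norm, Prod.norm_def] at hz
    obtain ⟨x, hx1, hx2⟩ := cn_rep (z - phT Q (a.1, a.2)).1
    obtain ⟨y, hy1, hy2⟩ := cn_rep (z - phT Q (a.1, a.2)).2
    refine ⟨a.1 + Q * x, a.2 + Q * y, ?_, ?_, ?_⟩
    · rw [add_sub_cancel_left, abs_mul, abs_of_pos hQ', hx2]
      calc _ ≤ (Q:ℝ) * (1 / (4 * Q)) := by gcongr; exact (le_max_left _ _).trans hz
        _ = _ := by field_simp
    · rw [add_sub_cancel_left, abs_mul, abs_of_pos hQ', hy2]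
      calc _ ≤ (Q:ℝ) * (1 / (4 * Q)) := by gcongr; exact (le_max_right _ _).trans hz
        _ = _ := by field_simp
    · have e : phT Q (a.1 + Q * x, a.2 + Q * y) = phT Q (a.1, a.2) + ((x : UnitAddCircle), (y : UnitAddCircle)) := by
        rw [phT_apply, phT_apply]; simp [add_div, hQ'.ne']
      rw [e, hx1, hy1]; exact (add_sub_cancel (phT Q (a.1, a.2)) z).symm
  set H := AA (phT Q) ((e2:ℝ) • (0, w)) F
  have hH : ∀ g, 0 ≤ H g := fun g => by
    have := AA_mono (phT Q) ((e2:ℝ) • (0, w)) (f := 0) (h := F) hF g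
    rwa [map_zero] at this
  have a1 : |(e1:ℝ)| = 1 := by rcases he1 with rfl | rfl <;> simp
  have a2 : |(e2:ℝ)| = 1 := by rcases he2 with rfl | rfl <;> simp
  have inner : ∀ i < m, ∀ s ∈ Icc (i:ℝ) (i + 1), (Real.exp 3 * w)⁻¹ * ∑ j ∈ Finset.range m', γ (a.1 + e1 * i, a.2 + ⌊u * (e1 * i)⌋ + e2 * j)
      ≤ H (phT Q (x, y) + phT Q (s • (e1:ℝ) • (1, u))) := by
    intro i hi s hs
    rw [inv_mul_le_iff₀ (by positivity)]
    have := sumlow (phT Q) F hF ((e2:ℝ) • (0, 1)) (phT Q (x, y) + phT Q (s • (e1:ℝ) • (1, u))) hw m' hm'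
      (fun j => γ (a.1 + e1 * i, a.2 + ⌊u * (e1 * i)⌋ + e2 * j)) (fun j => hγ _) ?_
    · refine this.trans (le_of_eq ?_)
      congr 3; ext; simp [mul_comm]
    intro j hj t ht
    rw [← map_add, ← map_add]
    have b1 : |(e1:ℝ) * (s - i)| ≤ 1 := by
      rw [abs_mul, a1, one_mul, abs_le]; constructor <;> linarith [hs.1, hs.2]
    have b2 : |(e2:ℝ) * (t - j)| ≤ 1 := by
      rw [abs_mul, a2, one_mul, abs_le]; constructor <;> linarith [ht.1, ht.2]
    have b3 : |u * ((e1:ℝ) * (s - i))| ≤ 1 := by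
      rw [abs_mul, abs_of_pos hu]; nlinarith [abs_nonneg ((e1:ℝ) * (s - i))]
    have b4 := Int.floor_le (u * (e1 * i))
    have b5 := Int.lt_floor_add_one (u * (e1 * i))
    rw [abs_le] at b1 b2 b3 hx hy
    refine hFγ _ _ _ ?_ ?_
    · push_cast
      simp only [Prod.fst_add, Prod.smul_fst, smul_eq_mul, mul_zero, add_zero]
      rw [abs_le]; constructor <;> nlinarith
    · push_cast
      simp only [Prod.snd_add, Prod.smul_snd, smul_eq_mul]
      rw [abs_le]; constructor <;> nlinarith
  have := sumlow (phT Q) H hH ((e1:ℝ) • (1, u)) (phT Q (x, y)) hL m hm _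
    (fun i => mul_nonneg (by positivity) (Finset.sum_nonneg fun j _ => hγ _)) inner
  rw [← Finset.mul_sum, inv_mul_le_iff₀ (by positivity), smul_comm L] at this
  refine this.trans (le_of_eq ?_)
  rw [show (6:ℝ) = 3 + 3 by norm_num, Real.exp_add, show L • ((1:ℝ), u) = (L, L * u) by simp]; ring

lemma bump (Q : ℕ) (hQ : 0 < Q) (γ : ℤ × ℤ → ℝ) (hγ : ∀ a, 0 ≤ γ a) (B : Finset (ℤ × ℤ)) (hB : ∀ a, a ∉ B → γ a = 0)
    {q : ℝ} (hq : 1 < q) {δ : ℝ} (hδ : 0 < δ) : ∃ F : C(TT, ℝ), (∀ g, 0 < F g) ∧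
      (∀ (c : ℤ × ℤ) (x y : ℝ), |x - c.1| ≤ 4 → |y - c.2| ≤ 4 → γ c ≤ F (phT Q (x, y))) ∧
      ∫ g, F g ^ q ∂νT ≤ δ + 100 / Q ^ 2 * ∑ a ∈ B, γ a ^ q := by
  have hQ' : (0:ℝ) < Q := by exact_mod_cast hQ
  have hq0 : 0 < q := by linarith
  let P : C(TT, ℝ) := ⟨fun z => δ + ∑ c ∈ B, γ c ^ q * (et Q (z - phT Q (c.1, c.2)).1 * et Q (z - phT Q (c.1, c.2)).2), by fun_prop⟩
  have hPe : ∀ z, P z = δ + ∑ c ∈ B, γ c ^ q * (et Q (z - phT Q (c.1, c.2)).1 * et Q (z - phT Q (c.1, c.2)).2) := fun z => rfl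
  have hterm : ∀ z, ∀ c ∈ B, 0 ≤ γ c ^ q * (et Q (z - phT Q (c.1, c.2)).1 * et Q (z - phT Q (c.1, c.2)).2) := fun z c _ =>
    mul_nonneg (Real.rpow_nonneg (hγ c) _) (mul_nonneg (et_nn _ _) (et_nn _ _))
  have hP : ∀ z, 0 < P z := fun z => by rw [hPe]; linarith [Finset.sum_nonneg (hterm z)]
  refine ⟨cpow P (1 / q), fun g => by rw [cpow_pos P hP]; exact Real.rpow_pos_of_pos (hP g) _, ?_, ?_⟩
  · intro c x y hx hy
    rw [cpow_pos P hP]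
    by_cases hc : c ∈ B
    swap
    · rw [hB c hc]; exact Real.rpow_nonneg (hP _).le _
    rw [one_div, Real.le_rpow_inv_iff_of_pos (hγ c) (hP _).le hq0, hPe]
    have h1 := Finset.single_le_sum (hterm (phT Q (x, y))) hc
    rw [← map_sub, phT_apply] at h1
    simp only [Prod.fst_sub, Prod.snd_sub] at h1
    rw [et_one _ hQ' _ hx, et_one _ hQ' _ hy, mul_one, mul_one] at h1
    simp only [Prod.fst_sub, Prod.snd_sub]
    linarith
  · have e : ∀ g, cpow P (1 / q) g ^ q = P g := fun g => by
      rw [cpow_pos P hP, ← Real.rpow_mul (hP g).le, one_div, inv_mul_cancel₀ hq0.ne', Real.rpow_one]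
    simp_rw [e, hPe]
    have hi : ∀ c ∈ B, Integrable (fun z : TT => γ c ^ q * (et Q (z - phT Q (c.1, c.2)).1 * et Q (z - phT Q (c.1, c.2)).2)) νT :=
      fun c _ => C_int νT ⟨fun z : TT => γ c ^ q * (et Q (z - phT Q (c.1, c.2)).1 * et Q (z - phT Q (c.1, c.2)).2), by fun_prop⟩
    rw [integral_add (integrable_const _) (integrable_finsetSum _ hi), integral_finsetSum _ hi]
    simp only [integral_const, probReal_univ, one_smul]
    gcongr
    rw [Finset.mul_sum]
    refine Finset.sum_le_sum fun c _ => ?_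
    rw [integral_const_mul, integral_sub_right_eq_self (fun z : TT => et Q z.1 * et Q z.2), mul_comm]
    refine mul_le_mul_of_nonneg_right ?_ (Real.rpow_nonneg (hγ c) _)
    rw [integral_prod_mul (fun z => et Q z) (fun z => et Q z)]
    have h1 := et_int Q hQ'
    calc _ ≤ 10 / (Q:ℝ) * (10 / Q) := mul_le_mul h1 h1 (integral_nonneg fun z => et_nn _ _) (by positivity)
      _ = _ := by ring

/-- the discrete maximal inequality -/
theorem disc {p : ℝ} (hp : 1 < p) (u : ℕ → ℝ) (hu : ∀ k, 0 < u k) (hu1 : ∀ k, u k < 1)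
    (hlac : ∃ l ∈ Set.Ioo (0 : ℝ) 1, ∀ k, u (k + 1) ≤ l * u k) :
    ∃ q C, 1 < q ∧ q < p ∧ 0 ≤ C ∧ ∀ (N : ℕ) (k : ℕ → ℕ) (L w : ℕ → ℝ) (m m' : ℕ → ℕ), (∀ n, 1 ≤ L n) → (∀ n, 1 ≤ w n) →
      (∀ n, m n ≤ 3 * L n) → (∀ n, m' n ≤ 3 * w n) → ∀ (Q : ℕ), 0 < Q → ∀ γ : ℤ × ℤ → ℝ, (∀ a, 0 ≤ γ a) →
      (∀ a, a ∉ Finset.Ico (0:ℤ) Q ×ˢ Finset.Ico (0:ℤ) Q → γ a = 0) → ∀ σ : ℤ × ℤ → ℕ, (∀ a, σ a < N) → 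
      ∑ a ∈ Finset.Ico (0:ℤ) Q ×ˢ Finset.Ico (0:ℤ) Q, ((L (σ a) * w (σ a))⁻¹ *
        ∑ e ∈ ({1, -1} : Finset ℤ) ×ˢ ({1, -1} : Finset ℤ), gsum γ (u (k (σ a))) (m (σ a)) (m' (σ a)) e.1 e.2 a) ^ q ≤
      C * ∑ a ∈ Finset.Ico (0:ℤ) Q ×ˢ Finset.Ico (0:ℤ) Q, γ a ^ q := by
  obtain ⟨q, D, hq, hqp, hD, hbig⟩ := bigmax νT hp u hu hlac
  have hq0 : 0 < q := by linarith
  set K := (8 * Real.exp 6) ^ q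
  have hK : 0 < K := by positivity
  refine ⟨q, 4 * K * D * 100, hq, hqp, by positivity, ?_⟩
  intro N k L w m m' hL hw hm hm' Q hQ γ hγ hγB σ hσ
  set B := Finset.Ico (0:ℤ) Q ×ˢ Finset.Ico (0:ℤ) Q
  have hQ' : (0:ℝ) < Q := by exact_mod_cast hQ
  refine le_of_forall_pos_le_add fun ε hε => ?_
  obtain ⟨F, hF, hFγ, hFi⟩ := bump Q hQ γ hγ B hγB hq (show 0 < ε / (4 * K * D * Q ^ 2 + 1) by positivity)
  obtain ⟨Z, hZ, hZi, hZm⟩ := hbig (phT Q) N k L w hL (fun n => by linarith [hw n]) F hF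
  set c : ℤ × ℤ → ℝ := fun a => ((L (σ a) * w (σ a))⁻¹ *
        ∑ e ∈ ({1, -1} : Finset ℤ) ×ˢ ({1, -1} : Finset ℤ), gsum γ (u (k (σ a))) (m (σ a)) (m' (σ a)) e.1 e.2 a) with hc
  have hc0 : ∀ a, 0 ≤ c a := fun a => mul_nonneg (inv_nonneg.2 (mul_nonneg (by linarith [hL (σ a)]) (by linarith [hw (σ a)])))
    (Finset.sum_nonneg fun e _ => Finset.sum_nonneg fun i _ => Finset.sum_nonneg fun j _ => hγ _)
  set Bl : ℤ × ℤ → Set TT := fun a => Metric.closedBall (phT Q (a.1, a.2)) (1 / (4 * Q))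
  have pw : ∀ a, ∀ z ∈ Bl a, c a ^ q ≤ K * Z z ^ q := by
    intro a z hz
    have hLp : 0 < L (σ a) := by linarith [hL (σ a)]
    have hwp : 0 < w (σ a) := by linarith [hw (σ a)]
    rw [← Real.mul_rpow (by positivity) (hZ z).le]
    refine Real.rpow_le_rpow (hc0 a) ?_ hq0.le
    rw [hc]
    simp only
    rw [inv_mul_le_iff₀ (by positivity)]
    have h1 : ∀ e ∈ ({1, -1} : Finset ℤ) ×ˢ ({1, -1} : Finset ℤ), gsum γ (u (k (σ a))) (m (σ a)) (m' (σ a)) e.1 e.2 a ≤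
        Real.exp 6 * (L (σ a) * w (σ a)) * (2 * Z z) := by
      intro e he
      simp only [Finset.mem_product, Finset.mem_insert, Finset.mem_singleton] at he
      refine (gsum_le Q hQ γ hγ F (fun g => (hF g).le) hFγ _ (hu _) (hu1 _) (L (σ a)) (w (σ a)) hLp hwp _ _ (hm _) (hm' _)
        e.1 e.2 he.1 he.2 a z hz).trans ?_
      refine mul_le_mul_of_nonneg_left (hZm _ (hσ a) _ _ ?_ ?_ z) (by positivity)
      · rcases he.1 with h | h <;> simp [h]
      · rcases he.2 with h | h <;> simp [h]
    refine (Finset.sum_le_sum h1).trans (le_of_eq ?_)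
    rw [Finset.sum_const, show (({1, -1} : Finset ℤ) ×ˢ ({1, -1} : Finset ℤ)).card = 4 from rfl]
    simp only [nsmul_eq_mul]; push_cast; ring
  have hZint : Integrable (fun z => K * Z z ^ q) νT := (pow_int νT hZ q).const_mul _
  have hZ0 : ∀ z, 0 ≤ K * Z z ^ q := fun z => mul_nonneg hK.le (Real.rpow_nonneg (hZ z).le _)
  have h1 : ∑ a ∈ B, c a ^ q * (1 / (2 * Q)) ^ 2 ≤ K * ∫ z, Z z ^ q ∂νT := by
    rw [← integral_const_mul]
    calc _ ≤ ∑ a ∈ B, ∫ z in Bl a, K * Z z ^ q ∂νT := Finset.sum_le_sum fun a _ => by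
          have : ∫ z in Bl a, c a ^ q ∂νT = c a ^ q * (1 / (2 * Q)) ^ 2 := by
            rw [setIntegral_const, ball_vol _ _ (by exact_mod_cast hQ), smul_eq_mul, mul_comm]
          rw [← this]
          exact setIntegral_mono_on (integrable_const _) hZint.integrableOn Metric.isClosed_closedBall.measurableSet (pw a)
      _ = ∫ z in ⋃ a ∈ B, Bl a, K * Z z ^ q ∂νT := (integral_biUnion_finset B (fun a _ => Metric.isClosed_closedBall.measurableSet)
          (fun a ha b hb hab => ball_disj Q hQ a b ha hb hab) (fun a _ => hZint.integrableOn)).symm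
      _ ≤ _ := setIntegral_le_integral hZint (Eventually.of_forall hZ0)
  rw [← Finset.sum_mul] at h1
  have h2 : ∑ a ∈ B, c a ^ q ≤ 4 * Q ^ 2 * (K * (D * (ε / (4 * K * D * Q ^ 2 + 1) + 100 / Q ^ 2 * ∑ a ∈ B, γ a ^ q))) := by
    have h3 := h1.trans (mul_le_mul_of_nonneg_left (hZi.trans (mul_le_mul_of_nonneg_left hFi hD)) hK.le)
    have h4 := mul_le_mul_of_nonneg_left h3 (show (0:ℝ) ≤ 4 * Q ^ 2 by positivity)
    refine le_trans (le_of_eq ?_) h4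
    field_simp; ring
  refine h2.trans ?_
  have h5 : (4 * K * D * Q ^ 2) * (ε / (4 * K * D * Q ^ 2 + 1)) ≤ ε := by
    rw [← mul_div_assoc, div_le_iff₀ (by positivity)]; nlinarith
  have h6 : 4 * (Q:ℝ) ^ 2 * (K * (D * (100 / Q ^ 2 * ∑ a ∈ B, γ a ^ q))) = 4 * K * D * 100 * ∑ a ∈ B, γ a ^ q := by
    field_simp
  rw [← h6]
  linarith
end P15

section P16
lemma carrier_iff (R : Rect) : ∃ Cx Cy : ℝ, ∀ x y : ℝ, (x, y) ∈ R.carrier ↔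
    |Real.cos R.angle * (x - Cx) + Real.sin R.angle * (y - Cy)| ≤ R.len1 / 2 ∧
    |-Real.sin R.angle * (x - Cx) + Real.cos R.angle * (y - Cy)| ≤ R.len2 / 2 := by
  have h1 := Real.sin_sq_add_cos_sq R.angle
  set s := Real.sin R.angle with hs
  set c := Real.cos R.angle with hc
  refine ⟨R.corner.1 + R.len1 / 2 * c - R.len2 / 2 * s, R.corner.2 + R.len1 / 2 * s + R.len2 / 2 * c, fun x y => ?_⟩
  simp only [Rect.carrier, Set.mem_ofPred_eq, Prod.ext_iff, Prod.fst_add, Prod.snd_add, Prod.smul_fst, Prod.smul_snd, smul_eq_mul]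
  rw [← hs, ← hc]
  constructor
  · rintro ⟨a, b, ha, hb, rfl, rfl⟩
    constructor
    · rw [show c * (R.corner.1 + a * c + b * -s - (R.corner.1 + R.len1 / 2 * c - R.len2 / 2 * s)) +
        s * (R.corner.2 + a * s + b * c - (R.corner.2 + R.len1 / 2 * s + R.len2 / 2 * c)) = (a - R.len1 / 2) * (s ^ 2 + c ^ 2) by ring, h1, abs_le]
      constructor <;> linarith [ha.1, ha.2]
    · rw [show -s * (R.corner.1 + a * c + b * -s - (R.corner.1 + R.len1 / 2 * c - R.len2 / 2 * s)) +
        c * (R.corner.2 + a * s + b * c - (R.corner.2 + R.len1 / 2 * s + R.len2 / 2 * c)) = (b - R.len2 / 2) * (s ^ 2 + c ^ 2) by ring, h1, abs_le]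
      constructor <;> linarith [hb.1, hb.2]
  · rintro ⟨ha, hb⟩
    rw [abs_le] at ha hb
    refine ⟨c * (x - (R.corner.1 + R.len1 / 2 * c - R.len2 / 2 * s)) + s * (y - (R.corner.2 + R.len1 / 2 * s + R.len2 / 2 * c)) + R.len1 / 2,
      -s * (x - (R.corner.1 + R.len1 / 2 * c - R.len2 / 2 * s)) + c * (y - (R.corner.2 + R.len1 / 2 * s + R.len2 / 2 * c)) + R.len2 / 2, ⟨by linarith [ha.1], by linarith [ha.2]⟩, ⟨by linarith [hb.1], by linarith [hb.2]⟩, ?_, ?_⟩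
    · linear_combination (R.corner.1 + R.len1 / 2 * c - R.len2 / 2 * s - x) * h1
    · linear_combination (R.corner.2 + R.len1 / 2 * s + R.len2 / 2 * c - y) * h1

lemma rect_form (R : Rect) {u : ℝ} (hu : 0 < u) (h : R.slope = u) : ∃ Cx Cy c : ℝ, c ^ 2 * (1 + u ^ 2) = 1 ∧
    ∀ x y : ℝ, (x, y) ∈ R.carrier ↔ |c| * |(x - Cx) + u * (y - Cy)| ≤ R.longSide / 2 ∧
      |c| * |(y - Cy) - u * (x - Cx)| ≤ R.shortSide / 2 := by
  obtain ⟨Cx, Cy, hC⟩ := carrier_iff R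
  have tn : ∀ a : ℝ, Real.tan a = u → Real.sin a = u * Real.cos a := fun a ha => by
    rw [Real.tan_eq_sin_div_cos] at ha
    have : Real.cos a ≠ 0 := by intro h0; rw [h0, div_zero] at ha; linarith
    field_simp at ha; linarith
  unfold Rect.slope at h
  split_ifs at h with hl
  · have hs := tn _ h
    refine ⟨Cx, Cy, Real.cos R.angle, by have := Real.sin_sq_add_cos_sq R.angle; rw [hs] at this; linarith, fun x y => ?_⟩
    rw [hC, Rect.longSide, Rect.shortSide, max_eq_left hl, min_eq_right hl, hs, ← abs_mul, ← abs_mul]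
    ring_nf
  · have hs := tn _ h
    rw [Real.sin_add_pi_div_two, Real.cos_add_pi_div_two] at hs
    have hl' : R.len1 ≤ R.len2 := (not_le.1 hl).le
    refine ⟨Cx, Cy, Real.sin R.angle, by have := Real.sin_sq_add_cos_sq R.angle; rw [hs] at this; linarith, fun x y => ?_⟩
    rw [hC, Rect.longSide, Rect.shortSide, max_eq_right hl', min_eq_left hl', hs, ← abs_mul, ← abs_mul, and_comm,
      ← abs_neg (-Real.sin R.angle * (x - Cx) + _)]
    ring_nf

lemma rect_sub (R : Rect) {u : ℝ} (hu : 0 < u) (hu1 : u < 1) (h : R.slope = u) (h0 : ((0:ℝ), (0:ℝ)) ∈ R.carrier) {x y : ℝ}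
    (hxy : (x, y) ∈ R.carrier) : |x| ≤ 2 * R.longSide ∧ |y - u * x| ≤ 2 * R.shortSide := by
  obtain ⟨Cx, Cy, c, hc, hC⟩ := rect_form R hu h
  obtain ⟨a1, a2⟩ := (hC 0 0).1 h0
  obtain ⟨b1, b2⟩ := (hC x y).1 hxy
  have hS : R.shortSide ≤ R.longSide := min_le_max
  have hS0 : 0 < R.shortSide := lt_min R.len1_pos R.len2_pos
  have hcc : |c| ^ 2 * (1 + u ^ 2) = 1 := by rw [sq_abs]; exact hc
  set d := |c|
  have hd0 : 0 ≤ d := abs_nonneg c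
  have hd1 : d ≤ 1 := by nlinarith [sq_nonneg (d * u)]
  have hd2 : 1 ≤ 2 * d := by 
    have : u ^ 2 ≤ 1 := by nlinarith
    nlinarith [sq_nonneg d, mul_le_mul_of_nonneg_left this (sq_nonneg d)]
  have e1 : d * |x + u * y| ≤ R.longSide := by
    have := abs_sub (x - Cx + u * (y - Cy)) (0 - Cx + u * (0 - Cy))
    rw [show x - Cx + u * (y - Cy) - (0 - Cx + u * (0 - Cy)) = x + u * y by ring] at this
    nlinarith
  have e2 : d * |y - u * x| ≤ R.shortSide := by
    have := abs_sub (y - Cy - u * (x - Cx)) (0 - Cy - u * (0 - Cx))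
    rw [show y - Cy - u * (x - Cx) - (0 - Cy - u * (0 - Cx)) = y - u * x by ring] at this
    nlinarith
  refine ⟨?_, by nlinarith [abs_nonneg (y - u * x)]⟩
  have e3 : |x| * (1 + u ^ 2) ≤ |x + u * y| + u * |y - u * x| := by
    have := abs_sub (x + u * y) (u * (y - u * x))
    rw [show x + u * y - u * (y - u * x) = x * (1 + u ^ 2) by ring, abs_mul, abs_of_pos (show 0 < 1 + u ^ 2 by positivity), abs_mul, abs_of_pos hu] at this
    exact this
  have e4 := mul_le_mul_of_nonneg_left e3 (sq_nonneg d)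
  rw [show d ^ 2 * (|x| * (1 + u ^ 2)) = |x| * (d ^ 2 * (1 + u ^ 2)) by ring, hcc, mul_one] at e4
  have e5 : d ^ 2 * (|x + u * y| + u * |y - u * x|) = d * (d * |x + u * y| + u * (d * |y - u * x|)) := by ring
  have e6 : d * |x + u * y| + u * (d * |y - u * x|) ≤ 2 * R.longSide := by nlinarith
  have e7 : 0 ≤ d * |x + u * y| + u * (d * |y - u * x|) := by positivity
  rw [e5] at e4
  nlinarith

lemma rect_fin (R : Rect) {u : ℝ} (hu : 0 < u) (hu1 : u < 1) (h : R.slope = u) (h0 : ((0:ℝ), (0:ℝ)) ∈ R.carrier) :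
    (latticePts R.carrier).Finite := by
  set B : ℤ := ⌈2 * R.longSide + 2 * R.shortSide⌉
  refine ((Finset.Icc (-B) B ×ˢ Finset.Icc (-B) B).finite_toSet).subset fun p hp => ?_
  obtain ⟨h1, h2⟩ := rect_sub R hu hu1 h h0 hp
  have hB : 2 * R.longSide + 2 * R.shortSide ≤ B := Int.le_ceil _
  have h3 : |(p.2:ℝ)| ≤ B := by
    have := abs_add_le ((p.2:ℝ) - u * p.1) (u * p.1)
    rw [sub_add_cancel, abs_mul, abs_of_pos hu] at this
    nlinarith [abs_nonneg (p.1:ℝ)]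
  have h4 : |(p.1:ℝ)| ≤ B := by linarith [lt_min R.len1_pos R.len2_pos, show R.shortSide = min R.len1 R.len2 from rfl]
  rw [abs_le] at h3 h4
  simp only [Finset.coe_product, Finset.coe_Icc, mem_prod, mem_Icc]
  constructor
  · exact_mod_cast h4
  · exact_mod_cast h3

lemma rect_count (R : Rect) {u : ℝ} (hu : 0 < u) (hu1 : u < 1) (h : R.slope = u) (h0 : ((0:ℝ), (0:ℝ)) ∈ R.carrier)
    (h8 : 8 ≤ R.shortSide) : R.longSide * R.shortSide ≤ 64 * latticeCount R.carrier := by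
  obtain ⟨Cx, Cy, c, hc, hC⟩ := rect_form R hu h
  have hS : R.shortSide ≤ R.longSide := min_le_max
  set L := R.longSide
  set w := R.shortSide
  have hcc : |c| ^ 2 * (1 + u ^ 2) = 1 := by rw [sq_abs]; exact hc
  have hd0 : 0 ≤ |c| := abs_nonneg c
  have hd1 : |c| ≤ 1 := by nlinarith [sq_nonneg (|c| * u)]
  let ψ : ℕ × ℕ → ℤ × ℤ := fun t => (⌈Cx - L / 8⌉ + t.1, ⌈Cy + u * (((⌈Cx - L / 8⌉ + t.1 : ℤ) : ℝ) - Cx) - w / 8⌉ + t.2)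
  have hψ : Function.Injective ψ := by
    rintro ⟨a, b⟩ ⟨a', b'⟩ hab
    simp only [ψ, Prod.mk.injEq] at hab
    have : a = a' := by omega
    subst this
    have : b = b' := by omega
    rw [this]
  have hfl : ∀ t : ℝ, 8 ≤ t → t / 8 ≤ (⌊t / 4⌋₊ : ℝ) ∧ (⌊t / 4⌋₊ : ℝ) ≤ t / 4 := fun t ht =>
    ⟨by linarith [Nat.lt_floor_add_one (t / 4)], Nat.floor_le (by linarith)⟩
  obtain ⟨f1, f2⟩ := hfl L (by linarith)
  obtain ⟨g1, g2⟩ := hfl w h8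
  have hsub : ((((Finset.range ⌊L / 4⌋₊ ×ˢ Finset.range ⌊w / 4⌋₊).image ψ : Finset (ℤ × ℤ)) : Set (ℤ × ℤ))) ⊆ latticePts R.carrier := by
    intro p hp
    simp only [Finset.coe_image, mem_image, Finset.mem_coe, Finset.mem_product, Finset.mem_range] at hp
    obtain ⟨⟨a, b⟩, ⟨ha, hb⟩, rfl⟩ := hp
    simp only at ha hb
    have ha' : (a:ℝ) + 1 ≤ ⌊L / 4⌋₊ := by exact_mod_cast ha
    have hb' : (b:ℝ) + 1 ≤ ⌊w / 4⌋₊ := by exact_mod_cast hb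
    refine (hC _ _).2 ?_
    simp only [ψ]
    set i : ℤ := ⌈Cx - L / 8⌉ + a with hi
    have c1 := Int.le_ceil (Cx - L / 8)
    have c2 := Int.ceil_lt_add_one (Cx - L / 8)
    have d1 := Int.le_ceil (Cy + u * ((i:ℝ) - Cx) - w / 8)
    have d2 := Int.ceil_lt_add_one (Cy + u * ((i:ℝ) - Cx) - w / 8)
    have hiR : (i:ℝ) = ⌈Cx - L / 8⌉ + a := by rw [hi]; push_cast; ring
    have X : |(i:ℝ) - Cx| ≤ L / 8 := by rw [abs_le]; constructor <;> linarith [Nat.cast_nonneg (α := ℝ) a]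
    push_cast
    set j := (⌈Cy + u * ((i:ℝ) - Cx) - w / 8⌉ : ℝ) + b
    have Y : |j - Cy - u * ((i:ℝ) - Cx)| ≤ w / 8 := by rw [abs_le]; constructor <;> linarith [Nat.cast_nonneg (α := ℝ) b]
    constructor
    · have := abs_add_le (((i:ℝ) - Cx) * (1 + u ^ 2)) (u * (j - Cy - u * ((i:ℝ) - Cx)))
      rw [show ((i:ℝ) - Cx) * (1 + u ^ 2) + u * (j - Cy - u * ((i:ℝ) - Cx)) = (i:ℝ) - Cx + u * (j - Cy) by ring, abs_mul, abs_mul,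
        abs_of_pos hu, abs_of_pos (show 0 < 1 + u ^ 2 by positivity)] at this
      have h1 : |(i:ℝ) - Cx| * (1 + u ^ 2) ≤ L / 8 * 2 := mul_le_mul X (by nlinarith) (by positivity) (by linarith)
      have h2 : u * |j - Cy - u * ((i:ℝ) - Cx)| ≤ 1 * (w / 8) := mul_le_mul hu1.le Y (abs_nonneg _) (by norm_num)
      have h3 := mul_le_mul_of_nonneg_right hd1 (abs_nonneg ((i:ℝ) - Cx + u * (j - Cy)))
      linarith
    · have h3 := mul_le_mul_of_nonneg_right hd1 (abs_nonneg (j - Cy - u * ((i:ℝ) - Cx)))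
      linarith
  have hn := Set.ncard_le_ncard hsub (rect_fin R hu hu1 h h0)
  rw [Set.ncard_coe_finset, Finset.card_image_of_injective _ hψ, Finset.card_product, Finset.card_range, Finset.card_range] at hn
  have hn' : (⌊L / 4⌋₊ : ℝ) * ⌊w / 4⌋₊ ≤ latticeCount R.carrier := by exact_mod_cast hn
  have := mul_le_mul f1 g1 (by linarith) (by positivity)
  linarith

lemma sum_gsum (R : Rect) {u : ℝ} (hu : 0 < u) (hu1 : u < 1) (h : R.slope = u) (h0 : ((0:ℝ), (0:ℝ)) ∈ R.carrier)
    (γ : ℤ × ℤ → ℝ) (hγ : ∀ a, 0 ≤ γ a) (a : ℤ × ℤ) (P : Finset (ℤ × ℤ)) (hP : ∀ p ∈ P, p ∈ latticePts R.carrier) :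
    ∑ p ∈ P, γ (a.1 + p.1, a.2 + p.2) ≤ ∑ e ∈ ({1, -1} : Finset ℤ) ×ˢ ({1, -1} : Finset ℤ),
      gsum γ u (⌊2 * R.longSide⌋₊ + 1) (⌊2 * R.shortSide⌋₊ + 2) e.1 e.2 a := by
  set m := ⌊2 * R.longSide⌋₊ + 1
  set m' := ⌊2 * R.shortSide⌋₊ + 2
  let ψ : (ℤ × ℤ) × ℕ × ℕ → ℤ × ℤ := fun t => (t.1.1 * t.2.1, ⌊u * (t.1.1 * t.2.1)⌋ + t.1.2 * t.2.2)
  set E := (({1, -1} : Finset ℤ) ×ˢ ({1, -1} : Finset ℤ)) ×ˢ (Finset.range m ×ˢ Finset.range m')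
  have sg : ∀ i : ℤ, ∃ e ∈ ({1, -1} : Finset ℤ), i = e * i.natAbs := by
    intro i
    rcases Int.natAbs_eq i with h | h
    · exact ⟨1, by simp, by omega⟩
    · exact ⟨-1, by simp, by omega⟩
  have hsub : P ⊆ E.image ψ := by
    intro p hp
    obtain ⟨h1, h2⟩ := rect_sub R hu hu1 h h0 (hP p hp)
    obtain ⟨e1, he1, h3⟩ := sg p.1
    obtain ⟨e2, he2, h4⟩ := sg (p.2 - ⌊u * p.1⌋)
    refine Finset.mem_image.2 ⟨((e1, e2), (p.1.natAbs, (p.2 - ⌊u * p.1⌋).natAbs)), ?_, ?_⟩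
    · simp only [E, Finset.mem_product, Finset.mem_range]
      refine ⟨⟨he1, he2⟩, ?_, ?_⟩
      · refine Nat.lt_succ_of_le (Nat.le_floor ?_)
        rw [Nat.cast_natAbs]; push_cast; exact h1
      · have : (p.2 - ⌊u * p.1⌋).natAbs ≤ ⌊2 * R.shortSide + 1⌋₊ := by
          refine Nat.le_floor ?_
          rw [Nat.cast_natAbs]; push_cast
          have b4 := Int.floor_le (u * (p.1:ℝ))
          have b5 := Int.lt_floor_add_one (u * (p.1:ℝ))
          rw [abs_le] at h2 ⊢
          constructor <;> linarith [h2.1, h2.2]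
        rw [Nat.floor_add_one (by have := (abs_nonneg _).trans h2; exact this)] at this
        omega
    · simp only [ψ]
      have h3' : (e1:ℝ) * (p.1.natAbs : ℝ) = p.1 := by rw [Nat.cast_natAbs]; exact_mod_cast h3.symm
      rw [h3', ← h3, ← h4]; ext <;> simp
  calc _ ≤ ∑ p ∈ E.image ψ, γ (a.1 + p.1, a.2 + p.2) := Finset.sum_le_sum_of_subset_of_nonneg hsub fun _ _ _ => hγ _
    _ ≤ ∑ t ∈ E, γ (a.1 + (ψ t).1, a.2 + (ψ t).2) := Finset.sum_image_le_of_nonneg (f := fun p : ℤ × ℤ => γ (a.1 + p.1, a.2 + p.2)) fun _ _ => hγ _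
    _ = _ := by
      simp only [E, Finset.sum_product, gsum, ψ, add_assoc]
end P16

section P17
def VV (S T : X ≃ᵐ X) (a : ℤ × ℤ) (x : X) : X := (S.toEquiv ^ a.1) ((T.toEquiv ^ a.2) x)

def AV (S T : X ≃ᵐ X) (P : Finset (ℤ × ℤ)) (f : X → ℝ) (x : X) : ℝ := (P.card : ℝ)⁻¹ * ∑ p ∈ P, f (VV S T p x)

lemma ergAvg_eq (S T : X ≃ᵐ X) (R : Rect) (hfin : (latticePts R.carrier).Finite) (f : X → ℝ) (x : X) :
    ergAvg S T R f x = AV S T hfin.toFinset f x := by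
  rw [ergAvg, AV, latticeCount, Set.ncard_eq_toFinset_card _ hfin, finsum_mem_eq_finite_toFinset_sum _ hfin]
  rfl

lemma mp_zpow (μ : Measure X) (S : X ≃ᵐ X) (hS : MeasurePreserving S μ μ) (n : ℤ) :
    MeasurePreserving (⇑(S.toEquiv ^ n)) μ μ := by
  have key : ∀ (S : X ≃ᵐ X), MeasurePreserving S μ μ → ∀ n : ℕ, MeasurePreserving (⇑(S.toEquiv ^ n)) μ μ := by
    intro S hS n
    have := hS.iterate n
    rwa [show (⇑S)^[n] = ⇑(S.toEquiv ^ n) from Equiv.Perm.iterate_eq_pow S.toEquiv n] at this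
  rcases Int.eq_nat_or_neg n with ⟨m, rfl | rfl⟩
  · rw [zpow_natCast]; exact key S hS m
  · rw [zpow_neg, zpow_natCast, ← inv_pow]
    exact key S.symm hS.symm m

lemma mp_VV (μ : Measure X) (S T : X ≃ᵐ X) (h : ErgodicSetup μ S T) (a : ℤ × ℤ) : MeasurePreserving (VV S T a) μ μ :=
  (mp_zpow μ S h.measPres_S a.1).comp (mp_zpow μ T h.measPres_T a.2)

lemma VV_add (μ : Measure X) (S T : X ≃ᵐ X) (h : ErgodicSetup μ S T) (a b : ℤ × ℤ) (x : X) :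
    VV S T b (VV S T a x) = VV S T (a.1 + b.1, a.2 + b.2) x := by
  have hc : Commute S.toEquiv T.toEquiv := Equiv.ext fun x => h.comm x
  have h1 := (hc.zpow_zpow a.1 b.2).eq
  have : S.toEquiv ^ b.1 * T.toEquiv ^ b.2 * (S.toEquiv ^ a.1 * T.toEquiv ^ a.2) = S.toEquiv ^ (a.1 + b.1) * T.toEquiv ^ (a.2 + b.2) := by
    rw [mul_assoc, ← mul_assoc (T.toEquiv ^ b.2), ← h1, mul_assoc, ← mul_assoc, ← zpow_add, ← zpow_add, add_comm b.1, add_comm b.2]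
  exact congrArg (fun e : Equiv.Perm X => e x) this

lemma AV_meas (μ : Measure X) (S T : X ≃ᵐ X) (h : ErgodicSetup μ S T) (P : Finset (ℤ × ℤ)) (f : X → ℝ) (hf : Measurable f) :
    Measurable (AV S T P f) :=
  (Finset.measurable_sum _ fun p _ => hf.comp (mp_VV μ S T h p).measurable).const_mul _

lemma trans_weak (μ : Measure X) (S T : X ≃ᵐ X) (hset : ErgodicSetup μ S T) (R : ℕ → Rect) (u : ℕ → ℝ)
    (hu : ∀ k, 0 < u k) (hu1 : ∀ k, u k < 1) (hlac : ∃ l ∈ Set.Ioo (0 : ℝ) 1, ∀ k, u (k + 1) ≤ l * u k)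
    (k : ℕ → ℕ) (hk : ∀ n, (R n).slope = u (k n)) (h0 : ∀ n, ((0 : ℝ), (0 : ℝ)) ∈ (R n).carrier) (h8 : ∀ n, 8 ≤ (R n).shortSide)
    (P : ℕ → Finset (ℤ × ℤ)) (hP : ∀ n p, p ∈ P n ↔ p ∈ latticePts (R n).carrier) (hPc : ∀ n, (P n).card = latticeCount (R n).carrier)
    {p : ℝ} (hp : 1 < p) : ∃ q C, 1 < q ∧ q < p ∧ 0 ≤ C ∧ ∀ (N : ℕ) (h : X → ℝ), Measurable h → (∀ x, 0 ≤ h x) → ∀ lam : ℝ, 0 < lam →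
      ENNReal.ofReal (lam ^ q) * μ {x | ∃ n < N, lam < AV S T (P n) h x} ≤ ENNReal.ofReal C * ∫⁻ x, ENNReal.ofReal (h x ^ q) ∂μ := by
  obtain ⟨q, C, hq, hqp, hC, hdisc⟩ := disc hp u hu hu1 hlac
  have hq0 : 0 < q := by linarith
  refine ⟨q, 4 * (64 ^ q * C), hq, hqp, by positivity, fun N h hm hh lam hlam => ?_⟩
  set E := {x | ∃ n < N, lam < AV S T (P n) h x} with hE
  have hEm : MeasurableSet E := by
    have : E = ⋃ n, ⋃ (_ : n < N), {x | lam < AV S T (P n) h x} := by ext x; simp [hE]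
    rw [this]
    exact MeasurableSet.iUnion fun n => MeasurableSet.iUnion fun _ => measurableSet_lt measurable_const (AV_meas μ S T hset _ _ hm)
  rcases Nat.eq_zero_or_pos N with hN | hN
  · have : E = ∅ := by ext x; simp [hE, hN]
    rw [this]; simp
  obtain ⟨ρ, hρ0, hρ⟩ : ∃ ρ : ℕ, 0 < ρ ∧ ∀ n < N, ∀ p ∈ P n, p.1.natAbs < ρ ∧ p.2.natAbs < ρ := by
    refine ⟨((Finset.range N).biUnion P).sup (fun p => p.1.natAbs + p.2.natAbs) + 1, by omega, fun n hn p hp => ?_⟩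
    have := Finset.le_sup (f := fun p : ℤ × ℤ => p.1.natAbs + p.2.natAbs) (Finset.mem_biUnion.2 ⟨n, Finset.mem_range.2 hn, hp⟩)
    constructor <;> omega
  set Q := 4 * ρ with hQ
  set B := Finset.Ico (0:ℤ) Q ×ˢ Finset.Ico (0:ℤ) Q with hB
  set I := Finset.Ico (ρ:ℤ) (3 * ρ) ×ˢ Finset.Ico (ρ:ℤ) (3 * ρ) with hI
  have hIB : I ⊆ B := Finset.product_subset_product (Finset.Ico_subset_Ico (by omega) (by omega)) (Finset.Ico_subset_Ico (by omega) (by omega))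
  have pw : ∀ x, ∑ a ∈ I, (VV S T a ⁻¹' E).indicator (fun _ => lam ^ q) x ≤ 64 ^ q * C * ∑ a ∈ B, h (VV S T a x) ^ q := by
    intro x
    classical
    let γ : ℤ × ℤ → ℝ := fun a => if a ∈ B then h (VV S T a x) else 0
    have hγ0 : ∀ a, 0 ≤ γ a := fun a => by simp only [γ]; split_ifs; exacts [hh _, le_rfl]
    let σ : ℤ × ℤ → ℕ := fun a => if H : ∃ n < N, lam < AV S T (P n) h (VV S T a x) then H.choose else 0
    have hσ : ∀ a, σ a < N := fun a => by
      simp only [σ]; split_ifs with H; exacts [H.choose_spec.1, hN]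
    have hσ2 : ∀ a, VV S T a x ∈ E → lam < AV S T (P (σ a)) h (VV S T a x) := fun a ha => by
      have H : ∃ n < N, lam < AV S T (P n) h (VV S T a x) := ha
      simp only [σ, dif_pos H]; exact H.choose_spec.2
    have hsl : ∀ n, (R n).shortSide ≤ (R n).longSide := fun n => min_le_max
    have hmain := hdisc N k (fun n => (R n).longSide) (fun n => (R n).shortSide) (fun n => ⌊2 * (R n).longSide⌋₊ + 1)
      (fun n => ⌊2 * (R n).shortSide⌋₊ + 2) (fun n => by linarith [h8 n, hsl n]) (fun n => by linarith [h8 n])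
      (fun n => by have := Nat.floor_le (show 0 ≤ 2 * (R n).longSide by linarith [h8 n, hsl n]); push_cast; linarith [h8 n, hsl n])
      (fun n => by have := Nat.floor_le (show 0 ≤ 2 * (R n).shortSide by linarith [h8 n]); push_cast; linarith [h8 n])
      Q (by omega) γ hγ0 (fun a ha => if_neg ha) σ hσ
    set c : ℤ × ℤ → ℝ := fun a => (((R (σ a)).longSide * (R (σ a)).shortSide)⁻¹ *
        ∑ e ∈ ({1, -1} : Finset ℤ) ×ˢ ({1, -1} : Finset ℤ), gsum γ (u (k (σ a))) (⌊2 * (R (σ a)).longSide⌋₊ + 1)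
          (⌊2 * (R (σ a)).shortSide⌋₊ + 2) e.1 e.2 a) with hc
    have hs0 : ∀ a, 0 ≤ ∑ e ∈ ({1, -1} : Finset ℤ) ×ˢ ({1, -1} : Finset ℤ), gsum γ (u (k (σ a))) (⌊2 * (R (σ a)).longSide⌋₊ + 1)
          (⌊2 * (R (σ a)).shortSide⌋₊ + 2) e.1 e.2 a := fun a =>
      Finset.sum_nonneg fun e _ => Finset.sum_nonneg fun i _ => Finset.sum_nonneg fun j _ => hγ0 _
    have hLw : ∀ n, 0 < (R n).longSide * (R n).shortSide := fun n => mul_pos (by linarith [h8 n, hsl n]) (by linarith [h8 n])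
    have hc0 : ∀ a, 0 ≤ c a := fun a => mul_nonneg (inv_nonneg.2 (hLw _).le) (hs0 a)
    have h1 : ∀ a ∈ I, (VV S T a ⁻¹' E).indicator (fun _ => lam ^ q) x ≤ 64 ^ q * c a ^ q := by
      intro a ha
      by_cases hx : x ∈ VV S T a ⁻¹' E
      swap
      · rw [indicator_of_notMem hx]; exact mul_nonneg (by positivity) (Real.rpow_nonneg (hc0 a) _)
      rw [indicator_of_mem hx, ← Real.mul_rpow (by norm_num) (hc0 a)]
      refine Real.rpow_le_rpow hlam.le ((hσ2 a hx).le.trans ?_) hq0.le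
      set n := σ a
      have e1 : ∑ p ∈ P n, h (VV S T p (VV S T a x)) = ∑ p ∈ P n, γ (a.1 + p.1, a.2 + p.2) := by
        refine Finset.sum_congr rfl fun p hp => ?_
        rw [VV_add μ S T hset]
        have := hρ n (hσ a) p hp
        simp only [hI, Finset.mem_product, Finset.mem_Ico] at ha
        simp only [γ]
        rw [if_pos]
        simp only [hB, Finset.mem_product, Finset.mem_Ico]
        omega
      rw [AV, e1]
      have h2 := sum_gsum (R n) (hu _) (hu1 _) (hk n) (h0 n) γ hγ0 a (P n) (fun p hp => (hP n p).1 hp)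
      have h3 := rect_count (R n) (hu _) (hu1 _) (hk n) (h0 n) (h8 n)
      rw [← hPc] at h3
      have h4 : ((P n).card : ℝ)⁻¹ ≤ 64 * ((R n).longSide * (R n).shortSide)⁻¹ := by
        have hpos : (0:ℝ) < (P n).card := by linarith [hLw n]
        rw [← div_eq_mul_inv, inv_eq_one_div, div_le_div_iff₀ hpos (hLw n)]; linarith
      calc _ ≤ _ := mul_le_mul h4 h2 (Finset.sum_nonneg fun p _ => hγ0 _) (mul_nonneg (by norm_num) (inv_nonneg.2 (hLw _).le))
        _ = _ := by rw [hc, mul_assoc]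
    calc _ ≤ ∑ a ∈ I, 64 ^ q * c a ^ q := Finset.sum_le_sum h1
      _ ≤ ∑ a ∈ B, 64 ^ q * c a ^ q := Finset.sum_le_sum_of_subset_of_nonneg hIB fun a _ _ =>
          mul_nonneg (by positivity) (Real.rpow_nonneg (hc0 a) _)
      _ = 64 ^ q * ∑ a ∈ B, c a ^ q := (Finset.mul_sum _ _ _).symm
      _ ≤ 64 ^ q * (C * ∑ a ∈ B, γ a ^ q) := mul_le_mul_of_nonneg_left hmain (by positivity)
      _ = _ := by
        rw [mul_assoc]; congr 2
        exact Finset.sum_congr rfl fun a ha => by simp only [γ, if_pos ha]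
  have hhm : Measurable fun x => ENNReal.ofReal (h x ^ q) := (hm.pow_const q).ennreal_ofReal
  have hint : ∫⁻ x, ∑ a ∈ I, (VV S T a ⁻¹' E).indicator (fun _ => ENNReal.ofReal (lam ^ q)) x ∂μ ≤
      ∫⁻ x, ENNReal.ofReal (64 ^ q * C) * ∑ a ∈ B, ENNReal.ofReal (h (VV S T a x) ^ q) ∂μ := by
    refine lintegral_mono fun x => ?_
    rw [← ENNReal.ofReal_sum_of_nonneg (fun a _ => Real.rpow_nonneg (hh _) _), ← ENNReal.ofReal_mul (by positivity)]
    refine le_trans (le_of_eq ?_) (ENNReal.ofReal_le_ofReal (pw x))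
    rw [ENNReal.ofReal_sum_of_nonneg (fun a _ => indicator_nonneg (fun _ _ => by positivity) _)]
    refine Finset.sum_congr rfl fun a _ => ?_
    by_cases hx : x ∈ VV S T a ⁻¹' E
    · rw [indicator_of_mem hx, indicator_of_mem hx]
    · rw [indicator_of_notMem hx, indicator_of_notMem hx, ENNReal.ofReal_zero]
  have hVm := fun a => mp_VV μ S T hset a
  have hcm : ∀ a, Measurable fun x => ENNReal.ofReal (h (VV S T a x) ^ q) := fun a => hhm.comp (hVm a).measurable
  rw [lintegral_finsetSum _ (fun a _ => measurable_const.indicator ((hVm a).measurable hEm)),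
    lintegral_const_mul _ (by fun_prop),
    lintegral_finsetSum _ (fun a _ => hcm a)] at hint
  have e1 : ∀ a ∈ I, ∫⁻ x, (VV S T a ⁻¹' E).indicator (fun _ => ENNReal.ofReal (lam ^ q)) x ∂μ = ENNReal.ofReal (lam ^ q) * μ E := fun a _ => by
    rw [lintegral_indicator_const ((hVm a).measurable hEm), (hVm a).measure_preimage hEm.nullMeasurableSet]
  have e2 : ∀ a ∈ B, ∫⁻ x, ENNReal.ofReal (h (VV S T a x) ^ q) ∂μ = ∫⁻ x, ENNReal.ofReal (h x ^ q) ∂μ := fun a _ =>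
    (hVm a).lintegral_comp hhm
  rw [Finset.sum_congr rfl e1, Finset.sum_congr rfl e2, Finset.sum_const, Finset.sum_const, hI, hB, Finset.card_product, Finset.card_product,
    Int.card_Ico, Int.card_Ico, show ((3 * (ρ:ℤ) - ρ).toNat) = 2 * ρ by omega, show ((Q:ℤ) - 0).toNat = 4 * ρ by omega,
    nsmul_eq_mul, nsmul_eq_mul] at hint
  have hne : ((2 * ρ * (2 * ρ) : ℕ) : ℝ≥0∞) ≠ 0 := by
    rw [Nat.cast_ne_zero]; positivity
  rw [← ENNReal.mul_le_mul_iff_right hne (ENNReal.natCast_ne_top _)]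
  refine hint.trans (le_of_eq ?_)
  rw [ENNReal.ofReal_mul (by norm_num : (0:ℝ) ≤ 4)]
  push_cast
  rw [show ENNReal.ofReal 4 = 4 by simp]
  ring
end P17

section P18
lemma markov_p (μ : Measure X) (f : X → ℝ) (hf : Measurable f) {p lam : ℝ} (hp : 0 < p) (hl : 0 < lam) :
    ENNReal.ofReal (lam ^ p) * μ {x | lam < |f x|} ≤ ∫⁻ x, ENNReal.ofReal (|f x| ^ p) ∂μ := by
  refine le_trans ?_ (mul_meas_ge_le_lintegral (((hf.abs).pow_const p).ennreal_ofReal) (ENNReal.ofReal (lam ^ p)))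
  refine mul_le_mul_right (measure_mono fun x hx => ?_) _
  exact ENNReal.ofReal_le_ofReal (Real.rpow_le_rpow hl.le (le_of_lt hx) hp.le)

lemma bad_n (μ : Measure X) (S T : X ≃ᵐ X) (hset : ErgodicSetup μ S T) (P : Finset (ℤ × ℤ)) (f : X → ℝ) (hf : Measurable f)
    (lam : ℝ) (hl : 0 < lam) :
    μ {x | lam < AV S T P (fun y => |f y|) x} ≤ P.card * μ {x | lam < |f x|} := by
  have hsub : {x | lam < AV S T P (fun y => |f y|) x} ⊆ ⋃ a ∈ P, VV S T a ⁻¹' {x | lam < |f x|} := by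
    intro x hx
    by_contra hcon
    simp only [mem_iUnion, mem_preimage, mem_setOf_eq, not_exists, not_lt] at hcon
    have h1 : AV S T P (fun y => |f y|) x ≤ lam := by
      unfold AV
      rcases P.eq_empty_or_nonempty with rfl | hne
      · simpa using hl.le
      rw [inv_mul_le_iff₀ (by exact_mod_cast hne.card_pos)]
      have := Finset.sum_le_card_nsmul P _ lam hcon
      simpa [nsmul_eq_mul] using this
    exact absurd hx (not_lt.2 h1)
  refine (measure_mono hsub).trans ((measure_biUnion_finset_le _ _).trans (le_of_eq ?_))
  have hm : MeasurableSet {x | lam < |f x|} := measurableSet_lt measurable_const hf.abs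
  rw [Finset.sum_congr rfl fun a _ => (mp_VV μ S T hset a).measure_preimage hm.nullMeasurableSet, Finset.sum_const, nsmul_eq_mul]

lemma AV_split (S T : X ≃ᵐ X) (P : Finset (ℤ × ℤ)) (hne : P.Nonempty) (g h : X → ℝ) (c : ℝ) (hgh : ∀ x, g x ≤ c + h x) (x : X) :
    AV S T P g x ≤ c + AV S T P h x := by
  have hc : (0:ℝ) < P.card := by exact_mod_cast hne.card_pos
  unfold AV
  calc _ ≤ (P.card:ℝ)⁻¹ * ∑ p ∈ P, (c + h (VV S T p x)) :=
        mul_le_mul_of_nonneg_left (Finset.sum_le_sum fun p _ => hgh _) (by positivity)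
    _ = _ := by
      rw [Finset.sum_add_distrib, Finset.sum_const, nsmul_eq_mul, mul_add, inv_mul_cancel_left₀ hc.ne']

lemma final_meas (μ : Measure X) (S T : X ≃ᵐ X) (hset : ErgodicSetup μ S T) (P : ℕ → Finset (ℤ × ℤ)) (hne : ∀ n, (P n).Nonempty)
    (N0 : ℕ) {p q C : ℝ} (hq : 1 < q) (hqp : q < p) (hC : 0 ≤ C)
    (H : ∀ (N : ℕ) (h : X → ℝ), Measurable h → (∀ x, 0 ≤ h x) → ∀ lam : ℝ, 0 < lam →
      ENNReal.ofReal (lam ^ q) * μ {x | ∃ n < N, lam < AV S T (P (n + N0)) h x} ≤ ENNReal.ofReal C * ∫⁻ x, ENNReal.ofReal (h x ^ q) ∂μ)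
    (f : X → ℝ) (hf : Measurable f) (lam : ℝ) (hl : 0 < lam) :
    ENNReal.ofReal (lam ^ p) * μ {x | ∃ n, lam < AV S T (P n) (fun y => |f y|) x} ≤
      ENNReal.ofReal ((∑ n ∈ Finset.range N0, ((P n).card : ℝ)) + C * 2 ^ p) * ∫⁻ x, ENNReal.ofReal (|f x| ^ p) ∂μ := by
  set I := ∫⁻ x, ENNReal.ofReal (|f x| ^ p) ∂μ with hI
  set g : X → ℝ := fun y => |f y| with hg
  set h : X → ℝ := {x | lam / 2 < |f x|}.indicator g with hh
  have hms : MeasurableSet {x | lam / 2 < |f x|} := measurableSet_lt measurable_const hf.abs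
  have hhm : Measurable h := hf.abs.indicator hms
  have hh0 : ∀ x, 0 ≤ h x := fun x => indicator_nonneg (fun _ _ => abs_nonneg _) _
  have hl2 : 0 < lam / 2 := by positivity
  have hgh : ∀ x, g x ≤ lam / 2 + h x := by
    intro x
    by_cases hx : lam / 2 < |f x|
    · rw [hh, indicator_of_mem (by exact hx)]; linarith
    · rw [hh, indicator_of_notMem (by exact hx)]; simp only [hg]; linarith [not_lt.1 hx]
  have hpt : ∀ x, h x ^ q ≤ (lam / 2) ^ (q - p) * |f x| ^ p := by
    intro x
    by_cases hx : lam / 2 < |f x|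
    · rw [hh, indicator_of_mem (by exact hx)]
      have hfx : 0 < |f x| := hl2.trans hx
      have e : |f x| ^ q = |f x| ^ (q - p) * |f x| ^ p := by rw [← Real.rpow_add hfx]; ring_nf
      simp only [hg]
      rw [e]
      exact mul_le_mul_of_nonneg_right (Real.rpow_le_rpow_of_nonpos hl2 hx.le (by linarith)) (by positivity)
    · rw [hh, indicator_of_notMem (by exact hx), Real.zero_rpow (by linarith)]; positivity
  have hint : ∫⁻ x, ENNReal.ofReal (h x ^ q) ∂μ ≤ ENNReal.ofReal ((lam / 2) ^ (q - p)) * I := by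
    rw [hI, ← lintegral_const_mul _ ((hf.abs.pow_const p).ennreal_ofReal)]
    refine lintegral_mono fun x => ?_
    rw [← ENNReal.ofReal_mul (by positivity)]
    exact ENNReal.ofReal_le_ofReal (hpt x)
  have good : ∀ N, ENNReal.ofReal (lam ^ p) * μ {x | ∃ n < N, lam < AV S T (P (n + N0)) g x} ≤ ENNReal.ofReal (C * 2 ^ p) * I := by
    intro N
    have hsub : {x | ∃ n < N, lam < AV S T (P (n + N0)) g x} ⊆ {x | ∃ n < N, lam / 2 < AV S T (P (n + N0)) h x} := by
      rintro x ⟨n, hn, hx⟩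
      refine ⟨n, hn, ?_⟩
      linarith [AV_split S T (P (n + N0)) (hne _) g h (lam / 2) hgh x]
    have h1 := (H N h hhm hh0 (lam / 2) hl2).trans (mul_le_mul_right hint _)
    have e : ENNReal.ofReal (lam ^ p) = ENNReal.ofReal (lam ^ p * (lam / 2) ^ (-q)) * ENNReal.ofReal ((lam / 2) ^ q) := by
      rw [← ENNReal.ofReal_mul (by positivity), mul_assoc, ← Real.rpow_add hl2]; simp
    calc _ ≤ ENNReal.ofReal (lam ^ p) * μ {x | ∃ n < N, lam / 2 < AV S T (P (n + N0)) h x} := mul_le_mul_right (measure_mono hsub) _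
      _ ≤ ENNReal.ofReal (lam ^ p * (lam / 2) ^ (-q)) * (ENNReal.ofReal C * (ENNReal.ofReal ((lam / 2) ^ (q - p)) * I)) := by
        rw [e, mul_assoc]; exact mul_le_mul_right h1 _
      _ = _ := by
        rw [← mul_assoc, ← mul_assoc, ← ENNReal.ofReal_mul (by positivity), ← ENNReal.ofReal_mul (by positivity)]
        congr 2
        have : (lam / 2) ^ (-q) * (lam / 2) ^ (q - p) = (lam / 2) ^ (-p) := by rw [← Real.rpow_add hl2]; ring_nf
        rw [show lam ^ p * (lam / 2) ^ (-q) * C * (lam / 2) ^ (q - p) = lam ^ p * C * ((lam / 2) ^ (-q) * (lam / 2) ^ (q - p)) by ring, this,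
          Real.rpow_neg hl2.le, Real.div_rpow hl.le (by norm_num)]
        have := Real.rpow_pos_of_pos hl p
        field_simp
  have good' : ENNReal.ofReal (lam ^ p) * μ {x | ∃ n, lam < AV S T (P (n + N0)) g x} ≤ ENNReal.ofReal (C * 2 ^ p) * I := by
    have e : {x | ∃ n, lam < AV S T (P (n + N0)) g x} = ⋃ N, {x | ∃ n < N, lam < AV S T (P (n + N0)) g x} := by
      ext x
      simp only [mem_setOf_eq, mem_iUnion]
      exact ⟨fun ⟨n, hn⟩ => ⟨n + 1, n, n.lt_succ_self, hn⟩, fun ⟨_, n, _, hn⟩ => ⟨n, hn⟩⟩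
    have hmono : Monotone fun N => {x | ∃ n < N, lam < AV S T (P (n + N0)) g x} :=
      fun a b hab x ⟨n, hn, hx⟩ => ⟨n, hn.trans_le hab, hx⟩
    rw [e, hmono.measure_iUnion, ENNReal.mul_iSup]
    exact iSup_le good
  have bad : ENNReal.ofReal (lam ^ p) * μ {x | ∃ n < N0, lam < AV S T (P n) g x} ≤
      ENNReal.ofReal (∑ n ∈ Finset.range N0, ((P n).card : ℝ)) * I := by
    have hsub : {x | ∃ n < N0, lam < AV S T (P n) g x} ⊆ ⋃ n ∈ Finset.range N0, {x | lam < AV S T (P n) g x} := by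
      rintro x ⟨n, hn, hx⟩
      simp only [mem_iUnion]
      exact ⟨n, Finset.mem_range.2 hn, hx⟩
    have h1 := (measure_mono (μ := μ) hsub).trans (measure_biUnion_finset_le _ _)
    have h2 := h1.trans (Finset.sum_le_sum fun n _ => bad_n μ S T hset (P n) f hf lam hl)
    rw [← Finset.sum_mul] at h2
    refine (mul_le_mul_right h2 _).trans ?_
    rw [mul_left_comm, ENNReal.ofReal_sum_of_nonneg (fun _ _ => by positivity)]
    simp only [ENNReal.ofReal_natCast]
    exact mul_le_mul_right (markov_p μ f hf (by linarith) hl) _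
  have hall : {x | ∃ n, lam < AV S T (P n) g x} ⊆ {x | ∃ n < N0, lam < AV S T (P n) g x} ∪ {x | ∃ n, lam < AV S T (P (n + N0)) g x} := by
    rintro x ⟨n, hx⟩
    rcases lt_or_ge n N0 with hn | hn
    · exact Or.inl ⟨n, hn, hx⟩
    · exact Or.inr ⟨n - N0, by rwa [Nat.sub_add_cancel hn]⟩
  calc _ ≤ ENNReal.ofReal (lam ^ p) * (μ {x | ∃ n < N0, lam < AV S T (P n) g x} + μ {x | ∃ n, lam < AV S T (P (n + N0)) g x}) :=
        mul_le_mul_right ((measure_mono hall).trans (measure_union_le _ _)) _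
    _ ≤ _ := by
      rw [mul_add, ENNReal.ofReal_add (Finset.sum_nonneg fun _ _ => by positivity) (by positivity), add_mul]
      exact add_le_add bad good'

lemma main_weak (μ : Measure X) (S T : X ≃ᵐ X)
    (hsetup : ErgodicSetup μ S T) (R : ℕ → Rect) (hR : IsProcess R)
    (u : ℕ → ℝ) (hu01 : ∀ k, u k ∈ Set.Ioo (0 : ℝ) 1)
    (hlac : ∃ l ∈ Set.Ioo (0 : ℝ) 1, ∀ k, u (k + 1) ≤ l * u k)
    (hslope : ∀ n, ∃ k, (R n).slope = u k) (p : ℝ) (hp : 1 < p) :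
    IsWeakType μ (maxOp S T R) p := by
  choose k hk using hslope
  obtain ⟨h0, htd⟩ := hR
  have hfin : ∀ n, (latticePts (R n).carrier).Finite := fun n => rect_fin (R n) (hu01 (k n)).1 (hu01 (k n)).2 (hk n) (h0 n)
  obtain ⟨N0, hN0⟩ := eventually_atTop.1 (htd.eventually_ge_atTop 8)
  set P : ℕ → Finset (ℤ × ℤ) := fun n => (hfin n).toFinset with hPdef
  have hPm : ∀ n a, a ∈ P n ↔ a ∈ latticePts (R n).carrier := fun n a => (hfin n).mem_toFinset
  have hPc : ∀ n, (P n).card = latticeCount (R n).carrier := fun n => (Set.ncard_eq_toFinset_card _ (hfin n)).symm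
  have hne : ∀ n, (P n).Nonempty := fun n => ⟨(0, 0), (hPm n _).2 (by simpa [latticePts] using h0 n)⟩
  obtain ⟨q, C, hq, hqp, hC, H⟩ := trans_weak μ S T hsetup (fun n => R (n + N0)) u (fun k => (hu01 k).1) (fun k => (hu01 k).2) hlac
    (fun n => k (n + N0)) (fun n => hk _) (fun n => h0 _) (fun n => hN0 _ (by omega)) (fun n => P (n + N0)) (fun n => hPm _) (fun n => hPc _) hp
  set K := (∑ n ∈ Finset.range N0, ((P n).card : ℝ)) + C * 2 ^ p with hK
  have hK0 : 0 ≤ K := add_nonneg (Finset.sum_nonneg fun _ _ => by positivity) (by positivity)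
  refine ⟨K + 1, by linarith, fun f hf lam hl => ?_⟩
  obtain ⟨f', hf'm, hff'⟩ := hf.aestronglyMeasurable
  have hf'm := hf'm.measurable
  have hf' : MemLp f' (ENNReal.ofReal p) μ := hf.ae_eq hff'
  rw [eLpNorm_congr_ae hff']
  have hae : ∀ᵐ x ∂μ, ∀ a, f (VV S T a x) = f' (VV S T a x) :=
    ae_all_iff.2 fun a => (mp_VV μ S T hsetup a).quasiMeasurePreserving.ae hff'
  have hle : μ {x | ENNReal.ofReal lam < maxOp S T R f x} ≤ μ {x | ∃ n, lam < AV S T (P n) (fun y => |f' y|) x} := by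
    refine measure_mono_ae ?_
    filter_upwards [hae] with x hx hlt
    obtain ⟨n, hn⟩ := lt_iSup_iff.1 (show ENNReal.ofReal lam < ⨆ n, ENNReal.ofReal (ergAvg S T (R n) (fun y => |f y|) x) from hlt)
    refine ⟨n, ?_⟩
    have h1 := (ENNReal.ofReal_lt_ofReal_iff_of_nonneg hl.le).1 hn
    rw [ergAvg_eq S T (R n) (hfin n)] at h1
    simpa only [AV, hx] using h1
  refine hle.trans ?_
  have hmain := final_meas μ S T hsetup P hne N0 hq hqp hC H f' hf'm lam hl
  have hp0 : 0 < p := by linarith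
  have hI : ∫⁻ x, ENNReal.ofReal (|f' x| ^ p) ∂μ = ENNReal.ofReal ((eLpNorm f' (ENNReal.ofReal p) μ).toReal ^ p) := by
    rw [← ENNReal.ofReal_rpow_of_nonneg ENNReal.toReal_nonneg hp0.le, ENNReal.ofReal_toReal hf'.eLpNorm_ne_top,
      eLpNorm_eq_lintegral_rpow_enorm_toReal (by simpa using hp0) ENNReal.ofReal_ne_top, ENNReal.toReal_ofReal hp0.le, ← ENNReal.rpow_mul,
      one_div, inv_mul_cancel₀ hp0.ne', ENNReal.rpow_one]
    refine lintegral_congr fun x => ?_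
    rw [← ENNReal.ofReal_rpow_of_nonneg (abs_nonneg _) hp0.le, Real.enorm_eq_ofReal_abs]
  set A := (eLpNorm f' (ENNReal.ofReal p) μ).toReal
  have hA : 0 ≤ A := ENNReal.toReal_nonneg
  have hlp : 0 < lam ^ p := Real.rpow_pos_of_pos hl p
  rw [hI, ← ENNReal.ofReal_mul hK0] at hmain
  have hne0 : ENNReal.ofReal (lam ^ p) ≠ 0 := by simpa using hlp
  rw [← ENNReal.mul_le_mul_iff_right hne0 ENNReal.ofReal_ne_top, ← ENNReal.ofReal_mul hlp.le]
  refine hmain.trans (ENNReal.ofReal_le_ofReal ?_)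
  rw [Real.div_rpow hA hl.le, mul_left_comm, mul_div_cancel₀ _ hlp.ne']
  exact mul_le_mul_of_nonneg_right (by linarith) (by positivity)
end P18

/-- if the slopes of the rectangles of the process lie in a lacunary
subset of `(0,1)` converging to `0`, then `M*` is of weak-type `(p,p)` for all
`1 < p < ∞`. -/
theorem stmt4 {X : Type*} [MeasurableSpace X] (μ : Measure X) (S T : X ≃ᵐ X)
    (hsetup : ErgodicSetup μ S T) (R : ℕ → Rect) (hR : IsProcess R)
    (u : ℕ → ℝ) (hu01 : ∀ k, u k ∈ Set.Ioo (0 : ℝ) 1)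
    (hlac : ∃ l ∈ Set.Ioo (0 : ℝ) 1, ∀ k, u (k + 1) ≤ l * u k)
    (hu0 : Tendsto u atTop (𝓝 0))
    (hslope : ∀ n, ∃ k, (R n).slope = u k)
    (p : ℝ) (hp : 1 < p) :
    IsWeakType μ (maxOp S T R) p :=
  main_weak μ S T hsetup R hR u hu01 hlac hslope p hp

end
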